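/- arXiv:1404.5258 — 4 statements merged into one kernel-verified Lean document; each statement's English description precedes it below -/
import Mathlib

section
/- For every integer k ≥ 2 and every ε > 0 the following holds. Let p = p(n) ∈ (0,1] be a sequence with n·p(n) → ∞ as n → ∞. Then with probability tending to 1 as n → ∞, the p-random subfamily 𝒫(n,p) of the power set of {1,…,n} satisfies: every subfamily 𝒜 ⊆ 𝒫(n,p) containing no k-chain has |𝒜| ≤ (k−1+ε)·p·C(n,⌊n/2⌋), and there exists a subfamily 𝒜 ⊆ 𝒫(n,p) containing no k-chain with |𝒜| ≥ (k−1−ε)·p·C(n,⌊n/2⌋). -/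
open Finset

/-- A `k`-chain: `k` distinct sets totally ordered by strict inclusion. -/
def IsKChain {n : ℕ} (k : ℕ) (𝒞 : Finset (Finset (Fin n))) : Prop :=
  𝒞.card = k ∧ IsChain (· ⊂ ·) (𝒞 : Set (Finset (Fin n)))

/-- A family contains no `k`-chain. -/
def NoKChain {n : ℕ} (k : ℕ) (𝒜 : Finset (Finset (Fin n))) : Prop :=
  ∀ 𝒞 ⊆ 𝒜, ¬ IsKChain k 𝒞

open scoped Classical in
/-- The probability that the `p`-random subfamily `𝒫(n,p)` of the power set of `{1,…,n}`
(each set included independently with probability `p`) satisfies the property `Q`. -/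
noncomputable def probFamily (n : ℕ) (p : ℝ) (Q : Finset (Finset (Fin n)) → Prop) : ℝ :=
  ∑ 𝒜 : Finset (Finset (Fin n)),
    if Q 𝒜 then p ^ 𝒜.card * (1 - p) ^ (2 ^ n - 𝒜.card) else 0


lemma avg_aux {α : Type*} [DecidableEq α] (U : Finset (Finset α)) (g : Finset α → ℝ)
    (B : Finset α) :
    ∑ b ∈ B, ∑ A ∈ U with A ⊆ B.erase b, g A / ((B.card - 1).choose A.card : ℝ)
      = B.card * ∑ A ∈ U with A ⊂ B, g A / (B.card.choose A.card : ℝ) := by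
  classical
  simp only [Finset.sum_filter]
  rw [Finset.sum_comm, Finset.mul_sum]
  refine Finset.sum_congr rfl fun A _ => ?_
  by_cases h : A ⊂ B
  · rw [if_pos h, ← Finset.sum_filter]
    have h1 : (B.filter fun b => A ⊆ B.erase b) = B \ A := by
      ext b
      simp only [Finset.mem_filter, Finset.mem_sdiff, Finset.subset_erase]
      constructor
      · rintro ⟨h1, h2, h3⟩; exact ⟨h1, h3⟩
      · rintro ⟨h1, h3⟩; exact ⟨h1, h.1, h3⟩
    rw [h1, Finset.sum_const, Finset.card_sdiff_of_subset h.1, nsmul_eq_mul]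
    have hlt := Finset.card_lt_card h
    obtain ⟨m, hm⟩ : ∃ m, B.card = m + 1 := ⟨B.card - 1, by omega⟩
    have hle : A.card ≤ m := by omega
    rw [hm, Nat.cast_sub (by omega)]
    have e := Nat.choose_mul_succ_eq m A.card
    have e' : (m.choose A.card : ℝ) * ((m:ℝ) + 1) = ((m+1).choose A.card : ℝ) * ((m:ℝ) + 1 - A.card) := by
      have := congrArg (Nat.cast : ℕ → ℝ) e
      rw [Nat.cast_mul, Nat.cast_mul, Nat.cast_sub (by omega)] at this
      simpa using this
    have p1 : (0:ℝ) < (m.choose A.card : ℝ) := by exact_mod_cast Nat.choose_pos hle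
    have p2 : (0:ℝ) < ((m+1).choose A.card : ℝ) := by exact_mod_cast Nat.choose_pos (by omega)
    simp only [Nat.add_sub_cancel]
    push_cast
    rw [← mul_div_assoc, ← mul_div_assoc, div_eq_div_iff p1.ne' p2.ne']
    linear_combination (-g A) * e'
  · rw [if_neg h, mul_zero]
    refine Finset.sum_eq_zero fun b hb => if_neg fun h2 => h ?_
    exact Finset.ssubset_of_subset_of_ssubset h2 (Finset.erase_ssubset hb)

noncomputable def wt {α : Type*} [DecidableEq α] (U : Finset (Finset α)) (B : Finset α) : ℝ :=
  ∑ A ∈ U with A ⊂ B, 1 / (B.card.choose A.card : ℝ)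

lemma wt_nonneg {α : Type*} [DecidableEq α] (U : Finset (Finset α)) (B : Finset α) :
    0 ≤ wt U B := Finset.sum_nonneg fun _ _ => by positivity

lemma phi_le {α : Type*} [DecidableEq α] (U : Finset (Finset α)) (B : Finset α) :
    ∑ A ∈ U with A ⊆ B, (1 - wt U A) / (B.card.choose A.card : ℝ) ≤ 1 := by
  classical
  induction B using Finset.strongInduction with
  | H B ih =>
  by_cases hB : B ∈ U
  · have h1 : (U.filter fun A => A ⊆ B) = insert B (U.filter fun A => A ⊂ B) := by
      ext A
      simp only [Finset.mem_filter, Finset.mem_insert]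
      constructor
      · rintro ⟨h1, h2⟩
        rcases eq_or_ssubset_of_subset h2 with h | h
        · exact Or.inl h
        · exact Or.inr ⟨h1, h⟩
      · rintro (h | ⟨h1, h2⟩)
        · subst h; exact ⟨hB, subset_rfl⟩
        · exact ⟨h1, h2.1⟩
    rw [h1, Finset.sum_insert (by simp)]
    have : ∑ A ∈ U with A ⊂ B, (1 - wt U A) / (B.card.choose A.card : ℝ) ≤ wt U B := by
      unfold wt
      refine Finset.sum_le_sum fun A _ => ?_
      have := wt_nonneg U A
      unfold wt at this
      gcongr
      linarith
    simp only [Nat.choose_self, Nat.cast_one, div_one]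
    linarith
  · have h1 : (U.filter fun A => A ⊆ B) = (U.filter fun A => A ⊂ B) := by
      refine Finset.filter_congr fun A hA => ⟨fun h => ?_, fun h => h.1⟩
      rcases eq_or_ssubset_of_subset h with h | h
      · subst h; exact absurd hA hB
      · exact h
    rw [h1]
    rcases B.eq_empty_or_nonempty with h0 | h0
    · subst h0
      simp
    · have hc : (0:ℝ) < B.card := by exact_mod_cast h0.card_pos
      have := avg_aux U (fun A => 1 - wt U A) B
      have h2 : ∑ b ∈ B, ∑ A ∈ U with A ⊆ B.erase b, (1 - wt U A) / ((B.card - 1).choose A.card : ℝ)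
          ≤ ∑ b ∈ B, (1:ℝ) := by
        refine Finset.sum_le_sum fun b hb => ?_
        have := ih (B.erase b) (Finset.erase_ssubset hb)
        rwa [Finset.card_erase_of_mem hb] at this
      rw [this] at h2
      simp only [Finset.sum_const, nsmul_eq_mul, mul_one] at h2
      exact le_of_mul_le_mul_left (by linarith) hc

/-- supersaturation core -/
lemma supersat {n : ℕ} (U : Finset (Finset (Fin n))) (d D : ℝ) (hD : 0 < D) (hdD : d ≤ D)
    (hU : ∀ B ∈ U, ∀ A ∈ U, A ⊂ B → D ≤ (B.card.choose A.card : ℝ))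
    (hdeg : ∀ B ∈ U, ((U.filter fun A => A ⊂ B).card : ℝ) ≤ d) :
    (U.card : ℝ) * (1 - d / D) ≤ (n.choose (n/2) : ℝ) := by
  have h := phi_le U (Finset.univ : Finset (Fin n))
  simp only [Finset.subset_univ, Finset.filter_true, Finset.card_univ, Fintype.card_fin] at h
  have hN : (0:ℝ) < (n.choose (n/2) : ℝ) := by
    exact_mod_cast Nat.choose_pos (Nat.div_le_self _ _)
  have h2 : ∑ A ∈ U, (1 - d / D) / (n.choose (n/2) : ℝ) ≤
      ∑ A ∈ U, (1 - wt U A) / (n.choose A.card : ℝ) := by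
    refine Finset.sum_le_sum fun B hB => ?_
    have hw : wt U B ≤ d / D := by
      unfold wt
      calc _ ≤ ∑ A ∈ U with A ⊂ B, 1 / D := by
            refine Finset.sum_le_sum fun A hA => ?_
            rw [Finset.mem_filter] at hA
            exact one_div_le_one_div_of_le hD (hU B hB A hA.1 hA.2)
        _ = ((U.filter fun A => A ⊂ B).card : ℝ) / D := by
            rw [Finset.sum_const, nsmul_eq_mul]; ring
        _ ≤ d / D := by gcongr; exact hdeg B hB
    have hd1 : d / D ≤ 1 := by rw [div_le_one hD]; exact hdD
    have hB' : B.card ≤ n := by simpa using Finset.card_le_univ B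
    have : (0:ℝ) < (n.choose B.card : ℝ) := by exact_mod_cast Nat.choose_pos hB'
    have h3 : (n.choose B.card : ℝ) ≤ (n.choose (n/2) : ℝ) := by
      exact_mod_cast Nat.choose_le_middle _ _
    exact div_le_div₀ (by linarith) (by linarith) this h3
  rw [Finset.sum_const, nsmul_eq_mul, ← mul_div_assoc] at h2
  have := h2.trans h
  rwa [div_le_one hN] at this

lemma choose_lower_aux (r : ℕ) : ∀ a m : ℕ, r ≤ a → a ≤ m → (m - a + r).choose r ≤ m.choose a := by
  intro a m hra ham
  induction a, hra using Nat.le_induction generalizing m with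
  | base => rw [Nat.sub_add_cancel ham]
  | succ a hra ih =>
    obtain ⟨m, rfl⟩ : ∃ m', m = m' + 1 := ⟨m - 1, by omega⟩
    have := ih m (by omega)
    rw [Nat.succ_sub_succ]
    refine this.trans ?_
    rw [Nat.choose_succ_succ]; omega

lemma choose_lower (r a m : ℕ) (hr : r ≤ 3) (hra : r ≤ a) (ham : a + r ≤ m) :
    ((m:ℝ)/2) ^ r / 6 ≤ (m.choose a : ℝ) := by
  have key : ∀ b, r ≤ b → b + r ≤ m → 2 * b ≤ m → ((m:ℝ)/2) ^ r / 6 ≤ (m.choose b : ℝ) := by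
    intro b hb hb2 hb3
    have h1 := choose_lower_aux r b m hb (by omega)
    have h2 := Nat.pow_le_choose (α := ℝ) r (m - b + r)
    have h3 : ((m - b + r + 1 - r : ℕ) : ℝ) ^ r / (r.factorial : ℝ) ≤ ((m-b+r).choose r : ℝ) := h2
    have h4 : ((m-b+r).choose r : ℝ) ≤ (m.choose b : ℝ) := by exact_mod_cast h1
    refine le_trans ?_ (h3.trans h4)
    have h5 : (m:ℝ)/2 ≤ ((m - b + r + 1 - r : ℕ) : ℝ) := by
      rw [div_le_iff₀ (by norm_num)]
      norm_cast
      omega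
    have h6 : (r.factorial : ℝ) ≤ 6 := by
      have := Nat.factorial_le hr
      exact_mod_cast this
    have h7 : (0:ℝ) < (r.factorial : ℝ) := by exact_mod_cast r.factorial_pos
    exact div_le_div₀ (by positivity) (by gcongr) h7 h6
  rcases le_total (2 * a) m with h | h
  · exact key a hra ham h
  · rw [← Nat.choose_symm (by omega)]
    exact key (m - a) (by omega) (by omega) (by omega)

def BigF (n : ℕ) : Finset (Finset (Fin n)) := Finset.univ.filter fun A => n ≤ 4 * A.card
def SmallF (n : ℕ) : Finset (Finset (Fin n)) := Finset.univ.filter fun A => 4 * A.card < n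

lemma degree_lemma {n : ℕ} (hn : 12 ≤ n) (r : ℕ) (hr0 : 0 < r) (hr : r ≤ 3) (e : ℝ) (he : 0 < e)
    (he1 : e ≤ 1/2) (U : Finset (Finset (Fin n))) (hU : U ⊆ BigF n)
    (hcard : r * (1 + e) * (n.choose (n/2) : ℝ) < U.card) :
    ∃ B ∈ U, e / 6144 * (n:ℝ)^r ≤ ((U.filter fun A => A ⊂ B ∨ B ⊂ A).card : ℝ) := by
  by_contra hcon
  push Not at hcon
  have hn0 : (0:ℝ) < n := by exact_mod_cast (by omega : 0 < n)
  have hN : (0:ℝ) < (n.choose (n/2) : ℝ) := by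
    exact_mod_cast Nat.choose_pos (Nat.div_le_self _ _)
  have hcls : ∀ i ∈ Finset.range r, ((U.filter fun A => A.card % r = i).card : ℝ) ≤
      (1 + e) * (n.choose (n/2) : ℝ) := by
    intro i _
    set V := U.filter fun A => A.card % r = i with hV
    have hD : (0:ℝ) < ((n:ℝ)/8)^r/6 := by positivity
    have hdD : e / 6144 * (n:ℝ)^r ≤ e/2 * (((n:ℝ)/8)^r/6) := by
      rw [div_pow]
      have : (8:ℝ)^r ≤ 8^3 := pow_le_pow_right₀ (by norm_num) hr
      have h8 : (0:ℝ) < 8^r := by positivity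
      have : (n:ℝ)^r / 8^3 ≤ (n:ℝ)^r/8^r := by gcongr
      have h3 : (n:ℝ)^r / 8^3 = (n:ℝ)^r / 512 := by norm_num
      nlinarith
    have := supersat V (e / 6144 * (n:ℝ)^r) (((n:ℝ)/8)^r/6) hD (by nlinarith) ?_ ?_
    · have h2 : e / 6144 * (n:ℝ)^r / (((n:ℝ)/8)^r/6) ≤ e/2 := by
        rw [div_le_iff₀ hD]; exact hdD
      have h3 : (V.card:ℝ) * (1 - e/2) ≤ (n.choose (n/2) : ℝ) := by
        refine le_trans ?_ this
        gcongr
      have h4 : 1 ≤ (1 + e) * (1 - e/2) := by nlinarith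
      have h5 : (0:ℝ) ≤ V.card := by positivity
      calc (V.card:ℝ) ≤ V.card * ((1 + e) * (1 - e/2)) := le_mul_of_one_le_right h5 h4
        _ = (1+e) * (V.card * (1-e/2)) := by ring
        _ ≤ _ := by gcongr
    · intro B hB A hA hAB
      rw [hV, Finset.mem_filter] at hA hB
      have hA' := hU hA.1
      have hB' := hU hB.1
      simp only [BigF, Finset.mem_filter, Finset.mem_univ, true_and] at hA' hB'
      have hlt := Finset.card_lt_card hAB
      have hmod : A.card + r ≤ B.card := by
        have : A.card ≡ B.card [MOD r] := by rw [Nat.ModEq, hA.2, hB.2]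
        have := (Nat.modEq_iff_dvd' hlt.le).1 this
        have := Nat.le_of_dvd (by omega) this
        omega
      refine le_trans ?_ (choose_lower r A.card B.card hr (by omega) hmod)
      have : (n:ℝ)/8 ≤ (B.card:ℝ)/2 := by
        have : (n:ℝ) ≤ 4 * B.card := by exact_mod_cast hB'
        linarith
      gcongr
    · intro B hB
      have hBU : B ∈ U := (Finset.mem_filter.1 hB).1
      refine le_trans ?_ (hcon B hBU).le
      norm_cast
      refine Finset.card_le_card fun A hA => ?_
      simp only [hV, Finset.mem_filter] at hA ⊢
      exact ⟨hA.1.1, Or.inl hA.2⟩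
  have hsum : U.card = ∑ i ∈ Finset.range r, (U.filter fun A => A.card % r = i).card :=
    Finset.card_eq_sum_card_fiberwise fun A _ => by
      simpa using Nat.mod_lt _ hr0
  have : (U.card:ℝ) ≤ ∑ i ∈ Finset.range r, (1 + e) * (n.choose (n/2) : ℝ) := by
    rw [hsum]; push_cast; exact Finset.sum_le_sum hcls
  rw [Finset.sum_const, Finset.card_range, nsmul_eq_mul] at this
  linarith

noncomputable def EE (V : Type*) [Fintype V] (p : ℝ) (f : Finset V → ℝ) : ℝ :=
  ∑ R : Finset V, p ^ R.card * (1 - p) ^ (Fintype.card V - R.card) * f R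

lemma EE_one {V : Type*} [Fintype V] (p : ℝ) : EE V p (fun _ => 1) = 1 := by
  simp only [EE, mul_one]
  rw [Fintype.sum_pow_mul_eq_add_pow]; simp

lemma EE_add {V : Type*} [Fintype V] (p : ℝ) (f g : Finset V → ℝ) :
    EE V p (fun R => f R + g R) = EE V p f + EE V p g := by
  simp only [EE, mul_add, Finset.sum_add_distrib]

lemma EE_mul {V : Type*} [Fintype V] (p c : ℝ) (f : Finset V → ℝ) :
    EE V p (fun R => c * f R) = c * EE V p f := by
  simp only [EE, Finset.mul_sum]
  exact Finset.sum_congr rfl fun _ _ => by ring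

lemma EE_mono {V : Type*} [Fintype V] {p : ℝ} (h0 : 0 ≤ p) (h1 : p ≤ 1) {f g : Finset V → ℝ}
    (h : ∀ R, f R ≤ g R) : EE V p f ≤ EE V p g := by
  refine Finset.sum_le_sum fun R _ => ?_
  have : 0 ≤ 1 - p := by linarith
  exact mul_le_mul_of_nonneg_left (h R) (by positivity)

lemma EE_ins {V : Type*} [Fintype V] [DecidableEq V] (p : ℝ) (v : V) (G : Finset V → ℝ)
    (hG : ∀ R, G (insert v R) = G R) :
    EE V p (fun R => if v ∈ R then G R else 0) = p * EE V p G := by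
  have split : ∀ f : Finset V → ℝ, EE V p f = ∑ R ∈ (Finset.univ.erase v).powerset,
      p ^ R.card * (1-p)^(Fintype.card V - 1 - R.card) * ((1-p) * f R + p * f (insert v R)) := by
    intro f
    have hu : (Finset.univ : Finset (Finset V)) = (insert v (Finset.univ.erase v)).powerset := by
      rw [Finset.insert_erase (Finset.mem_univ v)]; simp
    rw [EE, hu, Finset.sum_powerset_insert (by simp), ← Finset.sum_add_distrib]
    refine Finset.sum_congr rfl fun R hR => ?_
    rw [Finset.mem_powerset] at hR
    have hv : v ∉ R := fun h => by simpa using hR h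
    have hc : R.card ≤ Fintype.card V - 1 := by
      have := Finset.card_le_card hR
      rwa [Finset.card_erase_of_mem (Finset.mem_univ v), Finset.card_univ] at this
    have hpos : 0 < Fintype.card V := Fintype.card_pos_iff.2 ⟨v⟩
    obtain ⟨m, hm⟩ : ∃ m, Fintype.card V = R.card + m + 1 := ⟨Fintype.card V - 1 - R.card, by omega⟩
    rw [Finset.card_insert_of_notMem hv, hm]
    have e1 : R.card + m + 1 - R.card = m + 1 := by omega
    have e2 : R.card + m + 1 - (R.card + 1) = m := by omega
    have e3 : R.card + m + 1 - 1 - R.card = m := by omega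
    rw [e1, e2, e3]; ring
  rw [split, split, Finset.mul_sum]
  refine Finset.sum_congr rfl fun R hR => ?_
  rw [Finset.mem_powerset] at hR
  have hv : v ∉ R := fun h => by simpa using hR h
  rw [if_neg hv, if_pos (Finset.mem_insert_self _ _), hG]
  ring

lemma EE_exp {V : Type*} [Fintype V] [DecidableEq V] (p t : ℝ) (U : Finset V) :
    EE V p (fun R => Real.exp (t * ((R ∩ U).card : ℝ))) = (1 + p * (Real.exp t - 1)) ^ U.card := by
  induction U using Finset.induction_on with
  | empty => simp [EE_one]
  | insert v U hv ih =>
    have : ∀ R : Finset V, Real.exp (t * ((R ∩ insert v U).card : ℝ)) =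
        Real.exp (t * ((R ∩ U).card : ℝ)) +
          (Real.exp t - 1) * (if v ∈ R then Real.exp (t * ((R ∩ U).card : ℝ)) else 0) := by
      intro R
      by_cases h : v ∈ R
      · rw [if_pos h, Finset.inter_insert_of_mem h, Finset.card_insert_of_notMem (by simp [hv])]
        push_cast
        rw [mul_add, Real.exp_add, mul_one]; ring
      · rw [if_neg h, Finset.inter_insert_of_notMem h]; ring
    simp only [this]
    rw [EE_add, EE_mul, EE_ins, ih, Finset.card_insert_of_notMem hv]
    · ring
    · intro R
      rw [Finset.insert_inter_of_notMem hv]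

lemma EE_exp_le {V : Type*} [Fintype V] [DecidableEq V] {p : ℝ} (h0 : 0 ≤ p) (h1 : p ≤ 1) (t : ℝ)
    (U : Finset V) :
    EE V p (fun R => Real.exp (t * ((R ∩ U).card : ℝ))) ≤
      Real.exp (p * U.card * (Real.exp t - 1)) := by
  rw [EE_exp]
  have h2 : 1 + p * (Real.exp t - 1) ≤ Real.exp (p * (Real.exp t - 1)) := by
    have := Real.add_one_le_exp (p * (Real.exp t - 1)); linarith
  have h3 : 0 ≤ 1 + p * (Real.exp t - 1) := by nlinarith [Real.exp_pos t]
  calc _ ≤ Real.exp (p * (Real.exp t - 1)) ^ U.card := pow_le_pow_left₀ h3 h2 _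
    _ = _ := by rw [← Real.exp_nat_mul]; congr 1; ring

open scoped Classical in
noncomputable def alph {n : ℕ} (S : Finset (Finset (Fin n))) : ℕ :=
  (S.powerset.filter fun I : Finset (Finset (Fin n)) => IsAntichain (· ⊆ ·) (I : Set (Finset (Fin n)))).sup Finset.card

lemma le_alph {n : ℕ} {S I : Finset (Finset (Fin n))} (h : I ⊆ S)
    (hI : IsAntichain (· ⊆ ·) (I : Set (Finset (Fin n)))) : I.card ≤ alph S := by
  classical
  unfold alph
  exact Finset.le_sup (f := Finset.card) (by simp [h, hI])

lemma exists_alph {n : ℕ} (S : Finset (Finset (Fin n))) :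
    ∃ I ⊆ S, IsAntichain (· ⊆ ·) (I : Set (Finset (Fin n))) ∧ I.card = alph S := by
  classical
  obtain ⟨I, hI, h⟩ := Finset.exists_mem_eq_sup
    (S.powerset.filter fun I : Finset (Finset (Fin n)) => IsAntichain (· ⊆ ·) (I : Set (Finset (Fin n))))
    ⟨∅, by simp⟩ Finset.card
  simp only [Finset.mem_filter, Finset.mem_powerset] at hI
  exact ⟨I, hI.1, hI.2, h.symm⟩

lemma alph_le_card {n : ℕ} (S : Finset (Finset (Fin n))) : alph S ≤ S.card := by
  obtain ⟨I, h, _, h2⟩ := exists_alph S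
  rw [← h2]; exact Finset.card_le_card h

noncomputable def ZZ (n : ℕ) (p t : ℝ) (U : Finset (Finset (Fin n))) : ℝ :=
  EE (Finset (Fin n)) p (fun R => Real.exp (t * (alph (R ∩ U) : ℝ)))

lemma ZZ_rec {n : ℕ} {p t : ℝ} (h0 : 0 ≤ p) (h1 : p ≤ 1) (ht : 0 ≤ t)
    (U : Finset (Finset (Fin n))) (v : Finset (Fin n)) :
    ZZ n p t U ≤ ZZ n p t (U.erase v) + p * Real.exp t *
      ZZ n p t ((U.erase v).filter fun A => ¬ (A ⊂ v ∨ v ⊂ A)) := by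
  set W := (U.erase v).filter fun A => ¬ (A ⊂ v ∨ v ⊂ A) with hW
  have hvW : v ∉ W := by simp [hW]
  have key : ∀ R : Finset (Finset (Fin n)), Real.exp (t * (alph (R ∩ U) : ℝ)) ≤
      Real.exp (t * (alph (R ∩ U.erase v) : ℝ)) + Real.exp t *
        (if v ∈ R then Real.exp (t * (alph (R ∩ W) : ℝ)) else 0) := by
    intro R
    obtain ⟨I, hIS, hI, hIc⟩ := exists_alph (R ∩ U)
    by_cases hv : v ∈ I
    · have hvR : v ∈ R := (Finset.mem_inter.1 (hIS hv)).1
      rw [if_pos hvR, ← Real.exp_add]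
      have : alph (R ∩ U) ≤ 1 + alph (R ∩ W) := by
        rw [← hIc]
        have h2 : (I.erase v).card ≤ alph (R ∩ W) := by
          refine le_alph (fun A hA => ?_) (hI.subset (by simp))
          rw [Finset.mem_erase] at hA
          have h3 := Finset.mem_inter.1 (hIS hA.2)
          simp only [hW, Finset.mem_inter, Finset.mem_filter, Finset.mem_erase]
          refine ⟨h3.1, ⟨hA.1, h3.2⟩, ?_⟩
          rintro (h | h)
          · exact hI hA.2 hv hA.1 h.1
          · exact hI hv hA.2 (Ne.symm hA.1) h.1
        rw [Finset.card_erase_of_mem hv] at h2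
        omega
      have h4 : (alph (R ∩ U) : ℝ) ≤ 1 + alph (R ∩ W) := by exact_mod_cast this
      have h5 : Real.exp (t * (alph (R ∩ U) : ℝ)) ≤ Real.exp (t + t * (alph (R ∩ W) : ℝ)) := by
        apply Real.exp_le_exp.2; nlinarith
      have := Real.exp_pos (t * (alph (R ∩ U.erase v) : ℝ))
      linarith
    · have : alph (R ∩ U) ≤ alph (R ∩ U.erase v) := by
        rw [← hIc]
        refine le_alph (fun A hA => ?_) hI
        have h3 := Finset.mem_inter.1 (hIS hA)
        simp only [Finset.mem_inter, Finset.mem_erase]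
        exact ⟨h3.1, fun h => hv (h ▸ hA), h3.2⟩
      have h4 : (alph (R ∩ U) : ℝ) ≤ alph (R ∩ U.erase v) := by exact_mod_cast this
      have h5 : Real.exp (t * (alph (R ∩ U) : ℝ)) ≤ Real.exp (t * (alph (R ∩ U.erase v) : ℝ)) := by
        apply Real.exp_le_exp.2; nlinarith
      have : 0 ≤ Real.exp t * (if v ∈ R then Real.exp (t * (alph (R ∩ W) : ℝ)) else 0) := by
        split_ifs <;> positivity
      linarith
  unfold ZZ
  refine (EE_mono h0 h1 key).trans ?_
  rw [EE_add, EE_mul, EE_ins]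
  · apply le_of_eq; ring
  · intro R; rw [Finset.insert_inter_of_notMem hvW]

lemma ZZ_base {n : ℕ} {p t : ℝ} (h0 : 0 ≤ p) (h1 : p ≤ 1) (ht : 0 ≤ t)
    (U : Finset (Finset (Fin n))) :
    ZZ n p t U ≤ Real.exp (p * U.card * (Real.exp t - 1)) := by
  refine le_trans (EE_mono h0 h1 fun R => ?_) (EE_exp_le h0 h1 t U)
  apply Real.exp_le_exp.2
  gcongr
  exact alph_le_card _

lemma ZZ_phase {n : ℕ} {p t : ℝ} (h0 : 0 ≤ p) (h1 : p ≤ 1) (ht : 0 ≤ t)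
    (𝓜 : Finset (Finset (Fin n))) (M B d : ℝ) (hd : 0 < d) (hB : 0 ≤ B)
    (hbase : ∀ U ⊆ 𝓜, (U.card : ℝ) ≤ M → ZZ n p t U ≤ B)
    (hdeg : ∀ U ⊆ 𝓜, M < (U.card : ℝ) →
      ∃ v ∈ U, d ≤ ((U.filter fun A => A ⊂ v ∨ v ⊂ A).card : ℝ))
    (U : Finset (Finset (Fin n))) (hU : U ⊆ 𝓜) :
    ZZ n p t U ≤ B * Real.exp (Real.sqrt (p * Real.exp t / d) * U.card) := by
  set q := p * Real.exp t with hq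
  have hq0 : 0 ≤ q := by positivity
  set y := Real.sqrt (q / d) with hy
  have hy0 : 0 ≤ y := Real.sqrt_nonneg _
  have hyd : y * y * d = q := by
    rw [hy, Real.mul_self_sqrt (by positivity)]; field_simp
  have hyq : 1 + q * Real.exp (-(y*d)) ≤ Real.exp y := by
    have e1 : y * d ≤ Real.exp (y*d) := by have := Real.add_one_le_exp (y*d); linarith
    have e2 : q * Real.exp (-(y*d)) ≤ y := by
      rw [Real.exp_neg, ← div_eq_mul_inv, div_le_iff₀ (Real.exp_pos _), ← hyd]
      nlinarith
    have := Real.add_one_le_exp y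
    linarith
  induction U using Finset.strongInduction with
  | H U ih =>
  by_cases hM : (U.card : ℝ) ≤ M
  · refine (hbase U hU hM).trans (le_mul_of_one_le_right hB (Real.one_le_exp (by positivity)))
  · push Not at hM
    obtain ⟨v, hv, hdv⟩ := hdeg U hU hM
    have hs1 : U.erase v ⊂ U := Finset.erase_ssubset hv
    set W := (U.erase v).filter fun A => ¬ (A ⊂ v ∨ v ⊂ A) with hW
    have hs2 : W ⊂ U := Finset.ssubset_of_subset_of_ssubset (Finset.filter_subset _ _) hs1
    have i1 := ih _ hs1 (hs1.1.trans hU)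
    have i2 := ih _ hs2 (hs2.1.trans hU)
    have c1 : ((U.erase v).card : ℝ) = U.card - 1 := by
      have := Finset.card_erase_add_one hv
      rw [← this]; push_cast; ring
    have c2 : (W.card : ℝ) ≤ U.card - 1 - d := by
      have h3 := Finset.card_filter_add_card_filter_not (s := U.erase v) (fun A => A ⊂ v ∨ v ⊂ A)
      have h4 : ((U.erase v).filter fun A => A ⊂ v ∨ v ⊂ A) = U.filter fun A => A ⊂ v ∨ v ⊂ A := by
        ext A
        simp only [Finset.mem_filter, Finset.mem_erase]
        constructor
        · rintro ⟨⟨_, a⟩, b⟩; exact ⟨a, b⟩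
        · rintro ⟨a, b⟩
          refine ⟨⟨?_, a⟩, b⟩
          rintro rfl
          simp at b
      rw [h4] at h3
      have h5 : ((U.filter fun A => A ⊂ v ∨ v ⊂ A).card : ℝ) + W.card = (U.erase v).card := by
        exact_mod_cast h3
      linarith
    refine (ZZ_rec h0 h1 ht U v).trans ?_
    rw [← hq, ← hW]
    have i3 : ZZ n p t W ≤ B * (Real.exp (y * (U.card - 1)) * Real.exp (-(y*d))) := by
      refine i2.trans ?_
      rw [← Real.exp_add]
      gcongr
      nlinarith
    rw [c1] at i1
    calc _ ≤ B * Real.exp (y * (U.card - 1)) + q * (B * (Real.exp (y * (U.card - 1)) * Real.exp (-(y*d)))) := by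
          gcongr
      _ = B * Real.exp (y * (U.card - 1)) * (1 + q * Real.exp (-(y*d))) := by ring
      _ ≤ B * Real.exp (y * (U.card - 1)) * Real.exp y := by gcongr
      _ = B * Real.exp (y * U.card) := by
          rw [mul_assoc, ← Real.exp_add]; congr 2; ring

lemma two_pow_le_mid (n : ℕ) : (2:ℝ)^n ≤ ((n:ℝ) + 1) * (n.choose (n/2) : ℝ) := by
  have h : 2 ^ n ≤ (n + 1) * n.choose (n/2) := by
    rw [← Nat.sum_range_choose]
    refine (Finset.sum_le_card_nsmul _ _ _ fun m _ => Nat.choose_le_middle m n).trans ?_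
    simp
  exact_mod_cast h

lemma ZZ_bound {n : ℕ} (hn : 12 ≤ n) {p e : ℝ} (h0 : 0 < p) (h1 : p ≤ 1) (he : 0 < e)
    (he1 : e ≤ 1/2) :
    ZZ n p e (BigF n) ≤ Real.exp (p * ((1 + e) * (n.choose (n/2) : ℝ)) * (Real.exp e - 1)
      + Real.sqrt (p * Real.exp e / (e / 6144 * (n:ℝ))) * (6 * (n.choose (n/2) : ℝ))
      + Real.sqrt (p * Real.exp e / (e / 6144 * (n:ℝ)^3)) * 2^n) := by
  have hn0 : (0:ℝ) < n := by exact_mod_cast (by omega : 0 < n)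
  have hN : (0:ℝ) < (n.choose (n/2) : ℝ) := by
    exact_mod_cast Nat.choose_pos (Nat.div_le_self _ _)
  set N := (n.choose (n/2) : ℝ) with hNdef
  have hee : 0 ≤ Real.exp e - 1 := by have := Real.one_le_exp he.le; linarith
  have s1 := ZZ_phase (n := n) h0.le h1 he.le (BigF n) ((1 + e) * N)
    (Real.exp (p * ((1+e) * N) * (Real.exp e - 1))) (e / 6144 * (n:ℝ)) (by positivity)
    (by positivity)
    (fun U _ hc => (ZZ_base h0.le h1 he.le U).trans (by
      apply Real.exp_le_exp.2
      gcongr))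
    (fun U hU hc => by
      have := degree_lemma hn 1 (by norm_num) (by norm_num) e he he1 U hU (by
        rw [← hNdef]; simpa using hc)
      simpa using this)
  have s2 := ZZ_phase (n := n) h0.le h1 he.le (BigF n) (3 * (1 + e) * N)
    (Real.exp (p * ((1+e) * N) * (Real.exp e - 1)) *
      Real.exp (Real.sqrt (p * Real.exp e / (e / 6144 * (n:ℝ))) * (6 * N)))
    (e / 6144 * (n:ℝ)^3) (by positivity)
    (by positivity)
    (fun U hU hc => (s1 U hU).trans (by
      gcongr
      nlinarith))
    (fun U hU hc => by
      exact degree_lemma hn 3 (by norm_num) (by norm_num) e he he1 U hU (by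
        rw [← hNdef]; simpa using hc))
  refine (s2 (BigF n) subset_rfl).trans ?_
  rw [Real.exp_add, Real.exp_add]
  gcongr
  have : (BigF n).card ≤ 2 ^ n := by simpa using Finset.card_le_univ (BigF n)
  exact_mod_cast this

lemma exp_quad {x : ℝ} (hx : |x| ≤ 1) : Real.exp x - 1 ≤ x + x^2 := by
  have := (abs_le.1 (Real.abs_exp_sub_one_sub_id_le hx)).2
  linarith

lemma upper_bound {n : ℕ} (hn : 12 ≤ n) {p e : ℝ} (h0 : 0 < p) (h1 : p ≤ 1) (he : 0 < e)
    (he1 : e ≤ 1/2) (hK : 3072 / (e / 6144 * e^4) ≤ n * p) :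
    EE (Finset (Fin n)) p (fun R => Real.exp (-(e * (1 + 3 * e) * (p * (n.choose (n/2) : ℝ)))) *
      Real.exp (e * (alph (R ∩ BigF n) : ℝ))) ≤
      Real.exp (-(e^2/4) * (p * (n.choose (n/2) : ℝ))) := by
  have hn0 : (0:ℝ) < n := by exact_mod_cast (by omega : 0 < n)
  have hn1 : (1:ℝ) ≤ n := by exact_mod_cast (by omega : 1 ≤ n)
  have hN : (0:ℝ) < (n.choose (n/2) : ℝ) := by
    exact_mod_cast Nat.choose_pos (Nat.div_le_self _ _)
  have h2n := two_pow_le_mid n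
  have hZ := ZZ_bound hn h0 h1 he he1
  rw [EE_mul]
  change _ * ZZ n p e (BigF n) ≤ _
  set N := (n.choose (n/2) : ℝ) with hNdef
  refine (mul_le_mul_of_nonneg_left hZ (Real.exp_pos _).le).trans ?_
  rw [← Real.exp_add]
  apply Real.exp_le_exp.2
  have hexp : Real.exp e - 1 ≤ e + e^2 := exp_quad (by rw [abs_of_pos he]; linarith)
  have hexp3 : Real.exp e ≤ 3 := by nlinarith
  set s := Real.sqrt (p * Real.exp e / (e / 6144 * (n:ℝ))) with hs
  have hs0 : 0 ≤ s := Real.sqrt_nonneg _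
  have hs1 : s ≤ e^2 * p / 32 := by
    apply Real.sqrt_le_iff.2
    refine ⟨by positivity, ?_⟩
    rw [div_le_iff₀ (by positivity)] at hK ⊢
    have : p * (3 * 1024) ≤ p * (n * p * (e / 6144 * e ^ 4)) := by
      apply mul_le_mul_of_nonneg_left _ h0.le; linarith
    have h3 : p * Real.exp e ≤ p * 3 := by gcongr
    have : (e ^ 2 * p / 32) ^ 2 * (e / 6144 * ↑n) = p * (n * p * (e / 6144 * e ^ 4)) / 1024 := by ring
    rw [this]; linarith
  have hs3 : Real.sqrt (p * Real.exp e / (e / 6144 * (n:ℝ)^3)) = s / n := by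
    have : p * Real.exp e / (e / 6144 * (n:ℝ)^3) = p * Real.exp e / (e / 6144 * (n:ℝ)) / n^2 := by
      field_simp
    rw [this, Real.sqrt_div' _ (by positivity), Real.sqrt_sq hn0.le]
  rw [hs3]
  have t1 : s / n * 2 ^ n ≤ s * (2 * N) := by
    have : (2:ℝ)^n ≤ n * (2 * N) := by nlinarith
    calc s / n * 2^n ≤ s / n * (n * (2 * N)) := by gcongr
      _ = s * (2 * N) := by field_simp
  have t2 : s * (8 * N) ≤ e^2/4 * (p * N) := by
    calc s * (8 * N) ≤ e^2 * p / 32 * (8 * N) := by gcongr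
      _ = _ := by ring
  have t3 : p * ((1 + e) * N) * (Real.exp e - 1) ≤ p * ((1+e) * N) * (e + e^2) := by gcongr
  have t4 : p * ((1+e) * N) * (e + e^2) - e * (1 + 3 * e) * (p * N) ≤ -(e^2/2) * (p * N) := by
    have : (1+e)*(e+e^2) - e * (1+3*e) ≤ -(e^2/2) := by nlinarith [sq_nonneg e]
    have hpN : 0 < p * N := by positivity
    nlinarith
  nlinarith

lemma small_bound {n : ℕ} {p e : ℝ} (h0 : 0 < p) (h1 : p ≤ 1) (he : 0 < e)
    (he1 : e ≤ 1/2) (hO : ((SmallF n).card : ℝ) ≤ e / 4 * (n.choose (n/2) : ℝ)) :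
    EE (Finset (Fin n)) p (fun R => Real.exp (-(e * (p * (n.choose (n/2) : ℝ)))) *
      Real.exp (1 * ((R ∩ SmallF n).card : ℝ))) ≤
      Real.exp (-(e^2/4) * (p * (n.choose (n/2) : ℝ))) := by
  rw [EE_mul]
  refine (mul_le_mul_of_nonneg_left (EE_exp_le h0.le h1 1 _) (Real.exp_pos _).le).trans ?_
  rw [← Real.exp_add]
  apply Real.exp_le_exp.2
  have hexp := exp_quad (x := 1) (by simp)
  have hN : (0:ℝ) < (n.choose (n/2) : ℝ) := by
    exact_mod_cast Nat.choose_pos (Nat.div_le_self _ _)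
  set N := (n.choose (n/2) : ℝ)
  have : p * (SmallF n).card * (Real.exp 1 - 1) ≤ p * (e / 4 * N) * 2 := by
    have := Real.add_one_le_exp (1:ℝ)
    exact mul_le_mul (by gcongr) (by linarith) (by linarith) (by positivity)
  have hpN : 0 < p * N := by positivity
  nlinarith [mul_pos he hpN]

lemma lower_bound {n : ℕ} {p e : ℝ} (h0 : 0 < p) (h1 : p ≤ 1) (he : 0 < e)
    (he1 : e ≤ 1/2) (L : Finset (Finset (Fin n))) (hL : (n.choose (n/2) : ℝ) ≤ L.card) :
    EE (Finset (Fin n)) p (fun R => Real.exp (e / 2 * (1 - e) * (p * L.card)) *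
      Real.exp ((-(e/2)) * ((R ∩ L).card : ℝ))) ≤
      Real.exp (-(e^2/4) * (p * (n.choose (n/2) : ℝ))) := by
  rw [EE_mul]
  refine (mul_le_mul_of_nonneg_left (EE_exp_le h0.le h1 _ _) (Real.exp_pos _).le).trans ?_
  rw [← Real.exp_add]
  apply Real.exp_le_exp.2
  have hexp := exp_quad (x := -(e/2)) (by rw [abs_neg, abs_of_pos (by positivity)]; linarith)
  have : p * L.card * (Real.exp (-(e/2)) - 1) ≤ p * L.card * (-(e/2) + (-(e/2))^2) := by
    gcongr
  have h3 : e^2/4 * (p * (n.choose (n/2) : ℝ)) ≤ e^2/4 * (p * L.card) := by gcongr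
  nlinarith

lemma small_card (n : ℕ) : ((SmallF n).card : ℝ) ≤ (9/5 : ℝ)^n := by
  have h := Fintype.sum_pow_mul_eq_add_pow (R := ℝ) (Fin n) ((3/4)^4) 1
  simp only [one_pow, mul_one, Fintype.card_fin] at h
  have h2 : ∑ A ∈ SmallF n, ((3/4:ℝ))^n ≤ ∑ A : Finset (Fin n), (((3/4:ℝ))^4)^A.card := by
    refine le_trans (Finset.sum_le_sum (g := fun A => (((3/4:ℝ))^4)^A.card) fun A hA => ?_)
      (Finset.sum_le_sum_of_subset_of_nonneg (Finset.subset_univ _) fun _ _ _ => by positivity)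
    simp only [SmallF, Finset.mem_filter] at hA
    rw [← pow_mul]
    exact pow_le_pow_of_le_one (by norm_num) (by norm_num) hA.2.le
  rw [h, Finset.sum_const, nsmul_eq_mul] at h2
  have h3 : ((3/4:ℝ)^4+1)^n ≤ (9/5)^n * (3/4)^n := by
    rw [← mul_pow]; gcongr; norm_num
  exact le_of_mul_le_mul_right (h2.trans h3) (by positivity)

lemma small_eventually (e : ℝ) (he : 0 < e) : ∀ᶠ n : ℕ in Filter.atTop,
    ((SmallF n).card : ℝ) ≤ e / 4 * (n.choose (n/2) : ℝ) := by
  have t := tendsto_self_mul_const_pow_of_lt_one (r := 9/10) (by norm_num) (by norm_num)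
  have := t.eventually (gt_mem_nhds (show (0:ℝ) < e / 8 by positivity))
  filter_upwards [this, Filter.eventually_ge_atTop 1] with n hn hn1
  have h1 := small_card n
  have h2 := two_pow_le_mid n
  have hn1' : (1:ℝ) ≤ n := by exact_mod_cast hn1
  have hN : (0:ℝ) ≤ (n.choose (n/2) : ℝ) := by positivity
  have h3 : (9/5:ℝ)^n = (9/10)^n * 2^n := by rw [← mul_pow]; norm_num
  have h4 : (0:ℝ) ≤ (9/10:ℝ)^n := by positivity
  calc _ ≤ (9/10:ℝ)^n * 2^n := by rw [← h3]; exact h1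
    _ ≤ (9/10:ℝ)^n * (2 * n * (n.choose (n/2) : ℝ)) := by
        gcongr
        nlinarith
    _ = 2 * (n * (9/10:ℝ)^n) * (n.choose (n/2) : ℝ) := by ring
    _ ≤ 2 * (e/8) * (n.choose (n/2) : ℝ) := by gcongr
    _ = _ := by ring

lemma layer_ratio (i : ℕ) : Filter.Tendsto
    (fun n : ℕ => (n.choose (n/2 + i) : ℝ) / (n.choose (n/2) : ℝ)) Filter.atTop (nhds 1) := by
  induction i with
  | zero =>
    refine Filter.Tendsto.congr (fun n => ?_) tendsto_const_nhds
    have hN : (0:ℝ) < (n.choose (n/2) : ℝ) := by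
      exact_mod_cast Nat.choose_pos (Nat.div_le_self _ _)
    simp [hN.ne']
  | succ i ih =>
    have hr : Filter.Tendsto (fun n : ℕ => ((n - (n/2 + i) : ℕ) : ℝ) / ((n/2 + i + 1 : ℕ) : ℝ))
        Filter.atTop (nhds 1) := by
      have hlow : Filter.Tendsto (fun n : ℕ => 1 - (2 * (2 * (i:ℝ) + 1)) / (n:ℝ)) Filter.atTop (nhds 1) := by
        have := (tendsto_const_div_atTop_nhds_zero_nat (2 * (2 * (i:ℝ) + 1))).const_sub 1
        simpa using this
      refine tendsto_of_tendsto_of_tendsto_of_le_of_le' hlow tendsto_const_nhds ?_ ?_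
      · filter_upwards [Filter.eventually_ge_atTop (2 * i + 2)] with n hn
        have hn0 : (0:ℝ) < n := by exact_mod_cast (by omega : 0 < n)
        have hb : (0:ℝ) < ((n/2 + i + 1 : ℕ) : ℝ) := by positivity
        rw [le_div_iff₀ hb]
        have e1 : ((n - (n/2 + i) : ℕ) : ℝ) + (2 * (i:ℝ) + 1) ≥ ((n/2 + i + 1 : ℕ) : ℝ) := by
          norm_cast; omega
        have e2 : (n:ℝ) ≤ 2 * ((n/2 + i + 1 : ℕ) : ℝ) := by norm_cast; omega
        have e3 : 2 * (2 * (i:ℝ) + 1) / (n:ℝ) * ((n/2 + i + 1 : ℕ) : ℝ) ≥ 2 * (i:ℝ) + 1 := by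
          rw [ge_iff_le, div_mul_eq_mul_div, le_div_iff₀ hn0]
          nlinarith
        linarith
      · filter_upwards with n
        have hb : (0:ℝ) < ((n/2 + i + 1 : ℕ) : ℝ) := by positivity
        rw [div_le_one hb]
        norm_cast; omega
    have := ih.mul hr
    rw [one_mul] at this
    refine this.congr fun n => ?_
    have e := Nat.choose_succ_right_eq n (n/2 + i)
    have e' : (n.choose (n/2 + i + 1) : ℝ) * ((n/2 + i + 1 : ℕ) : ℝ) =
        (n.choose (n/2 + i) : ℝ) * ((n - (n/2 + i) : ℕ) : ℝ) := by exact_mod_cast e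
    have hN : (0:ℝ) < (n.choose (n/2) : ℝ) := by
      exact_mod_cast Nat.choose_pos (Nat.div_le_self _ _)
    have hb : (0:ℝ) < ((n/2 + i + 1 : ℕ) : ℝ) := by positivity
    rw [div_mul_div_comm, div_eq_div_iff (by positivity) hN.ne', ← e', ← add_assoc]
    ring

def LayF (n j : ℕ) : Finset (Finset (Fin n)) :=
  Finset.univ.filter fun A => n/2 ≤ A.card ∧ A.card < n/2 + j

lemma LayF_card (n j : ℕ) : (LayF n j).card = ∑ i ∈ Finset.range j, n.choose (n/2 + i) := by
  have h : (LayF n j).card = ∑ i ∈ Finset.range j,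
      ((LayF n j).filter fun A => A.card - n/2 = i).card :=
    Finset.card_eq_sum_card_fiberwise fun A hA => by
      simp [LayF] at hA ⊢
      omega
  rw [h]
  refine Finset.sum_congr rfl fun i hi => ?_
  rw [Finset.mem_range] at hi
  have : ((LayF n j).filter fun A => A.card - n/2 = i) =
      Finset.powersetCard (n/2 + i) Finset.univ := by
    ext A
    simp only [LayF, Finset.mem_filter, Finset.mem_univ, true_and, Finset.mem_powersetCard,
      Finset.subset_univ]
    omega
  rw [this, Finset.card_powersetCard]
  simp

lemma LayF_noKChain (n j : ℕ) (S : Finset (Finset (Fin n))) : NoKChain (j + 1) (S ∩ LayF n j) := by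
  intro C hC hk
  have hinj : Set.InjOn (fun A : Finset (Fin n) => A.card) (C : Set (Finset (Fin n))) := by
    intro A hA B hB hAB
    by_contra hne
    rcases hk.2 hA hB hne with h | h
    · exact absurd (Finset.card_lt_card h) (by simp only at hAB; omega)
    · exact absurd (Finset.card_lt_card h) (by simp only at hAB; omega)
  have h1 : C.card ≤ (Finset.Ico (n/2) (n/2 + j)).card := by
    refine Finset.card_le_card_of_injOn (fun A => A.card) (fun A hA => ?_) hinj
    have := (Finset.mem_inter.1 (hC hA)).2
    simpa [LayF] using this
  rw [hk.1] at h1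
  simp at h1

lemma LayF_large (j : ℕ) (e : ℝ) (he : 0 < e) : ∀ᶠ n : ℕ in Filter.atTop,
    j * (1 - e) * (n.choose (n/2) : ℝ) ≤ (LayF n j).card := by
  have : ∀ i ∈ Finset.range j, ∀ᶠ n : ℕ in Filter.atTop,
      1 - e < (n.choose (n/2 + i) : ℝ) / (n.choose (n/2) : ℝ) := fun i _ =>
    (layer_ratio i).eventually (lt_mem_nhds (by linarith))
  rw [← Filter.eventually_all_finset] at this
  filter_upwards [this] with n hn
  rw [LayF_card]
  push_cast
  have hN : (0:ℝ) < (n.choose (n/2) : ℝ) := by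
    exact_mod_cast Nat.choose_pos (Nat.div_le_self _ _)
  have : ∑ i ∈ Finset.range j, (1 - e) * (n.choose (n/2) : ℝ) ≤
      ∑ i ∈ Finset.range j, (n.choose (n/2 + i) : ℝ) :=
    Finset.sum_le_sum fun i hi => ((lt_div_iff₀ hN).1 (hn i hi)).le
  simpa [mul_assoc] using this

lemma LayF_ge (n j : ℕ) (hj : 1 ≤ j) : (n.choose (n/2) : ℝ) ≤ (LayF n j).card := by
  rw [LayF_card]
  norm_cast
  exact Finset.single_le_sum (f := fun i => n.choose (n/2 + i)) (fun _ _ => Nat.zero_le _)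
    (Finset.mem_range.2 hj)

lemma mirsky {n : ℕ} (j : ℕ) (A : Finset (Finset (Fin n))) (b : ℝ) (hA : NoKChain (j + 1) A)
    (hb : ∀ I ⊆ A, IsAntichain (· ⊆ ·) (I : Set (Finset (Fin n))) → (I.card : ℝ) ≤ b) :
    (A.card : ℝ) ≤ j * b := by
  classical
  induction j generalizing A with
  | zero =>
    have : A = ∅ := by
      by_contra h
      obtain ⟨x, hx⟩ := Finset.nonempty_iff_ne_empty.2 h
      exact hA {x} (by simpa using hx) ⟨by simp, by simp⟩
    simp [this]
  | succ j ih =>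
    set I := A.filter fun x => ∀ y ∈ A, ¬ y ⊂ x with hI
    have h1 : (I.card : ℝ) ≤ b := by
      refine hb I (Finset.filter_subset _ _) ?_
      intro x hx y hy hxy hsub
      simp only [hI, Finset.coe_filter, Set.mem_ofPred_eq] at hx hy
      exact hy.2 x hx.1 (lt_of_le_of_ne hsub hxy)
    have h2 : ((A \ I).card : ℝ) ≤ j * b := by
      refine ih (A \ I) ?_ fun J hJ => hb J (hJ.trans Finset.sdiff_subset)
      intro C hC hk
      have hne : C.Nonempty := by
        rw [← Finset.card_pos, hk.1]; omega
      obtain ⟨m, hm, hmin⟩ := C.exists_minimal hne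
      have hmA := Finset.mem_sdiff.1 (hC hm)
      have : ∃ y ∈ A, y ⊂ m := by
        by_contra hcon
        push Not at hcon
        exact hmA.2 (Finset.mem_filter.2 ⟨hmA.1, hcon⟩)
      obtain ⟨y, hy, hym⟩ := this
      have hlt : ∀ z ∈ C, y ⊂ z := by
        intro z hz
        by_cases hzm : z = m
        · rwa [hzm]
        rcases hk.2 hz hm hzm with h | h
        · exact absurd (hmin hz h.1) h.2
        · exact hym.trans h
      have hyC : y ∉ C := fun h => (hlt y h).2 subset_rfl
      refine hA (insert y C) ?_ ⟨?_, ?_⟩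
      · intro z hz
        rcases Finset.mem_insert.1 hz with h | h
        · rwa [h]
        · exact (Finset.mem_sdiff.1 (hC h)).1
      · rw [Finset.card_insert_of_notMem hyC, hk.1]
      · rw [Finset.coe_insert]
        exact hk.2.insert fun z hz _ => Or.inl (hlt z hz)
    have h3 : A.card = (A \ I).card + I.card :=
      (Finset.card_sdiff_add_card_eq_card (Finset.filter_subset _ _)).symm
    rw [h3]; push_cast; linarith

lemma prob_ge {n : ℕ} {p : ℝ} (h0 : 0 ≤ p) (h1 : p ≤ 1) (Q : Finset (Finset (Fin n)) → Prop)
    (f : Finset (Finset (Fin n)) → ℝ) (hf : ∀ R, 0 ≤ f R) (hQ : ∀ R, ¬ Q R → 1 ≤ f R) :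
    1 - EE (Finset (Fin n)) p f ≤ probFamily n p Q ∧ probFamily n p Q ≤ 1 := by
  classical
  have hP : probFamily n p Q = EE (Finset (Fin n)) p (fun R => if Q R then 1 else 0) := by
    simp [probFamily, EE]
  have hone := EE_one (V := Finset (Fin n)) p
  constructor
  · have : EE (Finset (Fin n)) p (fun _ => 1) ≤
        EE (Finset (Fin n)) p (fun R => (if Q R then 1 else 0) + f R) := by
      refine EE_mono h0 h1 fun R => ?_
      split_ifs with h
      · linarith [hf R]
      · linarith [hQ R h]
    rw [EE_add] at this
    rw [hP]; linarith
  · rw [hP]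
    refine le_trans (EE_mono h0 h1 (g := fun _ => 1) fun R => ?_) hone.le
    split_ifs <;> norm_num

/-- For `k ≥ 2` and `pn → ∞`, whp every `k`-chain-free subfamily of `𝒫(n,p)` has size at most
`(k-1+ε) p C(n, n/2)`, and some `k`-chain-free subfamily has size at least `(k-1-ε) p C(n, n/2)`. -/
theorem statement0 (k : ℕ) (hk : 2 ≤ k) (ε : ℝ) (hε : 0 < ε)
    (p : ℕ → ℝ) (hp : ∀ n, p n ∈ Set.Ioc (0 : ℝ) 1)
    (hnp : Filter.Tendsto (fun n : ℕ => (n : ℝ) * p n) Filter.atTop Filter.atTop) :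
    Filter.Tendsto (fun n : ℕ => probFamily n (p n) (fun 𝒬 =>
        (∀ 𝒜 ⊆ 𝒬, NoKChain k 𝒜 →
          (𝒜.card : ℝ) ≤ ((k : ℝ) - 1 + ε) * p n * (n.choose (n / 2))) ∧
        (∃ 𝒜 ⊆ 𝒬, NoKChain k 𝒜 ∧
          ((k : ℝ) - 1 - ε) * p n * (n.choose (n / 2)) ≤ (𝒜.card : ℝ))))
      Filter.atTop (nhds 1) := by
  obtain ⟨j, rfl⟩ : ∃ j, k = j + 1 := ⟨k - 1, by omega⟩
  have hj : 1 ≤ j := by omega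
  have hj1 : (1:ℝ) ≤ j := by exact_mod_cast hj
  have hj0 : (0:ℝ) < j := by linarith
  set e : ℝ := min (ε / (4 * j)) (1/2) with he_def
  have he : 0 < e := by positivity
  have he1 : e ≤ 1/2 := min_le_right _ _
  have he2 : 4 * e * j ≤ ε := by
    have : e ≤ ε / (4 * j) := min_le_left _ _
    rw [le_div_iff₀ (by positivity)] at this
    linarith
  have hpN : Filter.Tendsto (fun n : ℕ => p n * (n.choose (n/2) : ℝ)) Filter.atTop Filter.atTop := by
    refine Filter.tendsto_atTop_mono (fun n => ?_) hnp
    have : (n:ℝ) ≤ (n.choose (n/2) : ℝ) := by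
      have := Nat.choose_le_middle 1 n
      rw [Nat.choose_one_right] at this
      exact_mod_cast this
    rw [mul_comm]
    exact mul_le_mul_of_nonneg_left this (hp n).1.le
  have hlim : Filter.Tendsto (fun n : ℕ => 1 - 3 * Real.exp (-(e^2/4) * (p n * (n.choose (n/2) : ℝ))))
      Filter.atTop (nhds 1) := by
    have h1 : Filter.Tendsto (fun n : ℕ => -(e^2/4) * (p n * (n.choose (n/2) : ℝ)))
        Filter.atTop Filter.atBot :=
      hpN.const_mul_atTop_of_neg (by nlinarith)
    have := ((Real.tendsto_exp_atBot.comp h1).const_mul 3).const_sub 1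
    simpa using this
  have main : ∀ᶠ n : ℕ in Filter.atTop,
      1 - 3 * Real.exp (-(e^2/4) * (p n * (n.choose (n/2) : ℝ))) ≤
      probFamily n (p n) (fun 𝒬 =>
        (∀ 𝒜 ⊆ 𝒬, NoKChain (j+1) 𝒜 →
          (𝒜.card : ℝ) ≤ (((j+1 : ℕ) : ℝ) - 1 + ε) * p n * (n.choose (n / 2))) ∧
        (∃ 𝒜 ⊆ 𝒬, NoKChain (j+1) 𝒜 ∧
          (((j+1 : ℕ) : ℝ) - 1 - ε) * p n * (n.choose (n / 2)) ≤ (𝒜.card : ℝ))) ∧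
      probFamily n (p n) (fun 𝒬 =>
        (∀ 𝒜 ⊆ 𝒬, NoKChain (j+1) 𝒜 →
          (𝒜.card : ℝ) ≤ (((j+1 : ℕ) : ℝ) - 1 + ε) * p n * (n.choose (n / 2))) ∧
        (∃ 𝒜 ⊆ 𝒬, NoKChain (j+1) 𝒜 ∧
          (((j+1 : ℕ) : ℝ) - 1 - ε) * p n * (n.choose (n / 2)) ≤ (𝒜.card : ℝ))) ≤ 1 := by
    filter_upwards [Filter.eventually_ge_atTop 12, hnp.eventually_ge_atTop (3072 / (e / 6144 * e^4)),
      small_eventually e he, LayF_large j e he] with n hn hK hO hL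
    have h0 := (hp n).1
    have h1 := (hp n).2
    have b1 := upper_bound hn h0 h1 he he1 hK
    have b2 := small_bound h0 h1 he he1 hO
    have b3 := lower_bound h0 h1 he he1 (LayF n j) (LayF_ge n j hj)
    have hN : (0:ℝ) < (n.choose (n/2) : ℝ) := by
      exact_mod_cast Nat.choose_pos (Nat.div_le_self _ _)
    set N := (n.choose (n/2) : ℝ) with hNdef
    have hpos : 0 < p n * N := by positivity
    have hge := prob_ge (n := n) h0.le h1 (fun 𝒬 =>
        (∀ 𝒜 ⊆ 𝒬, NoKChain (j+1) 𝒜 →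
          (𝒜.card : ℝ) ≤ (((j+1 : ℕ) : ℝ) - 1 + ε) * p n * N) ∧
        (∃ 𝒜 ⊆ 𝒬, NoKChain (j+1) 𝒜 ∧
          (((j+1 : ℕ) : ℝ) - 1 - ε) * p n * N ≤ (𝒜.card : ℝ)))
      (fun R => (Real.exp (-(e * (1 + 3 * e) * (p n * N))) *
          Real.exp (e * (alph (R ∩ BigF n) : ℝ)) +
        Real.exp (-(e * (p n * N))) * Real.exp (1 * ((R ∩ SmallF n).card : ℝ))) +
        Real.exp (e / 2 * (1 - e) * (p n * (LayF n j).card)) *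
          Real.exp ((-(e/2)) * ((R ∩ LayF n j).card : ℝ)))
      (fun R => by positivity) ?_
    · refine ⟨le_trans ?_ hge.1, hge.2⟩
      rw [EE_add, EE_add]
      linarith
    · intro R hR
      by_contra hlt
      push Not at hlt
      simp only [← Real.exp_add] at hlt
      have p1 := Real.exp_pos (-(e * (1 + 3 * e) * (p n * N)) + e * (alph (R ∩ BigF n) : ℝ))
      have p2 := Real.exp_pos (-(e * (p n * N)) + 1 * ((R ∩ SmallF n).card : ℝ))
      have p3 := Real.exp_pos (e / 2 * (1 - e) * (p n * (LayF n j).card) +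
        (-(e/2)) * ((R ∩ LayF n j).card : ℝ))
      have q1 := Real.exp_lt_one_iff.1 (show Real.exp (-(e * (1 + 3 * e) * (p n * N)) +
        e * (alph (R ∩ BigF n) : ℝ)) < 1 by linarith)
      have q2 := Real.exp_lt_one_iff.1 (show Real.exp (-(e * (p n * N)) +
        1 * ((R ∩ SmallF n).card : ℝ)) < 1 by linarith)
      have q3 := Real.exp_lt_one_iff.1 (show Real.exp (e / 2 * (1 - e) * (p n * (LayF n j).card) +
        (-(e/2)) * ((R ∩ LayF n j).card : ℝ)) < 1 by linarith)
      have r1 : (alph (R ∩ BigF n) : ℝ) ≤ (1 + 3 * e) * (p n * N) := by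
        refine le_of_mul_le_mul_left ?_ he
        linarith
      have r2 : ((R ∩ SmallF n).card : ℝ) ≤ e * (p n * N) := by linarith
      have r3 : (1 - e) * (p n * (LayF n j).card) ≤ ((R ∩ LayF n j).card : ℝ) := by
        refine le_of_mul_le_mul_left ?_ (show 0 < e/2 by positivity)
        linarith
      apply hR
      push_cast
      constructor
      · intro 𝒜 hA hno
        have := mirsky j 𝒜 ((1 + 4 * e) * (p n * N)) hno (fun I hI hanti => by
          have c1 : (I ∩ BigF n).card ≤ alph (R ∩ BigF n) :=
            le_alph (Finset.inter_subset_inter_right (hI.trans hA))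
              (hanti.subset (by simp))
          have c2 : (I ∩ SmallF n).card ≤ (R ∩ SmallF n).card :=
            Finset.card_le_card (Finset.inter_subset_inter_right (hI.trans hA))
          have c3 : I.card ≤ (I ∩ BigF n).card + (I ∩ SmallF n).card := by
            refine le_trans (Finset.card_le_card fun A hA => ?_) (Finset.card_union_le _ _)
            simp only [BigF, SmallF, Finset.mem_union, Finset.mem_inter, Finset.mem_filter,
              Finset.mem_univ, true_and, hA]
            omega
          have c4 : (I.card : ℝ) ≤ (alph (R ∩ BigF n) : ℝ) + ((R ∩ SmallF n).card : ℝ) := by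
            exact_mod_cast c3.trans (Nat.add_le_add c1 c2)
          linarith)
        refine this.trans ?_
        nlinarith
      · refine ⟨R ∩ LayF n j, Finset.inter_subset_left, LayF_noKChain n j R, le_trans ?_ r3⟩
        have s1 : (1 - e) * (p n * (j * (1 - e) * N)) ≤ (1 - e) * (p n * (LayF n j).card) := by
          have : 0 ≤ 1 - e := by linarith
          gcongr
        refine le_trans ?_ s1
        have s2 : (j:ℝ) - ε ≤ j * ((1 - e) * (1 - e)) := by nlinarith [mul_pos he hj0]
        nlinarith
  exact tendsto_of_tendsto_of_tendsto_of_le_of_le' hlim tendsto_const_nhds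
    (main.mono fun n h => h.1) (main.mono fun n h => h.2)
end

section
/- For every integer k ≥ 2 and every α > 0, there exists δ = δ(α,k) > 0 such that the following holds. Let n ∈ ℕ and let ℱ ⊆ 𝒫(n) satisfy |ℱ| ≥ (k−1+α)·C(n,⌊n/2⌋), and suppose m is a real number with δ^{−1} ≤ m ≤ C(|F|,|G|) for every F, G ∈ ℱ with F ⊋ G. Then there exists a k-uniform hypergraph ℋ with vertex set ℱ, all of whose edges are k-chains of sets from ℱ, satisfying: (a) e(ℋ) ≥ δ^k · m^{k−1} · C(n,⌊n/2⌋), and (b) Δ_ℓ(ℋ) ≤ (δm)^{k−ℓ} for every 1 ≤ ℓ ≤ k. -/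
open Finset

lemma aux_perm {n : ℕ} (F G G' : Finset (Fin n)) (hG : G ⊆ F) (hG' : G' ⊆ F)
    (hc : G.card = G'.card) :
    ∃ π : Equiv.Perm (Fin n), (∀ x, x ∉ F → π x = x) ∧ (∀ x, π x ∈ F ↔ x ∈ F) ∧
      (∀ x, π x ∈ G' ↔ x ∈ G) := by
  classical
  have e1 : ∀ S : Finset (Fin n), S ⊆ F →
      Fintype.card {x : {x // x ∈ F} // x.1 ∈ S} = S.card := by
    intro S hS
    rw [Fintype.card_subtype]
    refine Finset.card_bij (fun x _ => x.1) ?_ ?_ ?_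
    · intro x hx; simpa using hx
    · intro x _ y _ h; exact Subtype.ext h
    · intro b hb; exact ⟨⟨b, hS hb⟩, by simpa using hb, rfl⟩
  let e : {x : {x // x ∈ F} // x.1 ∈ G} ≃ {x : {x // x ∈ F} // x.1 ∈ G'} :=
    Fintype.equivOfCardEq (by rw [e1 G hG, e1 G' hG', hc])
  let p : Equiv.Perm {x // x ∈ F} := e.extendSubtype
  refine ⟨Equiv.Perm.ofSubtype p, ?_, ?_, ?_⟩
  · intro x hx
    exact Equiv.Perm.ofSubtype_apply_of_not_mem p hx
  · intro x
    exact Equiv.Perm.ofSubtype_apply_mem_iff_mem p x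
  · intro x
    by_cases hx : x ∈ F
    · rw [Equiv.Perm.ofSubtype_apply_of_mem p hx]
      constructor
      · intro h
        by_contra h2
        exact Equiv.extendSubtype_not_mem e ⟨x, hx⟩ h2 h
      · intro h
        exact Equiv.extendSubtype_mem e ⟨x, hx⟩ h
    · rw [Equiv.Perm.ofSubtype_apply_of_not_mem p hx]
      constructor
      · intro h; exact absurd (hG' h) hx
      · intro h; exact absurd (hG h) hx

/-- numberings for which all members of `B` are prefixes -/
def prefNum {n : ℕ} (B : Finset (Finset (Fin n))) : Finset (Numbering (Fin n)) :=
  univ.filter (fun f => ∀ s ∈ B, Numbering.IsPrefix f s)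

lemma prefNum_le {n : ℕ} (B : Finset (Finset (Fin n))) (F G G' : Finset (Fin n))
    (hB : ∀ s ∈ B, F ⊆ s) (hG : G ⊆ F) (hG' : G' ⊆ F) (hc : G.card = G'.card) :
    (prefNum (insert G B)).card ≤ (prefNum (insert G' B)).card := by
  obtain ⟨π, h1, h2, h3⟩ := aux_perm F G G' hG hG' hc
  refine Finset.card_le_card_of_injOn (fun f => π.symm.trans f) ?_ ?_
  · intro f hf
    simp only [prefNum, coe_filter, mem_univ, true_and, Set.mem_ofPred_eq, mem_insert,
      forall_eq_or_imp] at hf ⊢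
    refine ⟨?_, ?_⟩
    · intro y
      have := hf.1 (π.symm y)
      rw [← h3, Equiv.apply_symm_apply] at this
      rw [this, hc]; rfl
    · intro s hs y
      have := hf.2 s hs (π.symm y)
      rw [Equiv.trans_apply, ← this]
      by_cases hy : π.symm y ∈ F
      · have h4 := (h2 (π.symm y)).2 hy
        rw [Equiv.apply_symm_apply] at h4
        simp [hB s hs hy, hB s hs h4]
      · have h4 := h1 _ hy
        rw [Equiv.apply_symm_apply] at h4
        rw [← h4]
  · intro f _ g _ h
    ext x
    have := congrArg (fun k => k (π x)) h
    simpa using congrArg Fin.val this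

lemma prefNum_step {n : ℕ} (B : Finset (Finset (Fin n))) (F G : Finset (Fin n))
    (hB : ∀ s ∈ B, F ⊆ s) (hG : G ⊆ F) :
    (prefNum (insert G B)).card * F.card.choose G.card ≤ (prefNum B).card := by
  classical
  calc (prefNum (insert G B)).card * F.card.choose G.card
      = ∑ _G' ∈ powersetCard G.card F, (prefNum (insert G B)).card := by
        rw [sum_const, card_powersetCard, smul_eq_mul, mul_comm]
    _ ≤ ∑ G' ∈ powersetCard G.card F, (prefNum (insert G' B)).card := by
        refine sum_le_sum fun G' hG' => ?_
        rw [mem_powersetCard] at hG'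
        exact prefNum_le B F G G' hB hG hG'.1 hG'.2.symm
    _ = ((powersetCard G.card F).biUnion (fun G' => prefNum (insert G' B))).card := by
        rw [card_biUnion]
        intro x hx y hy hxy
        rw [mem_coe, mem_powersetCard] at hx hy
        rw [Function.onFun, Finset.disjoint_left]
        intro f hf hf'
        simp only [prefNum, mem_filter, mem_univ, true_and, mem_insert,
          forall_eq_or_imp] at hf hf'
        apply hxy
        ext a
        rw [hf.1 a, hf'.1 a, hx.2, hy.2]
    _ ≤ (prefNum B).card := by
        refine card_le_card fun f hf => ?_
        simp only [prefNum, mem_biUnion, mem_filter, mem_univ, true_and, mem_insert,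
          forall_eq_or_imp] at hf ⊢
        obtain ⟨_, _, _, h⟩ := hf
        exact h

lemma prefNum_singleton {n : ℕ} (F : Finset (Fin n)) :
    (prefNum {F}).card * n.choose F.card = n.factorial := by
  have : prefNum {F} = Numbering.prefixed F := by
    ext f; simp [prefNum]
  rw [this, Numbering.card_prefixed, Fintype.card_fin, mul_comm, ← mul_assoc]
  exact Nat.choose_mul_factorial_mul_factorial (by simpa using F.card_le_univ)

lemma prefNum_chain {n : ℕ} (𝓕 : Finset (Finset (Fin n))) (m : ℝ) (hm0 : 0 ≤ m)
    (hm : ∀ F ∈ 𝓕, ∀ G ∈ 𝓕, G ⊂ F → m ≤ (F.card.choose G.card : ℝ)) (l : ℕ) :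
    ∀ B : Finset (Finset (Fin n)), B ⊆ 𝓕 →
    IsChain (· ⊂ ·) (B : Set (Finset (Fin n))) → B.card = l + 1 →
    ∃ F ∈ B, ((prefNum B).card : ℝ) * m ^ l * (n.choose F.card) ≤ n.factorial := by
  classical
  induction l with
  | zero =>
    intro B _ _ hc
    obtain ⟨F, rfl⟩ := card_eq_one.1 hc
    refine ⟨F, by simp, ?_⟩
    rw [pow_zero, mul_one]
    exact_mod_cast (prefNum_singleton F).le
  | succ l ih =>
    intro B hBF hch hc
    have hmin : ∀ B : Finset (Finset (Fin n)), IsChain (· ⊂ ·) (B : Set (Finset (Fin n))) →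
        B.Nonempty → ∃ G ∈ B, ∀ s ∈ B, s ≠ G → G ⊂ s := by
      intro B hch hne
      obtain ⟨G, hG, hmin⟩ := exists_min_image B card hne
      refine ⟨G, hG, fun s hs hne => ?_⟩
      rcases hch hs hG hne with h | h
      · exact absurd (card_lt_card h) (not_lt.2 (hmin s hs))
      · exact h
    obtain ⟨G, hG, hGm⟩ := hmin B hch (card_pos.1 (by omega))
    have hc' : (B.erase G).card = l + 1 := by rw [card_erase_of_mem hG]; omega
    have hch' : IsChain (· ⊂ ·) ((B.erase G : Finset _) : Set (Finset (Fin n))) :=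
      hch.mono (by exact_mod_cast erase_subset G B)
    obtain ⟨F, hF, hFm⟩ := hmin _ hch' (card_pos.1 (by omega))
    obtain ⟨T, hT, hTle⟩ := ih (B.erase G) ((erase_subset _ _).trans hBF) hch' hc'
    refine ⟨T, mem_of_mem_erase hT, le_trans ?_ hTle⟩
    have hGF : G ⊂ F := hGm F (mem_of_mem_erase hF) (ne_of_mem_erase hF)
    have hs := prefNum_step (B.erase G) F G (fun s hs => by
      by_cases h : s = F
      · rw [h]
      · exact (hFm s hs h).subset) hGF.subset
    rw [insert_erase hG] at hs
    have hs' : ((prefNum B).card : ℝ) * m ≤ (prefNum (B.erase G)).card := by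
      refine le_trans (mul_le_mul_of_nonneg_left
        (hm F (hBF (mem_of_mem_erase hF)) G (hBF hG) hGF) (by positivity)) ?_
      exact_mod_cast hs
    have : ((prefNum B).card : ℝ) * m ^ (l + 1) = ((prefNum B).card : ℝ) * m * m ^ l := by ring
    rw [this]
    gcongr

lemma hit_count {α : Type*} [DecidableEq α] (k : ℕ) (hk : 1 ≤ k) (𝓑 : Finset (Finset α))
    (hne : ∀ B ∈ 𝓑, B.Nonempty) (y : ℕ) : ∀ (Y : Finset α), Y.card = y →
    (∀ e ⊆ Y, e.card = k → ∃ B ∈ 𝓑, B ⊆ e) →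
    Y.card ≤ k - 1 + (𝓑.filter (fun B => B ⊆ Y)).card := by
  induction y with
  | zero => intro Y hY _; omega
  | succ y ih =>
    intro Y hY h
    by_cases hYk : Y.card < k
    · omega
    obtain ⟨e, heY, hek⟩ := exists_subset_card_eq (not_lt.1 hYk)
    obtain ⟨B, hB, hBe⟩ := h e heY hek
    obtain ⟨b, hb⟩ := hne B hB
    have hbY : b ∈ Y := heY (hBe hb)
    have hc : (Y.erase b).card = y := by rw [card_erase_of_mem hbY]; omega
    have := ih (Y.erase b) hc (fun e he => h e (he.trans (erase_subset _ _)))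
    have hlt : (𝓑.filter (fun B => B ⊆ Y.erase b)).card < (𝓑.filter (fun B => B ⊆ Y)).card := by
      apply card_lt_card
      rw [ssubset_iff_of_subset]
      · refine ⟨B, mem_filter.2 ⟨hB, hBe.trans heY⟩, fun h => ?_⟩
        exact notMem_erase b Y ((mem_filter.1 h).2 hb)
      · intro C hC
        rw [mem_filter] at hC ⊢
        exact ⟨hC.1, hC.2.trans (erase_subset _ _)⟩
    omega

lemma main_count {n : ℕ} (k : ℕ) (hk : 1 ≤ k) (𝓕 : Finset (Finset (Fin n))) (m : ℝ) (hm0 : 0 < m)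
    (hm : ∀ F ∈ 𝓕, ∀ G ∈ 𝓕, G ⊂ F → m ≤ (F.card.choose G.card : ℝ))
    (𝓑 : Finset (Finset (Finset (Fin n))))
    (hB : ∀ B ∈ 𝓑, B.Nonempty ∧ B ⊆ 𝓕 ∧ IsChain (· ⊂ ·) (B : Set (Finset (Fin n))))
    (hhit : ∀ e ⊆ 𝓕, IsKChain k e → ∃ B ∈ 𝓑, B ⊆ e) :
    (𝓕.card : ℝ) ≤ ((k : ℝ) - 1) * (n.choose (n / 2)) + ∑ B ∈ 𝓑, (m ^ (B.card - 1))⁻¹ := by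
  classical
  set N := n.choose (n / 2) with hN
  let Y : Numbering (Fin n) × ℕ → Finset (Finset (Fin n)) := fun p =>
    𝓕.filter (fun F => Numbering.IsPrefix p.1 F ∧ p.2 < n.choose F.card)
  let Ω : Finset (Numbering (Fin n) × ℕ) := univ ×ˢ range N
  have hΩ : Ω.card = n.factorial * N := by
    simp only [Ω, card_product, card_range, card_univ, Fintype.card_numbering, Fintype.card_fin]
  -- pointwise
  have hpt : ∀ p ∈ Ω, (Y p).card ≤ k - 1 + (𝓑.filter (fun B => B ⊆ Y p)).card := by
    intro p _
    refine hit_count k hk 𝓑 (fun B h => (hB B h).1) _ (Y p) rfl ?_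
    intro e he hek
    refine hhit e (he.trans (filter_subset _ _)) ⟨hek, ?_⟩
    intro s hs t ht hst
    have h1 := (mem_filter.1 (he hs)).2.1
    have h2 := (mem_filter.1 (he ht)).2.1
    rcases Nat.le_total s.card t.card with h | h
    · exact Or.inl ((h1.subset_of_card_le_card h2 h).ssubset_of_ne hst)
    · exact Or.inr ((h2.subset_of_card_le_card h1 h).ssubset_of_ne hst.symm)
  have hchoose : ∀ j, n.choose j ≤ N := fun j => Nat.choose_le_middle j n
  -- count for a family of prefixes
  have hL : ∑ p ∈ Ω, (Y p).card = 𝓕.card * n.factorial := by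
    simp only [Y, card_filter]
    rw [sum_comm, card_eq_sum_ones, sum_mul]
    refine sum_congr rfl fun F _ => ?_
    rw [← card_filter, one_mul, ← prefNum_singleton F]
    have : Ω.filter (fun p => Numbering.IsPrefix p.1 F ∧ p.2 < n.choose F.card)
        = prefNum {F} ×ˢ range (n.choose F.card) := by
      ext p
      simp only [Ω, prefNum, mem_filter, mem_product, mem_univ, true_and, mem_range,
        mem_singleton, forall_eq]
      have := hchoose F.card
      constructor
      · rintro ⟨_, h⟩; exact h
      · rintro h; exact ⟨h.2.trans_le this, h⟩
    rw [this, card_product, card_range]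
  have hR : ∑ p ∈ Ω, (𝓑.filter (fun B => B ⊆ Y p)).card
      = ∑ B ∈ 𝓑, (Ω.filter (fun p => B ⊆ Y p)).card := by
    simp only [card_filter]
    rw [sum_comm]
  have hR2 : ∀ B ∈ 𝓑, ((Ω.filter (fun p => B ⊆ Y p)).card : ℝ)
      ≤ n.factorial * (m ^ (B.card - 1))⁻¹ := by
    intro B hBB
    obtain ⟨hne, hBF, hch⟩ := hB B hBB
    have hpos := hne.card_pos
    obtain ⟨F, hF, hle⟩ := prefNum_chain 𝓕 m hm0.le hm (B.card - 1) B hBF hch (by omega)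
    have hsub : Ω.filter (fun p => B ⊆ Y p) ⊆ prefNum B ×ˢ range (n.choose F.card) := by
      intro p hp
      have h := (mem_filter.1 hp).2
      rw [mem_product, mem_range]
      refine ⟨?_, (mem_filter.1 (h hF)).2.2⟩
      simp only [prefNum, mem_filter, mem_univ, true_and]
      exact fun s hs => (mem_filter.1 (h hs)).2.1
    have hcard := card_le_card hsub
    rw [card_product, card_range] at hcard
    have hcard' : ((Ω.filter (fun p => B ⊆ Y p)).card : ℝ)
      ≤ (prefNum B).card * (n.choose F.card) := by exact_mod_cast hcard
    refine hcard'.trans ?_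
    rw [← div_eq_mul_inv, le_div_iff₀ (by positivity)]
    linarith
  have hsum : (𝓕.card : ℝ) * n.factorial ≤ (n.factorial : ℝ) * N * ((k : ℝ) - 1)
      + ∑ B ∈ 𝓑, n.factorial * (m ^ (B.card - 1))⁻¹ := by
    have h := sum_le_sum hpt
    rw [hL, sum_add_distrib, sum_const, hΩ, hR, smul_eq_mul] at h
    have h' : (𝓕.card : ℝ) * n.factorial ≤ (n.factorial : ℝ) * N * ((k - 1 : ℕ) : ℝ)
      + ∑ B ∈ 𝓑, ((Ω.filter (fun p => B ⊆ Y p)).card : ℝ) := by exact_mod_cast h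
    rw [Nat.cast_sub hk, Nat.cast_one] at h'
    exact h'.trans (add_le_add_right (sum_le_sum hR2) _)
  rw [← mul_sum] at hsum
  have hf : (0 : ℝ) < n.factorial := by exact_mod_cast n.factorial_pos
  refine le_of_mul_le_mul_right ?_ hf
  linarith

/-- Balanced supersaturation: a family slightly larger than `(k-1) C(n, n/2)` contains a
well-spread `k`-uniform hypergraph of `k`-chains. -/
theorem statement2 (k : ℕ) (hk : 2 ≤ k) (α : ℝ) (hα : 0 < α) :
    ∃ δ : ℝ, 0 < δ ∧ ∀ (n : ℕ) (𝓕 : Finset (Finset (Fin n))) (m : ℝ),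
      ((k : ℝ) - 1 + α) * (n.choose (n / 2)) ≤ (𝓕.card : ℝ) →
      δ⁻¹ ≤ m →
      (∀ F ∈ 𝓕, ∀ G ∈ 𝓕, G ⊂ F → m ≤ (F.card.choose G.card : ℝ)) →
      ∃ H : Finset (Finset (Finset (Fin n))),
        (∀ e ∈ H, e ⊆ 𝓕 ∧ IsKChain k e) ∧
        δ ^ k * m ^ (k - 1) * (n.choose (n / 2)) ≤ (H.card : ℝ) ∧
        (∀ ℓ : ℕ, 1 ≤ ℓ → ℓ ≤ k → ∀ A : Finset (Finset (Fin n)), A.card = ℓ →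
          ((H.filter (fun e => A ⊆ e)).card : ℝ) ≤ (δ * m) ^ (k - ℓ)) := by
  classical
  set δ : ℝ := min 1 (α / 2 ^ (k + 1)) with hδ
  have hδ0 : 0 < δ := lt_min one_pos (by positivity)
  have hδ1 : δ ≤ 1 := min_le_left _ _
  have hδα : δ * 2 ^ (k + 1) ≤ α := by
    rw [← le_div_iff₀ (by positivity)]; exact min_le_right _ _
  refine ⟨δ, hδ0, ?_⟩
  intro n 𝓕 m hF hm hmc
  have hm0 : 0 < m := lt_of_lt_of_le (inv_pos.2 hδ0) hm
  have hδm : 1 ≤ δ * m := by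
    have := mul_le_mul_of_nonneg_left hm hδ0.le
    rwa [mul_inv_cancel₀ hδ0.ne'] at this
  let good : Finset (Finset (Finset (Fin n))) → Prop := fun H =>
    (∀ e ∈ H, e ⊆ 𝓕 ∧ IsKChain k e) ∧
    (∀ ℓ : ℕ, 1 ≤ ℓ → ℓ ≤ k → ∀ A : Finset (Finset (Fin n)), A.card = ℓ →
          ((H.filter (fun e => A ⊆ e)).card : ℝ) ≤ (δ * m) ^ (k - ℓ))
  obtain ⟨H, hH, hmax⟩ := exists_max_image
    ((univ : Finset (Finset (Finset (Finset (Fin n))))).filter good) card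
    ⟨∅, by
      simp only [mem_filter, mem_univ, true_and, good]
      refine ⟨by simp, fun ℓ _ _ A _ => ?_⟩
      simp only [filter_empty, card_empty, Nat.cast_zero]
      positivity⟩
  replace hH : good H := (mem_filter.1 hH).2
  refine ⟨H, hH.1, ?_, hH.2⟩
  let deg : Finset (Finset (Fin n)) → ℕ := fun A => (H.filter (fun e => A ⊆ e)).card
  let 𝓑 : Finset (Finset (Finset (Fin n))) := univ.filter (fun A =>
    (A.Nonempty ∧ A ⊆ 𝓕 ∧ IsChain (· ⊂ ·) (A : Set (Finset (Fin n)))) ∧ A.card ≤ k ∧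
      (δ * m) ^ (k - A.card) < (deg A : ℝ) + 1)
  have hhit : ∀ e ⊆ 𝓕, IsKChain k e → ∃ B ∈ 𝓑, B ⊆ e := by
    intro e he hek
    by_cases heH : e ∈ H
    · refine ⟨e, ?_, subset_rfl⟩
      simp only [𝓑, mem_filter, mem_univ, true_and]
      refine ⟨⟨card_pos.1 (by rw [hek.1]; omega), he, hek.2⟩, hek.1.le, ?_⟩
      rw [hek.1, Nat.sub_self, pow_zero]
      have : 0 < deg e := card_pos.2 ⟨e, mem_filter.2 ⟨heH, subset_rfl⟩⟩
      have : (0 : ℝ) < deg e := by exact_mod_cast this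
      linarith
    · have hng : ¬ good (insert e H) := by
        intro hg
        have := hmax _ (mem_filter.2 ⟨mem_univ _, hg⟩)
        rw [card_insert_of_notMem heH] at this
        omega
      have h1 : ∀ e' ∈ insert e H, e' ⊆ 𝓕 ∧ IsKChain k e' := by
        intro e' he'
        rcases mem_insert.1 he' with rfl | h
        · exact ⟨he, hek⟩
        · exact hH.1 e' h
      have h2 : ¬ (∀ ℓ : ℕ, 1 ≤ ℓ → ℓ ≤ k → ∀ A : Finset (Finset (Fin n)), A.card = ℓ →
          (((insert e H).filter (fun e => A ⊆ e)).card : ℝ) ≤ (δ * m) ^ (k - ℓ)) :=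
        fun h => hng ⟨h1, h⟩
      push Not at h2
      obtain ⟨ℓ, hl1, hlk, A, hA, hlt⟩ := h2
      have hle := hH.2 ℓ hl1 hlk A hA
      rw [filter_insert] at hlt
      by_cases hAe : A ⊆ e
      · rw [if_pos hAe] at hlt
        refine ⟨A, ?_, hAe⟩
        simp only [𝓑, mem_filter, mem_univ, true_and]
        refine ⟨⟨card_pos.1 (by omega), hAe.trans he, hek.2.mono (by exact_mod_cast hAe)⟩,
          by omega, ?_⟩
        rw [hA]
        refine hlt.trans_le ?_
        exact_mod_cast card_insert_le _ _
      · rw [if_neg hAe] at hlt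
        linarith
  have hcount := main_count k (by omega) 𝓕 m hm0 hmc 𝓑
    (fun B hB => (mem_filter.1 hB).2.1) hhit
  set N : ℝ := (n.choose (n / 2) : ℝ) with hN
  have hαN : α * N ≤ ∑ B ∈ 𝓑, (m ^ (B.card - 1))⁻¹ := by linarith
  -- bound each term
  have hterm : ∀ B ∈ 𝓑, (m ^ (B.card - 1))⁻¹ * (δ * m) ^ (k - 1) ≤ 2 * (deg B : ℝ) := by
    intro B hB
    obtain ⟨⟨hne, _, _⟩, hBk, hlt⟩ := (mem_filter.1 hB).2
    have hpos := hne.card_pos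
    have ht1 : 1 ≤ (δ * m) ^ (k - B.card) := one_le_pow₀ hδm
    have hd : (0 : ℝ) < deg B := by linarith
    have hd1 : (1 : ℝ) ≤ deg B := by
      have : 0 < deg B := by exact_mod_cast hd
      exact_mod_cast this
    have hk1 : k - 1 = (B.card - 1) + (k - B.card) := by omega
    have : (m ^ (B.card - 1))⁻¹ * (δ * m) ^ (k - 1)
        = δ ^ (B.card - 1) * (δ * m) ^ (k - B.card) := by
      rw [hk1, pow_add, mul_pow δ m (B.card - 1)]
      field_simp
    rw [this]
    have hle : δ ^ (B.card - 1) ≤ 1 := pow_le_one₀ hδ0.le hδ1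
    have := mul_le_mul_of_nonneg_right hle (zero_le_one.trans ht1)
    linarith
  have hdeg : ∑ B ∈ 𝓑, deg B ≤ H.card * 2 ^ k := by
    have : ∑ B ∈ 𝓑, deg B = ∑ e ∈ H, (𝓑.filter (fun B => B ⊆ e)).card := by
      simp only [deg, card_filter]
      rw [sum_comm]
    rw [this, ← smul_eq_mul]
    refine sum_le_card_nsmul _ _ _ fun e he => ?_
    rw [← (hH.1 e he).2.1, ← card_powerset]
    refine card_le_card fun B hB => ?_
    exact mem_powerset.2 (mem_filter.1 hB).2
  have hdeg' : ∑ B ∈ 𝓑, (deg B : ℝ) ≤ H.card * 2 ^ k := by exact_mod_cast hdeg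
  have h3 : α * N * (δ * m) ^ (k - 1) ≤ 2 * (H.card * 2 ^ k) := by
    calc α * N * (δ * m) ^ (k - 1)
        ≤ (∑ B ∈ 𝓑, (m ^ (B.card - 1))⁻¹) * (δ * m) ^ (k - 1) :=
          mul_le_mul_of_nonneg_right hαN (by positivity)
      _ = ∑ B ∈ 𝓑, (m ^ (B.card - 1))⁻¹ * (δ * m) ^ (k - 1) := by rw [sum_mul]
      _ ≤ ∑ B ∈ 𝓑, 2 * (deg B : ℝ) := sum_le_sum hterm
      _ = 2 * ∑ B ∈ 𝓑, (deg B : ℝ) := by rw [mul_sum]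
      _ ≤ _ := by linarith
  have hN0 : 0 ≤ N := by positivity
  have h4 : δ * 2 ^ (k + 1) * (N * (δ * m) ^ (k - 1)) ≤ α * (N * (δ * m) ^ (k - 1)) :=
    mul_le_mul_of_nonneg_right hδα (by positivity)
  have hk2 : δ ^ k = δ * δ ^ (k - 1) := by
    rw [← pow_succ']; congr 1; omega
  have h2k : (0 : ℝ) < 2 ^ (k + 1) := by positivity
  refine le_of_mul_le_mul_right ?_ h2k
  calc δ ^ k * m ^ (k - 1) * N * 2 ^ (k + 1)
      = δ * 2 ^ (k + 1) * (N * (δ * m) ^ (k - 1)) := by rw [hk2, mul_pow]; ring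
    _ ≤ α * (N * (δ * m) ^ (k - 1)) := h4
    _ = α * N * (δ * m) ^ (k - 1) := by ring
    _ ≤ 2 * (H.card * 2 ^ k) := h3
    _ = H.card * 2 ^ (k + 1) := by ring
end

section
/- For every integer k ≥ 2 and every α > 0, there exists δ = δ(α,k) > 0 such that the following holds for all sufficiently large n. Let C ⊆ 𝒫(n) with |C| ≥ (k−1+α)·C(n,⌊n/2⌋), and let τ(C) = 1/n if |C| ≤ 3k·C(n,⌊n/2⌋) and τ(C) = 1/n³ otherwise. Then there exists a collection 𝒞 of subsets of C and a function f from subsets of C to 𝒞 such that: (a) for every I ⊆ C containing no k-chain, there exists T ⊆ I with |T| ≤ k·τ(C)·|C| and I ⊆ f(T) ∪ T; and (b) |C′| ≤ (1−δ)·|C| for every C′ ∈ 𝒞. -/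
open Finset

section Containers
variable {α : Type} [Fintype α] [DecidableEq α]

noncomputable def dg (w : Finset α → ℝ) (S : Finset α) : ℝ := ∑ A with S ⊆ A, w A

open scoped Classical in
noncomputable def NV (w : Finset α → ℝ) (p : ℝ) (G : Finset α → ℝ) (v : α) : Finset α → ℝ :=
  fun A => if v ∉ A ∧ ∀ S ⊆ A, S.Nonempty → dg G S < p ^ (#S - 1) then w (insert v A) / p else 0

def VG (w : Finset α → ℝ) (p c γ : ℝ) (T : Finset α) (G : Finset α → ℝ) : Prop :=
  (∀ A, 0 ≤ G A) ∧ (∀ A, G A ≠ 0 → ∃ v ∈ T, v ∉ A ∧ w (insert v A) ≠ 0) ∧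
  (∀ S : Finset α, S.Nonempty → dg G S ≤ (1 + c) * p ^ (#S - 1)) ∧
  #T * (γ / p) ≤ ∑ A, G A ∧ ∑ A, G A ≤ #T * (c / p)

lemma NV_nonneg {w : Finset α → ℝ} {p : ℝ} (hp : 0 < p) (hw : ∀ A, 0 ≤ w A) (G : Finset α → ℝ) (v : α)
    (A : Finset α) : 0 ≤ NV w p G v A := by
  unfold NV
  split_ifs
  · exact div_nonneg (hw _) hp.le
  · exact le_rfl

lemma dg_NV_le {w : Finset α → ℝ} {p : ℝ} (hp : 0 < p) (hw : ∀ A, 0 ≤ w A) (G : Finset α → ℝ) (v : α)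
    (S : Finset α) : dg (NV w p G v) S ≤ dg w (insert v S) / p := by
  unfold dg
  rw [Finset.sum_div]
  calc ∑ A with S ⊆ A, NV w p G v A ≤ ∑ A with (S ⊆ A ∧ v ∉ A), w (insert v A) / p := by
        rw [← Finset.filter_filter, Finset.sum_filter (fun A => v ∉ A)]
        apply Finset.sum_le_sum
        intro A _
        unfold NV
        have := div_nonneg (hw (insert v A)) hp.le
        split_ifs <;> first | exact le_rfl | assumption | skip
        all_goals tauto
    _ = ∑ B ∈ ({A : Finset α | S ⊆ A ∧ v ∉ A} : Finset (Finset α)).image (insert v), w B / p := by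
        rw [Finset.sum_image]
        intro A hA B hB h
        simp only [coe_filter, mem_univ, true_and, Set.mem_ofPred_eq] at hA hB
        rw [← Finset.erase_insert hA.2, ← Finset.erase_insert hB.2]
        exact congrArg (fun X => X.erase v) h
    _ ≤ _ := by
        apply Finset.sum_le_sum_of_subset_of_nonneg
        · intro B hB
          simp only [mem_image, mem_filter, mem_univ, true_and] at hB ⊢
          obtain ⟨A, hA, rfl⟩ := hB
          exact Finset.insert_subset_insert _ hA.1
        · intro B _ _
          exact div_nonneg (hw _) hp.le

lemma dg_empty (w : Finset α → ℝ) : dg w ∅ = ∑ A, w A := by simp [dg]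

lemma VG_insert {w : Finset α → ℝ} {p c γ : ℝ} (hp : 0 < p) (hw : ∀ A, 0 ≤ w A)
    (hd : ∀ S : Finset α, S.Nonempty → dg w S ≤ c * p ^ (#S - 1))
    {T : Finset α} {G : Finset α → ℝ} (h : VG w p c γ T G) {v : α} (hv : v ∉ T)
    (hN : γ / p ≤ ∑ A, NV w p G v A) : VG w p c γ (insert v T) (G + NV w p G v) := by
  obtain ⟨h1, h2, h3, h4, h5⟩ := h
  have hcard : ((#(insert v T) : ℕ) : ℝ) = #T + 1 := by
    rw [Finset.card_insert_of_notMem hv]; push_cast; ring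
  have hsum : ∑ A, (G + NV w p G v) A = ∑ A, G A + ∑ A, NV w p G v A := by
    simp [Finset.sum_add_distrib]
  refine ⟨?_, ?_, ?_, ?_, ?_⟩
  · intro A
    exact add_nonneg (h1 A) (NV_nonneg hp hw G v A)
  · intro A hA
    by_cases hG : G A = 0
    · have : NV w p G v A ≠ 0 := by
        intro h0; apply hA; simp [hG, h0]
      unfold NV at this
      split_ifs at this with hh
      · refine ⟨v, by simp, hh.1, ?_⟩
        intro h0; apply this; simp [h0]
      · exact absurd rfl this
    · obtain ⟨u, hu, hu2⟩ := h2 A hG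
      exact ⟨u, by simp [hu], hu2⟩
  · intro S hS
    have hadd : dg (G + NV w p G v) S = dg G S + dg (NV w p G v) S := by
      simp [dg, Finset.sum_add_distrib]
    rw [hadd]
    by_cases hz : dg G S < p ^ (#S - 1) ∧ v ∉ S
    · have h6 := dg_NV_le hp hw G v S
      have h7 := hd (insert v S) (by simp)
      rw [Finset.card_insert_of_notMem hz.2] at h7
      have h8 : dg w (insert v S) / p ≤ c * p ^ (#S - 1) := by
        rw [div_le_iff₀ hp]
        refine h7.trans (le_of_eq ?_)
        have : 0 < #S := hS.card_pos
        obtain ⟨m, hm⟩ := Nat.exists_eq_succ_of_ne_zero this.ne'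
        rw [hm]; simp [pow_succ]; ring
      nlinarith [hz.1]
    · have : dg (NV w p G v) S = 0 := by
        unfold dg
        apply Finset.sum_eq_zero
        intro A hA
        simp only [mem_filter, mem_univ, true_and] at hA
        unfold NV
        rw [if_neg]
        rintro ⟨ha, hb⟩
        exact hz ⟨hb S hA hS, fun h => ha (hA h)⟩
      rw [this, add_zero]
      exact h3 S hS
  · rw [hcard, hsum]; nlinarith
  · rw [hcard, hsum]
    have h6 := dg_NV_le hp hw G v ∅
    have h7 := hd {v} (by simp)
    rw [dg_empty] at h6
    simp at h6 h7
    have : dg w {v} / p ≤ c / p := by gcongr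
    nlinarith

open scoped Classical in
lemma count_lemma {w : Finset α → ℝ} {p c γ : ℝ} (hp : 0 < p) (hc : 0 < c) (hγ : 0 < γ) (hw : ∀ A, 0 ≤ w A)
    (C : Finset α) (s : ℕ) (hs : ∀ A, w A ≠ 0 → A ⊆ C ∧ #A = s + 2)
    (hd : ∀ S : Finset α, S.Nonempty → dg w S ≤ c * p ^ (#S - 1))
    {T : Finset α} {G : Finset α → ℝ} (h : VG w p c γ T G) :
    ∑ A, w A ≤ c * 2 ^ (s + 1) * ∑ A, G A + γ * #C +
      c * #(C \ C.filter (fun v => ∑ A, NV w p G v A < γ / p)) := by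
  obtain ⟨h1, h2, h3, h4, h5⟩ := h
  set W := C.filter (fun v => ∑ A, NV w p G v A < γ / p) with hW
  have hGs : ∀ A, G A ≠ 0 → #A = s + 1 := by
    intro A hA
    obtain ⟨v, _, hvA, hv⟩ := h2 A hA
    have := (hs _ hv).2
    rw [Finset.card_insert_of_notMem hvA] at this
    omega
  let sat : Finset (Finset α) := univ.filter (fun S => S.Nonempty ∧ p ^ (#S - 1) ≤ dg G S)
  have key : ∀ A, w A ≤ (∑ S ∈ sat, if S ⊆ A then w A else 0) +
      (∑ v ∈ W, if v ∈ A then p * NV w p G v (A.erase v) else 0) +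
      ∑ v ∈ C \ W, if v ∈ A then w A else 0 := by
    intro A
    have n1 : ∀ S ∈ sat, 0 ≤ if S ⊆ A then w A else 0 := by
      intro S _; split_ifs; exacts [hw _, le_rfl]
    have n2 : ∀ v ∈ W, 0 ≤ if v ∈ A then p * NV w p G v (A.erase v) else 0 := by
      intro v _; split_ifs; exacts [mul_nonneg hp.le (NV_nonneg hp hw _ _ _), le_rfl]
    have n3 : ∀ v ∈ C \ W, 0 ≤ if v ∈ A then w A else 0 := by
      intro S _; split_ifs; exacts [hw _, le_rfl]
    have m1 := Finset.sum_nonneg n1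
    have m2 := Finset.sum_nonneg n2
    have m3 := Finset.sum_nonneg n3
    by_cases hA : w A = 0
    · rw [hA] at m1 m3 ⊢; linarith
    obtain ⟨hAC, hAs⟩ := hs A hA
    by_cases hb : ∃ S ∈ sat, S ⊆ A
    · obtain ⟨S, hS, hSA⟩ := hb
      have := Finset.single_le_sum n1 hS
      rw [if_pos hSA] at this
      linarith
    · push Not at hb
      obtain ⟨v, hv⟩ : A.Nonempty := by rw [← Finset.card_pos]; omega
      by_cases hvW : v ∈ W
      · have := Finset.single_le_sum n2 hvW
        rw [if_pos hv] at this
        have e : p * NV w p G v (A.erase v) = w A := by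
          unfold NV
          rw [if_pos, Finset.insert_erase hv]
          · field_simp
          · refine ⟨by simp, fun S hS hS2 => ?_⟩
            by_contra hcon
            push Not at hcon
            exact hb S (by simp [sat, hS2, hcon]) (hS.trans (Finset.erase_subset _ _))
        rw [e] at this
        linarith
      · have := Finset.single_le_sum n3 (Finset.mem_sdiff.2 ⟨hAC hv, hvW⟩)
        rw [if_pos hv] at this
        linarith
  have b1 : ∑ A, (∑ S ∈ sat, if S ⊆ A then w A else 0) ≤ c * 2 ^ (s + 1) * ∑ A, G A := by
    rw [Finset.sum_comm]
    calc ∑ S ∈ sat, ∑ A, (if S ⊆ A then w A else 0) ≤ ∑ S ∈ sat, c * dg G S := by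
          apply Finset.sum_le_sum
          intro S hS
          simp only [sat, mem_filter, mem_univ, true_and] at hS
          rw [← Finset.sum_filter]
          exact (hd S hS.1).trans (mul_le_mul_of_nonneg_left hS.2 hc.le)
      _ ≤ ∑ S, c * dg G S := by
          apply Finset.sum_le_sum_of_subset_of_nonneg (Finset.subset_univ _)
          intro S _ _
          exact mul_nonneg hc.le (Finset.sum_nonneg fun A _ => h1 A)
      _ = c * ∑ A, ∑ S : Finset α, (if S ⊆ A then G A else 0) := by
          rw [← Finset.mul_sum, Finset.sum_comm]
          congr 1
          apply Finset.sum_congr rfl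
          intro S _
          rw [← Finset.sum_filter]; rfl
      _ = c * ∑ A, 2 ^ (s + 1) * G A := by
          congr 1
          apply Finset.sum_congr rfl
          intro A _
          by_cases hA : G A = 0
          · simp [hA]
          rw [← Finset.sum_filter, Finset.sum_const, nsmul_eq_mul]
          congr 1
          have : (univ.filter (fun S => S ⊆ A)) = A.powerset := by ext S; simp
          rw [this, Finset.card_powerset, hGs A hA]; push_cast; rfl
      _ = _ := by rw [← Finset.mul_sum]; ring
  have b2 : ∑ A : Finset α, (∑ v ∈ W, if v ∈ A then p * NV w p G v (A.erase v) else 0) ≤ γ * #C := by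
    rw [Finset.sum_comm]
    calc _ ≤ ∑ v ∈ W, γ := by
          apply Finset.sum_le_sum
          intro v hv
          have hv' := (Finset.mem_filter.1 hv).2
          rw [← Finset.sum_filter]
          have : ∑ A : Finset α with v ∈ A, p * NV w p G v (A.erase v) ≤ ∑ B, p * NV w p G v B := by
            rw [← Finset.sum_image (s := univ.filter (fun A : Finset α => v ∈ A)) (g := fun A : Finset α => A.erase v)
              (f := fun B => p * NV w p G v B)]
            · apply Finset.sum_le_sum_of_subset_of_nonneg (Finset.subset_univ _)
              intro S _ _
              exact mul_nonneg hp.le (NV_nonneg hp hw _ _ _)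
            · intro A hA B hB h
              simp only [coe_filter, mem_univ, true_and, Set.mem_ofPred_eq] at hA hB
              rw [← Finset.insert_erase hA, ← Finset.insert_erase hB]
              exact congrArg (insert v) h
          refine this.trans ?_
          rw [← Finset.mul_sum]
          rw [lt_div_iff₀ hp] at hv'
          linarith
      _ ≤ _ := by
          rw [Finset.sum_const, nsmul_eq_mul, mul_comm]
          have : (#W : ℝ) ≤ #C := by exact_mod_cast Finset.card_filter_le _ _
          gcongr
  have b3 : ∑ A : Finset α, (∑ v ∈ C \ W, if v ∈ A then w A else 0) ≤ c * #(C \ W) := by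
    rw [Finset.sum_comm]
    calc _ ≤ ∑ v ∈ C \ W, c := by
          apply Finset.sum_le_sum
          intro v hv
          have := hd {v} (by simp)
          simp [dg] at this
          rw [← Finset.sum_filter]
          exact this
      _ = _ := by rw [Finset.sum_const, nsmul_eq_mul, mul_comm]
  calc ∑ A, w A ≤ _ := Finset.sum_le_sum fun A _ => key A
    _ ≤ _ := by
      rw [Finset.sum_add_distrib, Finset.sum_add_distrib]
      linarith

end Containers


/-- consistent selection of a maximal valid subset -/
lemma exists_select {α : Type} [Fintype α] [DecidableEq α] (P : Finset α → Prop) (h0 : P ∅) :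
    ∃ Tf : Finset α → Finset α, ∀ I, Tf I ⊆ I ∧ P (Tf I) ∧
      (∀ T, T ⊆ I → P T → Tf I ⊆ T → T = Tf I) ∧
      (∀ J, Tf I ⊆ J → J ⊆ I → Tf J = Tf I) := by
  classical
  have hex : ∀ I : Finset α, ∃ T ∈ univ.filter (fun T => T ⊆ I ∧ P T),
      ∀ T' ∈ univ.filter (fun T => T ⊆ I ∧ P T),
        (toLinearExtension T' : LinearExtension (Finset α)) ≤ toLinearExtension T := fun I =>
    Finset.exists_max_image _ _ ⟨∅, by simp [h0]⟩
  choose Tf h1 h2 using hex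
  have inj : Function.Injective (toLinearExtension : Finset α → LinearExtension (Finset α)) :=
    fun a b h => h
  simp only [mem_filter, mem_univ, true_and] at h1 h2
  refine ⟨Tf, fun I => ⟨(h1 I).1, (h1 I).2, ?_, ?_⟩⟩
  · intro T hT hP hle
    exact inj (le_antisymm (h2 I T ⟨hT, hP⟩) (toLinearExtension.monotone hle))
  · intro J hJ hJI
    refine inj (le_antisymm (h2 I _ ⟨(h1 J).1.trans hJI, (h1 J).2⟩) (h2 J _ ⟨hJ, (h1 I).2⟩))

set_option maxHeartbeats 4000000 in
theorem container (s : ℕ) : ∀ c ε : ℝ, 0 < c → 0 < ε → ∃ δ : ℝ, 0 < δ ∧ ∃ K : ℝ,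
    ∀ (α : Type) [Fintype α] [DecidableEq α] (C : Finset α) (p : ℝ) (w : Finset α → ℝ),
      0 < p → K ≤ p * #C → (∀ A, 0 ≤ w A) → (∀ A, w A ≠ 0 → A ⊆ C ∧ #A = s + 1) →
      (∀ S : Finset α, S.Nonempty → dg w S ≤ c * p ^ (#S - 1)) →
      ε * #C ≤ ∑ A, w A →
      ∃ Tf f : Finset α → Finset α, ∀ I ⊆ C, Tf I ⊆ I ∧ f I ⊆ C ∧
        (#(Tf I) : ℝ) ≤ s * (p * #C) ∧ (#(f I) : ℝ) ≤ (1 - δ) * #C ∧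
        ((∀ A ⊆ I, w A = 0) → I ⊆ f I ∪ Tf I) ∧
        ∀ J, Tf I ⊆ J → J ⊆ I → Tf J = Tf I ∧ f J = f I := by
  have cardaux : ∀ (α : Type) [DecidableEq α] (C F : Finset α) (δ : ℝ), F ⊆ C →
      δ * #C ≤ #(C \ F) → (#F : ℝ) ≤ (1 - δ) * #C := by
    intro α _ C F δ hF h
    have : (#(C \ F) : ℝ) + #F = #C := by exact_mod_cast Finset.card_sdiff_add_card_eq_card hF
    linarith
  induction s with
  | zero =>
    intro c ε hc hε
    refine ⟨ε / c, by positivity, 0, ?_⟩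
    intro α _ _ C p w hp _ hw hs hd he
    classical
    refine ⟨fun _ => ∅, fun _ => C.filter (fun v => w {v} = 0), fun I hI => ⟨by simp, by simp, by simp, ?_, ?_, by simp⟩⟩
    · apply cardaux
      · simp
      rw [div_mul_eq_mul_div, div_le_iff₀ hc]
      refine he.trans ?_
      calc ∑ A, w A ≤ ∑ A : Finset α, ∑ v ∈ C \ C.filter (fun v => w {v} = 0), (if v ∈ A then w A else 0) := by
            apply Finset.sum_le_sum
            intro A _
            have n3 : ∀ v ∈ C \ C.filter (fun v => w {v} = 0), 0 ≤ if v ∈ A then w A else 0 := by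
              intro S _; split_ifs; exacts [hw _, le_rfl]
            by_cases hA : w A = 0
            · rw [hA] at n3 ⊢; exact Finset.sum_nonneg n3
            obtain ⟨h1, h2⟩ := hs A hA
            obtain ⟨v, rfl⟩ := Finset.card_eq_one.1 h2
            have := Finset.single_le_sum n3 (a := v) (by simpa [hA] using h1)
            simpa using this
        _ ≤ ∑ v ∈ C \ C.filter (fun v => w {v} = 0), c := by
            rw [Finset.sum_comm]
            apply Finset.sum_le_sum
            intro v hv
            have := hd {v} (by simp)
            simp [dg] at this
            rw [← Finset.sum_filter]
            exact this
        _ = _ := by rw [Finset.sum_const, nsmul_eq_mul]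
    · intro hI0 v hv
      simp [hI hv, hI0 {v} (by simpa using hv)]
  | succ s ih =>
    intro c ε hc hε
    obtain ⟨γ, hγ⟩ : ∃ γ : ℝ, γ = ε / 3 := ⟨_, rfl⟩
    have hγ0 : 0 < γ := by rw [hγ]; positivity
    obtain ⟨η, hη0, hη1, hη2⟩ : ∃ η : ℝ, 0 < η ∧ η ≤ 1 ∧ c * 2 ^ (s + 1) * c * η ≤ ε / 3 := by
      refine ⟨min 1 (ε / (3 * (c * 2 ^ (s + 1) * c))), by positivity, min_le_left _ _, ?_⟩
      have := min_le_right 1 (ε / (3 * (c * 2 ^ (s + 1) * c)))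
      rw [le_div_iff₀ (by positivity)] at this
      linarith
    obtain ⟨δ', hδ', K', ih⟩ := ih (1 + c) (η * γ / 2) (by positivity) (by positivity)
    refine ⟨min δ' (ε / (3 * c)), by positivity, max K' (2 / η), ?_⟩
    intro α _ _ C p w hp hK hw hs hd he
    classical
    have hM : (0 : ℝ) ≤ #C := Nat.cast_nonneg _
    have hpM : 0 ≤ p * #C := mul_nonneg hp.le hM
    have hK1 : K' ≤ p * #C := (le_max_left _ _).trans hK
    have hK2 : 2 ≤ η * (p * #C) := by
      have := (le_max_right _ _).trans hK
      rw [div_le_iff₀ hη0] at this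
      linarith
    obtain ⟨B, hB⟩ : ∃ B : ℝ, B = η * (p * #C) := ⟨_, rfl⟩
    rw [← hB] at hK2
    let P : Finset α → Prop := fun T => (#T : ℝ) ≤ B ∧ ∃ G, VG w p c γ T G
    have hP0 : P ∅ := by
      refine ⟨by simp; linarith only [hK2], 0, ?_⟩
      refine ⟨by simp, by simp, ?_, by simp, by simp⟩
      intro S _
      have : dg (0 : Finset α → ℝ) S = 0 := by simp [dg]
      rw [this]; positivity
    obtain ⟨T1, hT1⟩ := exists_select P hP0
    have hGex : ∀ T, ∃ G, P T → VG w p c γ T G := by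
      intro T
      by_cases h : P T
      · obtain ⟨G, hG⟩ := h.2
        exact ⟨G, fun _ => hG⟩
      · exact ⟨0, fun h' => absurd h' h⟩
    choose Gf hGf using hGex
    have hih : ∀ T, ∃ Tf f : Finset α → Finset α, P T → B < #T + 1 → ∀ I ⊆ C, Tf I ⊆ I ∧ f I ⊆ C ∧
        (#(Tf I) : ℝ) ≤ s * (p * #C) ∧ (#(f I) : ℝ) ≤ (1 - δ') * #C ∧
        ((∀ A ⊆ I, Gf T A = 0) → I ⊆ f I ∪ Tf I) ∧
        ∀ J, Tf I ⊆ J → J ⊆ I → Tf J = Tf I ∧ f J = f I := by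
      intro T
      by_cases h : P T ∧ B < #T + 1
      · obtain ⟨hPT, hBT⟩ := h
        obtain ⟨g1, g2, g3, g4, g5⟩ := hGf T hPT
        obtain ⟨Tf, f, hh⟩ := ih α C p (Gf T) hp hK1 g1 (by
          intro A hA
          obtain ⟨v, _, hvA, hv⟩ := g2 A hA
          obtain ⟨h1, h2⟩ := hs _ hv
          refine ⟨(Finset.subset_insert _ _).trans h1, ?_⟩
          rw [Finset.card_insert_of_notMem hvA] at h2
          omega) g3 (by
          refine le_trans ?_ g4
          have : B / 2 ≤ #T := by linarith only [hBT, hK2]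
          calc η * γ / 2 * #C = B / 2 * (γ / p) := by rw [hB]; field_simp
            _ ≤ _ := by gcongr)
        exact ⟨Tf, f, fun _ _ => hh⟩
      · exact ⟨id, id, fun h1 h2 => absurd ⟨h1, h2⟩ h⟩
    choose T2 f2 h2 using hih
    refine ⟨fun I => if B < #(T1 I) + 1 then T1 I ∪ T2 (T1 I) I else T1 I,
      fun I => if B < #(T1 I) + 1 then f2 (T1 I) I else
        C.filter (fun v => ∑ A, NV w p (Gf (T1 I)) v A < γ / p), ?_⟩
    intro I hI
    obtain ⟨a1, a2, a3, a4⟩ := hT1 I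
    have hV := hGf _ a2
    by_cases hb : B < #(T1 I) + 1
    · obtain ⟨b1, b2, b3, b4, b5, b6⟩ := h2 (T1 I) a2 hb I hI
      simp only [if_pos hb]
      refine ⟨Finset.union_subset a1 b1, b2, ?_, ?_, ?_, ?_⟩
      · have : (#(T1 I ∪ T2 (T1 I) I) : ℝ) ≤ #(T1 I) + #(T2 (T1 I) I) := by
          exact_mod_cast Finset.card_union_le _ _
        have h3 : B ≤ p * #C := by
          rw [hB]
          exact mul_le_of_le_one_left hpM hη1
        have h4 := a2.1
        push_cast
        linarith only [this, h3, h4, b3]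
      · refine b4.trans ?_
        have := min_le_left δ' (ε / (3 * c))
        exact mul_le_mul_of_nonneg_right (by linarith only [this]) hM
      · intro hind
        have := b5 (by
          intro A hA
          by_contra hne
          obtain ⟨v, hv, hvA, hv2⟩ := hV.2.1 A hne
          exact hv2 (hind _ (Finset.insert_subset (a1 hv) hA)))
        intro x hx
        have := this hx
        simp only [mem_union] at this ⊢
        tauto
      · intro J hJ hJI
        have e1 := a4 J (Finset.subset_union_left.trans hJ) hJI
        obtain ⟨e2, e3⟩ := b6 J (Finset.subset_union_right.trans hJ) hJI
        rw [e1, if_pos hb, if_pos hb, e2, e3]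
        exact ⟨rfl, rfl⟩
    · simp only [if_neg hb]
      refine ⟨a1, Finset.filter_subset _ _, ?_, ?_, ?_, ?_⟩
      · have h3 : B ≤ p * #C := by
          rw [hB]
          exact mul_le_of_le_one_left hpM hη1
        have h4 := a2.1
        have : 0 ≤ s * (p * #C) := mul_nonneg (Nat.cast_nonneg _) hpM
        push_cast
        linarith only [this, h3, h4]
      · apply cardaux _ _ _ _ (Finset.filter_subset _ _)
        have hcount := count_lemma hp hc hγ0 hw C s hs hd hV
        have h5 := hV.2.2.2.2
        have h6 : ∑ A, Gf (T1 I) A ≤ c * η * #C := by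
          refine h5.trans ?_
          have := a2.1
          calc (#(T1 I) : ℝ) * (c / p) ≤ B * (c / p) := by gcongr
            _ = _ := by rw [hB]; field_simp
        have h7 : c * 2 ^ (s + 1) * ∑ A, Gf (T1 I) A ≤ ε / 3 * #C := by
          calc c * 2 ^ (s + 1) * ∑ A, Gf (T1 I) A ≤ c * 2 ^ (s + 1) * (c * η * #C) := by gcongr
            _ = (c * 2 ^ (s + 1) * c * η) * #C := by ring
            _ ≤ _ := mul_le_mul_of_nonneg_right hη2 hM
        have h8 := min_le_right δ' (ε / (3 * c))
        refine (mul_le_mul_of_nonneg_right h8 hM).trans ?_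
        rw [div_mul_eq_mul_div, div_le_iff₀ (by positivity)]
        rw [hγ] at hcount
        rw [hγ]
        linarith only [hcount, h7, he]
      · intro _ x hx
        by_contra hcon
        simp only [mem_union, mem_filter, not_or, not_and, not_lt] at hcon
        have hins := VG_insert hp hw hd hV hcon.2 (hcon.1 (hI hx))
        have := a3 (insert x (T1 I)) (Finset.insert_subset hx a1) (by
          refine ⟨?_, _, hins⟩
          rw [Finset.card_insert_of_notMem hcon.2]
          push_cast
          exact not_lt.1 hb) (Finset.subset_insert _ _)
        exact hcon.2 (this ▸ Finset.mem_insert_self x (T1 I))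
      · intro J hJ hJI
        have e1 := a4 J hJ hJI
        rw [e1, if_neg hb, if_neg hb]
        exact ⟨rfl, rfl⟩


lemma exists_enum {α : Type} [DecidableEq α] [Nonempty α] (ρ : α → ℕ) (Y : Finset α) (hρ : Set.InjOn ρ Y) :
    ∃ y : ℕ → α, (∀ i < #Y, y i ∈ Y) ∧ ∀ i j, i < j → j < #Y → ρ (y i) < ρ (y j) := by
  have hc : #(Y.image ρ) = #Y := Finset.card_image_of_injOn hρ
  have h : ∀ i, ∃ a, ∀ h : i < #Y, a ∈ Y ∧ ρ a = (Y.image ρ).orderEmbOfFin hc ⟨i, h⟩ := by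
    intro i
    by_cases h : i < #Y
    · have := (Y.image ρ).orderEmbOfFin_mem hc ⟨i, h⟩
      obtain ⟨a, ha, ha2⟩ := Finset.mem_image.1 this
      exact ⟨a, fun _ => ⟨ha, ha2⟩⟩
    · exact ⟨Classical.arbitrary α, fun h' => absurd h' h⟩
  choose y hy using h
  refine ⟨y, fun i hi => (hy i hi).1, fun i j hij hj => ?_⟩
  rw [(hy i (hij.trans hj)).2, (hy j hj).2]
  simpa using hij

lemma windows {α : Type} [DecidableEq α] [Nonempty α] (ρ : α → ℕ) (Y : Finset α) (hρ : Set.InjOn ρ Y)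
    (k g : ℕ) (hk : 1 ≤ k) (hg : 1 ≤ g) :
    ∃ W : Finset (Finset α), #Y ≤ #W + g * (k - 1) ∧
      (∀ A ∈ W, A ⊆ Y ∧ #A = k ∧ ∀ a ∈ A, ∀ b ∈ A, ρ a < ρ b → ρ a + g ≤ ρ b) ∧
      ∀ a, #(W.filter (fun A => a ∈ A)) ≤ k := by
  obtain ⟨y, hy1, hy2⟩ := exists_enum ρ Y hρ
  have hinj : ∀ i j, i < #Y → j < #Y → y i = y j → i = j := by
    intro i j hi hj h
    rcases lt_trichotomy i j with h' | h' | h'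
    · have := hy2 i j h' hj; rw [h] at this; omega
    · exact h'
    · have := hy2 j i h' hi; rw [h] at this; omega
  have hgap : ∀ d i, i + d < #Y → ρ (y i) + d ≤ ρ (y (i + d)) := by
    intro d
    induction d with
    | zero => intro i _; simp
    | succ d ih =>
      intro i hi
      have h1 := ih i (by omega)
      have h2 := hy2 (i + d) (i + (d + 1)) (by omega) hi
      omega
  obtain ⟨m, hm⟩ : ∃ m, m = #Y - g * (k - 1) := ⟨_, rfl⟩
  have hlt : ∀ i < m, ∀ j < k, i + g * j < #Y := by
    intro i hi j hj
    have : g * j ≤ g * (k - 1) := Nat.mul_le_mul_left _ (by omega)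
    omega
  let win : ℕ → Finset α := fun i => (range k).image (fun j => y (i + g * j))
  have hwin : ∀ i a, a ∈ win i ↔ ∃ j < k, y (i + g * j) = a := by
    intro i a; simp [win]
  refine ⟨(range m).image win, ?_, ?_, ?_⟩
  · rw [Finset.card_image_of_injOn]
    · simp; omega
    · intro i hi i' hi' h
      simp only [coe_range, Set.mem_Iio] at hi hi'
      have h1 : y i ∈ win i' := by
        rw [← h, hwin]; exact ⟨0, by omega, by simp⟩
      have h2 : y i' ∈ win i := by
        rw [h, hwin]; exact ⟨0, by omega, by simp⟩
      rw [hwin] at h1 h2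
      obtain ⟨j, hj, e⟩ := h1
      obtain ⟨j', hj', e'⟩ := h2
      have e1 := hinj _ _ (hlt i' hi' j hj) (by have := hlt i hi 0 (by omega); omega) e
      have e2 := hinj _ _ (hlt i hi j' hj') (by have := hlt i' hi' 0 (by omega); omega) e'
      omega
  · intro A hA
    obtain ⟨i, hi, rfl⟩ := Finset.mem_image.1 hA
    rw [mem_range] at hi
    refine ⟨?_, ?_, ?_⟩
    · intro a ha
      obtain ⟨j, hj, rfl⟩ := (hwin _ _).1 ha
      exact hy1 _ (hlt i hi j hj)
    · rw [Finset.card_image_of_injOn]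
      · simp
      · intro j hj j' hj' h
        simp only [coe_range, Set.mem_Iio] at hj hj'
        have := hinj _ _ (hlt i hi j hj) (hlt i hi j' hj') h
        have : g * j = g * j' := by omega
        exact Nat.eq_of_mul_eq_mul_left (by omega) this
    · intro a ha b hb hab
      obtain ⟨j, hj, rfl⟩ := (hwin _ _).1 ha
      obtain ⟨j', hj', rfl⟩ := (hwin _ _).1 hb
      have hjj : j < j' := by
        by_contra hcon
        push Not at hcon
        have h1 : g * j' ≤ g * j := Nat.mul_le_mul_left _ hcon
        have := hgap (g * j - g * j') (i + g * j') (by have := hlt i hi j hj; omega)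
        rw [show i + g * j' + (g * j - g * j') = i + g * j by omega] at this
        omega
      have h1 : g * (j + 1) ≤ g * j' := Nat.mul_le_mul_left _ hjj
      have h2 : g * (j + 1) = g * j + g := by ring
      have := hgap (g * j' - g * j) (i + g * j) (by have := hlt i hi j' hj'; omega)
      rw [show i + g * j + (g * j' - g * j) = i + g * j' by omega] at this
      omega
  · intro a
    by_cases ha : ∃ q < #Y, y q = a
    · obtain ⟨q, hq, rfl⟩ := ha
      have : ((range m).image win).filter (fun A => y q ∈ A) ⊆ (range k).image (fun j => win (q - g * j)) := by
        intro A hA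
        rw [mem_filter, mem_image] at hA
        obtain ⟨⟨i, hi, rfl⟩, hA⟩ := hA
        rw [mem_range] at hi
        obtain ⟨j, hj, e⟩ := (hwin _ _).1 hA
        have := hinj _ _ (hlt i hi j hj) hq e
        rw [mem_image]
        exact ⟨j, by simpa using hj, by rw [← this]; simp⟩
      calc _ ≤ _ := Finset.card_le_card this
        _ ≤ _ := Finset.card_image_le
        _ = k := by simp
    · have : ((range m).image win).filter (fun A => a ∈ A) = ∅ := by
        rw [Finset.filter_eq_empty_iff]
        intro A hA hcon
        obtain ⟨i, hi, rfl⟩ := Finset.mem_image.1 hA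
        rw [mem_range] at hi
        obtain ⟨j, hj, e⟩ := (hwin _ _).1 hcon
        exact ha ⟨_, hlt i hi j hj, e⟩
      rw [this]; simp


section Perms
variable {n : ℕ}

def IsPref (σ : Equiv.Perm (Fin n)) (F : Finset (Fin n)) : Prop := ∀ x ∈ F, ∀ y ∉ F, σ x < σ y

open scoped Classical in
noncomputable def PS (S : Finset (Finset (Fin n))) : Finset (Equiv.Perm (Fin n)) :=
  univ.filter (fun σ => ∀ F ∈ S, IsPref σ F)

lemma mem_PS {S : Finset (Finset (Fin n))} {σ : Equiv.Perm (Fin n)} :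
    σ ∈ PS S ↔ ∀ F ∈ S, IsPref σ F := by simp [PS]

lemma IsPref.comp {σ : Equiv.Perm (Fin n)} {F G : Finset (Fin n)} (hF : IsPref σ F) (hG : IsPref σ G)
    (h : #F ≤ #G) : F ⊆ G := by
  by_contra hcon
  obtain ⟨x, hx, hxG⟩ := Finset.not_subset.1 hcon
  have : G ⊆ F := by
    intro y hy
    by_contra hyF
    exact lt_asymm (hF x hx y hyF) (hG y hy x hxG)
  exact hcon (Finset.eq_of_subset_of_card_le this h).symm.subset

lemma IsPref.eq {σ : Equiv.Perm (Fin n)} {F G : Finset (Fin n)} (hF : IsPref σ F) (hG : IsPref σ G)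
    (h : #F = #G) : F = G := (hF.comp hG h.le).antisymm (hG.comp hF h.ge)

lemma exists_pref (σ : Equiv.Perm (Fin n)) (r : ℕ) (hr : r ≤ n) : ∃ F, IsPref σ F ∧ #F = r := by
  refine ⟨univ.filter (fun x => (σ x : ℕ) < r), ?_, ?_⟩
  · intro x hx y hy
    simp at hx hy
    exact Fin.lt_def.2 (by omega)
  · have : univ.filter (fun x => (σ x : ℕ) < r) = (univ.filter (fun x : Fin n => (x : ℕ) < r)).map σ.symm.toEmbedding := by
      ext x; simp [Finset.mem_map_equiv]
    rw [this, card_map]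
    rw [Fin.card_filter_val_lt]
    simp [hr]

lemma isPref_mul {σ τ : Equiv.Perm (Fin n)} {F : Finset (Fin n)} :
    IsPref (σ * τ) F ↔ IsPref σ (F.map τ.toEmbedding) := by
  constructor
  · intro h x hx y hy
    rw [Finset.mem_map_equiv] at hx hy
    simpa using h _ hx _ hy
  · intro h x hx y hy
    exact h (τ x) (by simpa using hx) (τ y) (by simpa using hy)

lemma exists_perm {F' F G : Finset (Fin n)} (hF : F' ⊆ F) (hG : F' ⊆ G) (h : #F = #G) :
    ∃ τ : Equiv.Perm (Fin n), (∀ x ∈ F', τ x = x) ∧ F.map τ.toEmbedding = G := by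
  obtain ⟨g, hg⟩ := Set.MapsTo.exists_equiv_extend_of_card_eq (α := {x // x ∈ F}) (t := G) (by simpa using h)
    (s := {x | x.1 ∈ F'}) (f := fun x => x.1) (by intro x hx; exact hG hx) (by
      intro x _ y _ h; exact Subtype.ext h)
  refine ⟨Equiv.extendSubtype (p := fun x => x ∈ F) (q := fun x => x ∈ G) g, ?_, ?_⟩
  · intro x hx
    rw [Equiv.extendSubtype_apply_of_mem _ _ (hF hx)]
    exact hg ⟨x, hF hx⟩ hx
  · apply Finset.eq_of_subset_of_card_le
    · intro y hy
      obtain ⟨x, hx, rfl⟩ := Finset.mem_map.1 hy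
      exact Equiv.extendSubtype_mem _ _ hx
    · simp [h]

lemma card_PS_insert_eq {S : Finset (Finset (Fin n))} {F' F G : Finset (Fin n)} (hS : ∀ H ∈ S, H ⊆ F')
    (hF : F' ⊆ F) (hG : F' ⊆ G) (h : #F = #G) : #(PS (insert F S)) = #(PS (insert G S)) := by
  obtain ⟨τ, h1, h2⟩ := exists_perm hF hG h
  have h3 : ∀ H ∈ S, H.map τ.toEmbedding = H := by
    intro H hH
    apply Finset.eq_of_subset_of_card_le
    · intro y hy
      obtain ⟨x, hx, rfl⟩ := Finset.mem_map.1 hy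
      simpa [h1 x (hS H hH hx)] using hx
    · simp
  symm
  apply Finset.card_bij (fun σ _ => σ * τ)
  · intro σ hσ
    rw [mem_PS] at hσ ⊢
    intro H hH
    rw [isPref_mul]
    rcases Finset.mem_insert.1 hH with rfl | hH
    · rw [h2]; exact hσ G (by simp)
    · rw [h3 H hH]; exact hσ H (by simp [hH])
  · intro a _ b _ hab
    exact mul_right_cancel hab
  · intro σ hσ
    refine ⟨σ * τ⁻¹, ?_, by simp⟩
    rw [mem_PS] at hσ ⊢
    intro H hH
    rcases Finset.mem_insert.1 hH with rfl | hH
    · rw [← h2, ← isPref_mul]; simpa using hσ F (by simp)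
    · rw [← h3 H hH, ← isPref_mul]; simpa using hσ H (by simp [hH])

lemma PS_insert {S : Finset (Finset (Fin n))} {F : Finset (Fin n)} {σ : Equiv.Perm (Fin n)} :
    σ ∈ PS (insert F S) ↔ IsPref σ F ∧ σ ∈ PS S := by
  simp [mem_PS]

lemma card_PS_insert_le {S : Finset (Finset (Fin n))} {F G : Finset (Fin n)} (hS : ∀ H ∈ S, H ⊆ F)
    (hG : F ⊆ G) : #(PS (insert G S)) * (n - #F).choose (#G - #F) ≤ #(PS S) := by
  classical
  have hd : ∀ P ∈ powersetCard (#G - #F) Fᶜ, #(F ∪ P) = #G ∧ Disjoint F P := by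
    intro P hP
    rw [mem_powersetCard] at hP
    have hdis : Disjoint F P := by
      rw [Finset.disjoint_left]
      intro x hx hxP
      have := hP.1 hxP
      simp [hx] at this
    rw [Finset.card_union_of_disjoint hdis, hP.2]
    have := Finset.card_le_card hG
    exact ⟨by omega, hdis⟩
  calc #(PS (insert G S)) * (n - #F).choose (#G - #F)
      = ∑ P ∈ powersetCard (#G - #F) Fᶜ, #(PS (insert (F ∪ P) S)) := by
        rw [Finset.sum_congr rfl (g := fun _ => #(PS (insert G S)))]
        · rw [Finset.sum_const, card_powersetCard, card_compl]
          simp [mul_comm]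
        · intro P hP
          exact card_PS_insert_eq hS subset_union_left hG (hd P hP).1
    _ = #((powersetCard (#G - #F) Fᶜ).biUnion (fun P => PS (insert (F ∪ P) S))) := by
        rw [Finset.card_biUnion]
        intro P hP P' hP' hne
        rw [Function.onFun, Finset.disjoint_left]
        intro σ h1 h2
        rw [PS_insert] at h1 h2
        have e := h1.1.eq h2.1 (by rw [(hd P hP).1, (hd P' hP').1])
        apply hne
        have := congrArg (fun X => X \ F) e
        simpa [Finset.union_sdiff_cancel_left (hd P hP).2, Finset.union_sdiff_cancel_left (hd P' hP').2] using this
    _ ≤ _ := by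
        apply Finset.card_le_card
        intro σ hσ
        obtain ⟨P, _, h⟩ := Finset.mem_biUnion.1 hσ
        exact (PS_insert.1 h).2

lemma card_PS_single (F : Finset (Fin n)) : #(PS {F}) * n.choose #F = n.factorial := by
  classical
  calc #(PS {F}) * n.choose #F
      = ∑ P ∈ powersetCard #F (univ : Finset (Fin n)), #(PS {P}) := by
        rw [Finset.sum_congr rfl (g := fun _ => #(PS {F}))]
        · rw [Finset.sum_const, card_powersetCard]
          simp [mul_comm]
        · intro P hP
          rw [mem_powersetCard] at hP
          exact card_PS_insert_eq (S := ∅) (F' := ∅) (by simp) (by simp) (by simp) hP.2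
    _ = #((powersetCard #F (univ : Finset (Fin n))).biUnion (fun P => PS {P})) := by
        rw [Finset.card_biUnion]
        intro P hP P' hP' hne
        rw [Function.onFun, Finset.disjoint_left]
        intro σ h1 h2
        rw [mem_coe, mem_powersetCard] at hP hP'
        apply hne
        exact (mem_PS.1 h1 P (by simp)).eq (mem_PS.1 h2 P' (by simp)) (by rw [hP.2, hP'.2])
    _ = #(univ : Finset (Equiv.Perm (Fin n))) := by
        congr 1
        apply Finset.eq_univ_of_forall
        intro σ
        obtain ⟨P, h1, h2⟩ := exists_pref σ #F (by simpa using Finset.card_le_univ F)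
        rw [Finset.mem_biUnion]
        exact ⟨P, by simp [mem_powersetCard, h2], by simpa [mem_PS] using h1⟩
    _ = _ := by simp [Fintype.card_perm]

lemma card_PS_chain (Q : ℝ) (hQ0 : 0 ≤ Q) (S : Finset (Finset (Fin n))) (hne : S.Nonempty)
    (hc : ∀ F ∈ S, ∀ G ∈ S, F ≠ G → #F ≤ #G → F ⊆ G ∧ Q ≤ (n - #F).choose (#G - #F)) :
    ∃ F ∈ S, (#(PS S) : ℝ) * Q ^ (#S - 1) ≤ #(PS {F}) := by
  revert hne hc
  refine Finset.induction_on_max_value (fun F : Finset (Fin n) => #F) S ?_ ?_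
  · intro hne; simp at hne
  · intro G s hG hmax ih hne hc
    rcases s.eq_empty_or_nonempty with rfl | hs
    · exact ⟨G, by simp, by simp⟩
    · obtain ⟨F, hF, hle⟩ := ih hs (fun F hF G hG => hc F (by simp [hF]) G (by simp [hG]))
      refine ⟨F, by simp [hF], le_trans ?_ hle⟩
      obtain ⟨H, hH, hHmax⟩ := Finset.exists_max_image s (fun F => #F) hs
      have hHG := hc H (by simp [hH]) G (by simp) (by rintro rfl; exact hG hH) (hmax H hH)
      have h1 := card_PS_insert_le (S := s) (F := H) (G := G) (by
        intro K hK
        by_cases hKH : K = H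
        · rw [hKH]
        · exact (hc K (by simp [hK]) H (by simp [hH]) hKH (hHmax K hK)).1) hHG.1
      have h2 : (#(PS (insert G s)) : ℝ) * (n - #H).choose (#G - #H) ≤ #(PS s) := by exact_mod_cast h1
      rw [Finset.card_insert_of_notMem hG]
      obtain ⟨m, hm⟩ := Nat.exists_eq_succ_of_ne_zero hs.card_pos.ne'
      rw [hm]
      simp only [Nat.succ_eq_add_one, Nat.add_sub_cancel]
      rw [pow_succ]
      calc (#(PS (insert G s)) : ℝ) * (Q ^ m * Q) = (#(PS (insert G s)) * Q) * Q ^ m := by ring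
        _ ≤ (#(PS (insert G s)) * (n - #H).choose (#G - #H)) * Q ^ m := by
            gcongr; exact hHG.2
        _ ≤ _ := by gcongr

lemma choose_lower_s5 (g m d : ℕ) (hd : g ≤ d) (hm : d ≤ m) (x : ℝ) (hx0 : 0 ≤ x) (hx : x ≤ (m - d : ℕ)) :
    x ^ g / g.factorial ≤ m.choose d := by
  have h1 : (m - d + g).choose g ≤ m.choose d := by
    calc (m - d + g).choose g = (m - d + g).choose (m - d) := by
          rw [← Nat.choose_symm_of_eq_add]; omega
      _ ≤ m.choose (m - d) := Nat.choose_le_choose _ (by omega)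
      _ = _ := Nat.choose_symm hm
  have h2 := Nat.pow_le_choose (α := ℝ) g (m - d + g)
  have h3 : ((m - d + g).choose g : ℝ) ≤ m.choose d := by exact_mod_cast h1
  refine le_trans ?_ (h2.trans h3)
  have h4 : ((m - d : ℕ) : ℝ) ≤ ((m - d + g + 1 - g : ℕ) : ℝ) := by
    exact_mod_cast (by omega)
  gcongr
  linarith

theorem supersat_s5 (k g : ℕ) (hk : 1 ≤ k) (hg : 1 ≤ g) (hn : 0 < n) (C : Finset (Finset (Fin n)))
    (hC : ∀ F ∈ C, (n : ℝ) / 4 ≤ (n - #F : ℕ)) :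
    ∃ w : Finset (Finset (Fin n)) → ℝ, (∀ A, 0 ≤ w A) ∧
      (∀ A, w A ≠ 0 → A ⊆ C ∧ #A = k ∧ ∀ F ∈ A, ∀ G ∈ A, F ⊆ G ∨ G ⊆ F) ∧
      (∀ S, S.Nonempty → dg w S * (((n : ℝ) / 4) ^ g / g.factorial) ^ (#S - 1) ≤ k) ∧
      (#C : ℝ) - g * (k - 1) * n.choose (n / 2) ≤ ∑ A, w A := by
  classical
  set N := n.choose (n / 2) with hN
  let Y : Equiv.Perm (Fin n) × ℕ → Finset (Finset (Fin n)) := fun ω =>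
    C.filter (fun F => IsPref ω.1 F ∧ ω.2 < n.choose #F)
  have hYinj : ∀ ω, Set.InjOn (fun F : Finset (Fin n) => #F) (Y ω) := by
    intro ω F hF G hG h
    simp only [Y, coe_filter, Set.mem_ofPred_eq] at hF hG
    exact hF.2.1.eq hG.2.1 h
  choose W hW1 hW2 hW3 using fun ω => windows (fun F : Finset (Fin n) => #F) (Y ω) (hYinj ω) k g hk hg
  let Ω : Finset (Equiv.Perm (Fin n) × ℕ) := univ ×ˢ range N
  have hfac : (0 : ℝ) < n.factorial := by exact_mod_cast n.factorial_pos
  have hΩ : ∀ (S : Finset (Finset (Fin n))), ∀ F ∈ S,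
      #(Ω.filter (fun ω => S ⊆ Y ω)) ≤ #(PS S) * n.choose #F := by
    intro S F hF
    calc _ ≤ #(PS S ×ˢ range (n.choose #F)) := by
          apply Finset.card_le_card
          intro ω hω
          rw [mem_filter] at hω
          rw [mem_product, mem_PS, mem_range]
          refine ⟨fun G hG => ?_, ?_⟩
          · have := hω.2 hG
            simp only [Y, mem_filter] at this
            exact this.2.1
          · have := hω.2 hF
            simp only [Y, mem_filter] at this
            exact this.2.2
      _ = _ := by simp
  refine ⟨fun A => (∑ ω ∈ Ω, if A ∈ W ω then (1 : ℝ) else 0) / n.factorial, ?_, ?_, ?_, ?_⟩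
  · intro A
    apply div_nonneg _ hfac.le
    apply Finset.sum_nonneg
    intro ω _
    split_ifs <;> simp
  · intro A hA
    have : ∃ ω ∈ Ω, A ∈ W ω := by
      by_contra hcon
      push Not at hcon
      apply hA
      dsimp only
      rw [Finset.sum_eq_zero]
      · simp
      · intro ω hω
        rw [if_neg (hcon ω hω)]
    obtain ⟨ω, _, hω⟩ := this
    obtain ⟨h1, h2, _⟩ := hW2 ω A hω
    refine ⟨h1.trans (Finset.filter_subset _ _), h2, ?_⟩
    intro F hF G hG
    have hF := h1 hF
    have hG := h1 hG
    simp only [Y, mem_filter] at hF hG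
    rcases le_total #F #G with h | h
    · exact Or.inl (hF.2.1.comp hG.2.1 h)
    · exact Or.inr (hG.2.1.comp hF.2.1 h)
  · intro S hS
    set Q := ((n : ℝ) / 4) ^ g / g.factorial with hQ
    have hQ0 : 0 ≤ Q := by positivity
    have e1 : dg (fun A => (∑ ω ∈ Ω, if A ∈ W ω then (1 : ℝ) else 0) / n.factorial) S
        = (∑ ω ∈ Ω, (#((W ω).filter (fun A => S ⊆ A)) : ℝ)) / n.factorial := by
      unfold dg
      rw [← Finset.sum_div, Finset.sum_comm]
      congr 1
      apply Finset.sum_congr rfl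
      intro ω _
      rw [← Finset.sum_filter, Finset.sum_const, nsmul_eq_mul, mul_one, Finset.filter_filter]
      congr 2
      ext A
      simp [and_comm]
    have hk0 : (0 : ℝ) ≤ k := Nat.cast_nonneg _
    by_cases hex : ∃ ω ∈ Ω, ∃ A ∈ W ω, S ⊆ A
    · obtain ⟨ω, _, A, hA, hSA⟩ := hex
      obtain ⟨h1, h2, h3⟩ := hW2 ω A hA
      obtain ⟨F, hF, hle⟩ := card_PS_chain Q hQ0 S hS (by
        intro F hF G hG hne hFG
        have hF1 := h1 (hSA hF)
        have hG1 := h1 (hSA hG)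
        have hlt : #F < #G := lt_of_le_of_ne hFG (fun h => hne (hYinj ω hF1 hG1 h))
        have hgap := h3 F (hSA hF) G (hSA hG) hlt
        simp only [Y, mem_filter] at hF1 hG1
        refine ⟨hF1.2.1.comp hG1.2.1 hFG, ?_⟩
        have hGn : #G ≤ n := by simpa using Finset.card_le_univ G
        have := hC G hG1.1
        apply choose_lower_s5 g (n - #F) (#G - #F) (by omega) (by omega) _ (by positivity)
        rwa [show n - #F - (#G - #F) = n - #G by omega])
      have h4 : (∑ ω ∈ Ω, (#((W ω).filter (fun A => S ⊆ A)) : ℝ)) ≤ k * (#(PS S) * n.choose #F) := by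
        calc _ ≤ ∑ ω ∈ Ω, (if S ⊆ Y ω then (k : ℝ) else 0) := by
              apply Finset.sum_le_sum
              intro ω _
              split_ifs with h
              · obtain ⟨F, hF⟩ := hS
                exact_mod_cast (Finset.card_le_card (by
                  intro A hA
                  rw [mem_filter] at hA ⊢
                  exact ⟨hA.1, hA.2 hF⟩)).trans (hW3 ω F)
              · rw [Finset.filter_eq_empty_iff.2]
                · simp
                · intro A hA hcon
                  exact h (hcon.trans (hW2 ω A hA).1)
          _ = k * (#(Ω.filter (fun ω => S ⊆ Y ω)) : ℝ) := by
              rw [← Finset.sum_filter, Finset.sum_const, nsmul_eq_mul, mul_comm]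
          _ ≤ _ := by
              gcongr
              exact_mod_cast hΩ S F hF
      have h5 : (#(PS {F}) : ℝ) * n.choose #F = n.factorial := by exact_mod_cast card_PS_single F
      rw [e1, div_mul_eq_mul_div, div_le_iff₀ hfac]
      calc _ ≤ (k * (#(PS S) * n.choose #F)) * Q ^ (#S - 1) := by gcongr
        _ = k * ((#(PS S) * Q ^ (#S - 1)) * n.choose #F) := by ring
        _ ≤ k * (#(PS {F}) * n.choose #F) := by gcongr
        _ = _ := by rw [h5]
    · push Not at hex
      rw [e1, Finset.sum_eq_zero]
      · simp
      · intro ω hω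
        rw [Finset.filter_eq_empty_iff.2]
        · simp
        · intro A hA
          exact hex ω hω A hA
  · have e1 : ∑ A, (∑ ω ∈ Ω, if A ∈ W ω then (1 : ℝ) else 0) / n.factorial
        = (∑ ω ∈ Ω, (#(W ω) : ℝ)) / n.factorial := by
      rw [← Finset.sum_div, Finset.sum_comm]
      congr 1
      apply Finset.sum_congr rfl
      intro ω _
      simp
    rw [e1, le_div_iff₀ hfac]
    have e2 : ∑ ω ∈ Ω, (#(Y ω) : ℝ) = #C * n.factorial := by
      calc ∑ ω ∈ Ω, (#(Y ω) : ℝ) = ∑ ω ∈ Ω, ∑ F ∈ C, (if IsPref ω.1 F ∧ ω.2 < n.choose #F then (1 : ℝ) else 0) := by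
            apply Finset.sum_congr rfl
            intro ω _
            simp [Y]
        _ = ∑ F ∈ C, (n.factorial : ℝ) := by
            rw [Finset.sum_comm]
            apply Finset.sum_congr rfl
            intro F _
            rw [← card_PS_single F, ← Finset.sum_filter, Finset.sum_const, nsmul_eq_mul, mul_one]
            have : Ω.filter (fun ω => IsPref ω.1 F ∧ ω.2 < n.choose #F) = PS {F} ×ˢ range (n.choose #F) := by
              ext ω
              have := Nat.choose_le_middle #F n
              simp only [Ω, mem_filter, mem_product, mem_univ, true_and, mem_range, mem_PS, mem_singleton, forall_eq]
              constructor
              · rintro ⟨_, h⟩; exact h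
              · rintro ⟨h1, h2⟩; exact ⟨by omega, h1, h2⟩
            rw [this]; simp
        _ = _ := by simp
    have e3 : ∑ ω ∈ Ω, (#(Y ω) : ℝ) ≤ ∑ ω ∈ Ω, ((#(W ω) : ℝ) + g * (k - 1)) := by
      apply Finset.sum_le_sum
      intro ω _
      have : (#(Y ω) : ℝ) ≤ ((#(W ω) + g * (k - 1) : ℕ) : ℝ) := by exact_mod_cast hW1 ω
      push_cast [Nat.cast_sub hk] at this
      exact this
    rw [e2, Finset.sum_add_distrib, Finset.sum_const, nsmul_eq_mul] at e3
    have e4 : #Ω = n.factorial * N := by simp [Ω, Fintype.card_perm]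
    rw [e4] at e3
    push_cast at e3
    linarith
end Perms

lemma ev_large (g : ℕ) (K β : ℝ) (hβ : 0 < β) :
    ∀ᶠ n : ℕ in Filter.atTop, K ≤ ((n : ℝ) ^ g)⁻¹ * (β * n.choose (n / 2)) := by
  have h := tendsto_pow_const_div_const_pow_of_one_lt (g + 1) (r := (2 : ℝ)) (by norm_num)
  have h2 := h.eventually (gt_mem_nhds (show (0 : ℝ) < β / (2 * (|K| + 1)) by positivity))
  filter_upwards [h2, Filter.eventually_ge_atTop 1] with n hn hn1
  have hn0 : (1 : ℝ) ≤ n := by exact_mod_cast hn1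
  have h3 : 2 ^ n ≤ (n + 1) * n.choose (n / 2) := by
    rw [← Nat.sum_range_choose]
    calc _ ≤ ∑ i ∈ range (n + 1), n.choose (n / 2) := Finset.sum_le_sum fun i _ => Nat.choose_le_middle i n
      _ = _ := by simp
  have h4 : (2 : ℝ) ^ n ≤ (n + 1) * n.choose (n / 2) := by exact_mod_cast h3
  have hN : (0 : ℝ) ≤ n.choose (n / 2) := by positivity
  have h5 : (2 : ℝ) ^ n ≤ 2 * n * n.choose (n / 2) := by nlinarith
  rw [div_lt_div_iff₀ (by positivity) (by positivity)] at hn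
  have h6 : K ≤ |K| + 1 := by linarith [le_abs_self K]
  refine h6.trans ?_
  rw [inv_mul_eq_div, le_div_iff₀ (by positivity)]
  have h7 : (n : ℝ) ^ (g + 1) * (2 * (|K| + 1)) ≤ β * (2 * n * n.choose (n / 2)) :=
    hn.le.trans (by gcongr)
  have h8 : (2 * (n : ℝ)) * ((|K| + 1) * n ^ g) ≤ (2 * (n : ℝ)) * (β * n.choose (n / 2)) := by
    rw [pow_succ] at h7; linarith
  exact le_of_mul_le_mul_left h8 (by positivity)

lemma choose_double (n m j : ℕ) (h : 3 * (m + j) ≤ n) : n.choose m * 2 ^ j ≤ n.choose (m + j) := by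
  induction j with
  | zero => simp
  | succ j ih =>
    have h1 := ih (by omega)
    have h2 := Nat.choose_succ_right_eq n (m + j)
    have h3 : 2 * (m + j + 1) ≤ n - (m + j) := by omega
    have h4 : n.choose (m + j) * 2 ≤ n.choose (m + j + 1) := by
      have : n.choose (m + j) * 2 * (m + j + 1) ≤ n.choose (m + j + 1) * (m + j + 1) := by
        rw [h2, mul_assoc]; exact Nat.mul_le_mul_left _ h3
      exact Nat.le_of_mul_le_mul_right this (by omega)
    calc n.choose m * 2 ^ (j + 1) = n.choose m * 2 ^ j * 2 := by ring
      _ ≤ n.choose (m + j) * 2 := Nat.mul_le_mul_right _ h1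
      _ ≤ _ := h4

lemma ev_tail (a : ℝ) (ha : 0 < a) : ∀ᶠ n : ℕ in Filter.atTop,
    (#(univ.filter (fun F : Finset (Fin n) => 4 * (n - #F) < n)) : ℝ) ≤ a * n.choose (n / 2) := by
  have h := tendsto_pow_const_div_const_pow_of_one_lt 1 (r := (2 : ℝ)) (by norm_num)
  have hh := h.comp (Nat.tendsto_div_const_atTop (n := 12) (by norm_num))
  have h2 := hh.eventually (gt_mem_nhds (show (0 : ℝ) < a / 24 by positivity))
  filter_upwards [h2, Filter.eventually_ge_atTop 12] with n hn hn1
  simp only [Function.comp, pow_one] at hn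
  have hj : 1 ≤ n / 12 := by omega
  obtain ⟨j, hjd⟩ : ∃ j, j = n / 12 := ⟨_, rfl⟩
  rw [← hjd] at hn hj
  rw [div_lt_div_iff₀ (by positivity) (by positivity)] at hn
  have h3 : #(univ.filter (fun F : Finset (Fin n) => 4 * (n - #F) < n)) * 2 ^ j ≤ (n + 1) * n.choose (n / 2) := by
    have hsub : univ.filter (fun F : Finset (Fin n) => 4 * (n - #F) < n) ⊆
        ((range (n + 1)).filter (fun r => 4 * (n - r) < n)).biUnion (fun r => powersetCard r univ) := by
      intro F hF
      simp only [mem_filter, mem_univ, true_and] at hF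
      have hFn : #F ≤ n := by simpa using Finset.card_le_univ F
      simp only [mem_biUnion, mem_filter, mem_range, mem_powersetCard]
      exact ⟨#F, ⟨by omega, hF⟩, by simp, rfl⟩
    calc _ ≤ (∑ r ∈ (range (n + 1)).filter (fun r => 4 * (n - r) < n), n.choose r) * 2 ^ j := by
          apply Nat.mul_le_mul_right
          refine (Finset.card_le_card hsub).trans (Finset.card_biUnion_le.trans ?_)
          simp
      _ = ∑ r ∈ (range (n + 1)).filter (fun r => 4 * (n - r) < n), n.choose r * 2 ^ j := by
          rw [Finset.sum_mul]
      _ ≤ ∑ r ∈ (range (n + 1)).filter (fun r => 4 * (n - r) < n), n.choose (n / 2) := by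
          apply Finset.sum_le_sum
          intro r hr
          simp only [mem_filter, mem_range] at hr
          rw [← Nat.choose_symm (by omega : r ≤ n)]
          exact (choose_double n (n - r) j (by omega)).trans (Nat.choose_le_middle _ _)
      _ ≤ ∑ r ∈ range (n + 1), n.choose (n / 2) :=
          Finset.sum_le_sum_of_subset (Finset.filter_subset _ _)
      _ = _ := by simp
  have h4 : (#(univ.filter (fun F : Finset (Fin n) => 4 * (n - #F) < n)) : ℝ) * 2 ^ j ≤ (n + 1) * n.choose (n / 2) := by
    exact_mod_cast h3
  have h5 : ((n : ℝ) + 1) ≤ 24 * j := by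
    exact_mod_cast (by omega : n + 1 ≤ 24 * j)
  have h6 : ((n : ℝ) + 1) ≤ a * 2 ^ j := by linarith
  have hN : (0 : ℝ) ≤ n.choose (n / 2) := by positivity
  have h7 := h4.trans (mul_le_mul_of_nonneg_right h6 hN)
  have h8 : (0 : ℝ) < 2 ^ j := by positivity
  refine le_of_mul_le_mul_right ?_ h8
  linarith

theorem main_g (k g : ℕ) (hk : 1 ≤ k) (hg : 1 ≤ g) (α : ℝ) (hα : 0 < α) :
    ∃ δ : ℝ, 0 < δ ∧ ∀ᶠ n : ℕ in Filter.atTop, ∀ C : Finset (Finset (Fin n)),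
      (g * ((k : ℝ) - 1) + α) * (n.choose (n / 2)) ≤ (C.card : ℝ) →
      ∃ Tf f : Finset (Finset (Fin n)) → Finset (Finset (Fin n)), ∀ I ⊆ C, Tf I ⊆ I ∧ f I ⊆ C ∧
        (#(Tf I) : ℝ) ≤ k * ((n : ℝ) ^ g)⁻¹ * #C ∧ (#(f I) : ℝ) ≤ (1 - δ) * #C ∧
        (NoKChain k I → I ⊆ f I ∪ Tf I) ∧ f (Tf I) = f I := by
  obtain ⟨c0, hc0⟩ : ∃ c0 : ℝ, c0 = 4 ^ g * g.factorial := ⟨_, rfl⟩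
  have hc1 : 1 ≤ c0 := by
    rw [hc0]
    have h1 : (1 : ℝ) ≤ g.factorial := by exact_mod_cast g.factorial_pos
    have h2 : (1 : ℝ) ≤ 4 ^ g := one_le_pow₀ (by norm_num)
    nlinarith
  have hkR : (1 : ℝ) ≤ k := by exact_mod_cast hk
  obtain ⟨β, hβ⟩ : ∃ β : ℝ, β = g * ((k : ℝ) - 1) + α := ⟨_, rfl⟩
  have hβ0 : 0 < β := by
    rw [hβ]
    have : 0 ≤ (g : ℝ) * ((k : ℝ) - 1) := mul_nonneg (Nat.cast_nonneg _) (by linarith)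
    linarith
  have hβα : α ≤ β := by
    rw [hβ]
    have : 0 ≤ (g : ℝ) * ((k : ℝ) - 1) := mul_nonneg (Nat.cast_nonneg _) (by linarith)
    linarith
  obtain ⟨δ, hδ, K, hcont⟩ := container (k - 1) (k * c0 ^ k) (α / (2 * β)) (by positivity) (by positivity)
  refine ⟨δ, hδ, ?_⟩
  filter_upwards [ev_large g K β hβ0, ev_tail (α / 2) (by positivity), Filter.eventually_ge_atTop 1]
    with n hn1 hn2 hn3 C hC
  rw [← hβ] at hC
  have hn0 : (0 : ℝ) < n := by exact_mod_cast hn3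
  have hM : (0 : ℝ) ≤ #C := Nat.cast_nonneg _
  obtain ⟨p, hp⟩ : ∃ p : ℝ, p = ((n : ℝ) ^ g)⁻¹ := ⟨_, rfl⟩
  have hp0 : 0 < p := by rw [hp]; positivity
  obtain ⟨w, w1, w2, w3, w4⟩ := supersat_s5 k g hk hg hn3 (C.filter (fun F => ¬ 4 * (n - #F) < n)) (by
    intro F hF
    rw [mem_filter, not_lt] at hF
    have : (n : ℝ) ≤ 4 * (n - #F : ℕ) := by exact_mod_cast hF.2
    linarith)
  have hcard : (#C : ℝ) ≤ #(C.filter (fun F => ¬ 4 * (n - #F) < n)) + α / 2 * n.choose (n / 2) := by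
    have h1 := Finset.card_filter_add_card_filter_not (s := C) (fun F => 4 * (n - #F) < n)
    have h2 : #(C.filter (fun F => 4 * (n - #F) < n)) ≤ #(univ.filter (fun F : Finset (Fin n) => 4 * (n - #F) < n)) :=
      Finset.card_le_card (Finset.filter_subset_filter _ (Finset.subset_univ _))
    have h1' : (#(C.filter (fun F => 4 * (n - #F) < n)) : ℝ) + #(C.filter (fun F => ¬ 4 * (n - #F) < n)) = #C := by
      exact_mod_cast h1
    have h2' : (#(C.filter (fun F => 4 * (n - #F) < n)) : ℝ) ≤ #(univ.filter (fun F : Finset (Fin n) => 4 * (n - #F) < n)) := by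
      exact_mod_cast h2
    linarith
  obtain ⟨Tf, f, hTf⟩ := hcont (Finset (Fin n)) C p w hp0 (by
      rw [hp]
      refine hn1.trans ?_
      gcongr) w1 (by
      intro A hA
      obtain ⟨h1, h2, _⟩ := w2 A hA
      exact ⟨h1.trans (Finset.filter_subset _ _), by omega⟩) (by
      intro S hS
      by_cases hSk : #S ≤ k
      · have h3 := w3 S hS
        have hQ : ((n : ℝ) / 4) ^ g / g.factorial = (c0 * p)⁻¹ := by
          rw [hc0, hp, div_pow]; field_simp
        rw [hQ, inv_pow, ← div_eq_mul_inv, div_le_iff₀ (by positivity), mul_pow] at h3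
        refine h3.trans ?_
        rw [← mul_assoc]
        have : c0 ^ (#S - 1) ≤ c0 ^ k := pow_le_pow_right₀ hc1 (by omega)
        gcongr
      · have : dg w S = 0 := by
          unfold dg
          apply Finset.sum_eq_zero
          intro A hA
          simp only [mem_filter, mem_univ, true_and] at hA
          by_contra hne
          have h1 := (w2 A hne).2.1
          have h2 := Finset.card_le_card hA
          omega
        rw [this]; positivity) (by
      refine le_trans ?_ w4
      have h1 : α / (2 * β) * #C = #C - (1 - α / (2 * β)) * #C := by ring
      have h2 : 0 ≤ 1 - α / (2 * β) := by
        rw [sub_nonneg, div_le_one (by positivity)]; linarith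
      have h3 := mul_le_mul_of_nonneg_left hC h2
      have h4 : (1 - α / (2 * β)) * (β * n.choose (n / 2)) = (β - α / 2) * n.choose (n / 2) := by
        field_simp
      rw [h4, hβ] at h3
      rw [h1, hβ]
      linarith)
  refine ⟨Tf, f, fun I hI => ?_⟩
  obtain ⟨h1, h2, h3, h4, h5, h6⟩ := hTf I hI
  refine ⟨h1, h2, ?_, h4, ?_, (h6 _ (Finset.Subset.refl _) h1).2⟩
  · refine h3.trans ?_
    rw [mul_assoc, ← hp]
    have : ((k - 1 : ℕ) : ℝ) ≤ k := by exact_mod_cast Nat.sub_le _ _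
    exact mul_le_mul_of_nonneg_right this (mul_nonneg hp0.le hM)
  · intro hI0
    apply h5
    intro A hA
    by_contra hne
    obtain ⟨_, e2, e3⟩ := w2 A hne
    refine hI0 A hA ⟨e2, ?_⟩
    intro F hF G hG hFG
    rcases e3 F hF G hG with h | h
    · exact Or.inl (h.ssubset_of_ne hFG)
    · exact Or.inr (h.ssubset_of_ne hFG.symm)

open scoped Classical in
/-- Specialized hypergraph container lemma for `k`-chains. -/
theorem statement5 (k : ℕ) (hk : 2 ≤ k) (α : ℝ) (hα : 0 < α) :
    ∃ δ : ℝ, 0 < δ ∧ ∀ᶠ n : ℕ in Filter.atTop, ∀ C : Finset (Finset (Fin n)),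
      ((k : ℝ) - 1 + α) * (n.choose (n / 2)) ≤ (C.card : ℝ) →
      ∃ (𝒞 : Finset (Finset (Finset (Fin n))))
        (f : Finset (Finset (Fin n)) → Finset (Finset (Fin n))),
        (∀ C' ∈ 𝒞, C' ⊆ C) ∧
        (∀ T ⊆ C, f T ∈ 𝒞) ∧
        (∀ I ⊆ C, NoKChain k I → ∃ T ⊆ I,
          (T.card : ℝ) ≤ (k : ℝ) *
            (if (C.card : ℝ) ≤ 3 * k * (n.choose (n / 2)) then ((n : ℝ))⁻¹
              else ((n : ℝ) ^ 3)⁻¹) * (C.card : ℝ) ∧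
          I ⊆ f T ∪ T) ∧
        (∀ C' ∈ 𝒞, (C'.card : ℝ) ≤ (1 - δ) * (C.card : ℝ)) := by
  obtain ⟨δ1, hδ1, H1⟩ := main_g k 1 (by omega) le_rfl α hα
  obtain ⟨δ3, hδ3, H3⟩ := main_g k 3 (by omega) (by norm_num) 3 (by norm_num)
  refine ⟨min δ1 δ3, lt_min hδ1 hδ3, ?_⟩
  filter_upwards [H1, H3] with n H1 H3 C hC
  have hM : (0 : ℝ) ≤ C.card := Nat.cast_nonneg _
  obtain ⟨Tf, f, h⟩ : ∃ Tf f : Finset (Finset (Fin n)) → Finset (Finset (Fin n)), ∀ I ⊆ C, Tf I ⊆ I ∧ f I ⊆ C ∧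
        (#(Tf I) : ℝ) ≤ k * (if (C.card : ℝ) ≤ 3 * k * (n.choose (n / 2)) then ((n : ℝ))⁻¹
              else ((n : ℝ) ^ 3)⁻¹) * #C ∧ (#(f I) : ℝ) ≤ (1 - min δ1 δ3) * #C ∧
        (NoKChain k I → I ⊆ f I ∪ Tf I) ∧ f (Tf I) = f I := by
    split_ifs with hsm
    · obtain ⟨Tf, f, h⟩ := H1 C (by simpa using hC)
      refine ⟨Tf, f, fun I hI => ?_⟩
      obtain ⟨h1, h2, h3, h4, h5, h6⟩ := h I hI
      refine ⟨h1, h2, by simpa using h3, ?_, ?_, h6⟩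
      · exact h4.trans (mul_le_mul_of_nonneg_right (by linarith [min_le_left δ1 δ3]) hM)
      · intro hI x hx
        have := h5 hI hx
        simpa using this
    · obtain ⟨Tf, f, h⟩ := H3 C (by
        push Not at hsm
        refine le_trans (le_of_eq ?_) hsm.le
        push_cast; ring)
      refine ⟨Tf, f, fun I hI => ?_⟩
      obtain ⟨h1, h2, h3, h4, h5, h6⟩ := h I hI
      refine ⟨h1, h2, h3, ?_, ?_, h6⟩
      · exact h4.trans (mul_le_mul_of_nonneg_right (by linarith [min_le_right δ1 δ3]) hM)
      · intro hI x hx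
        have := h5 hI hx
        simpa using this
  refine ⟨C.powerset.image f, f, ?_, ?_, ?_, ?_⟩
  · intro C' hC'
    obtain ⟨I, hI, rfl⟩ := Finset.mem_image.1 hC'
    exact (h I (Finset.mem_powerset.1 hI)).2.1
  · intro T hT
    exact Finset.mem_image_of_mem _ (Finset.mem_powerset.2 hT)
  · intro I hI hI0
    obtain ⟨h1, h2, h3, h4, h5, h6⟩ := h I hI
    exact ⟨Tf I, h1, h3, by rw [h6]; exact h5 hI0⟩
  · intro C' hC'
    obtain ⟨I, hI, rfl⟩ := Finset.mem_image.1 hC'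
    exact (h I (Finset.mem_powerset.1 hI)).2.2.2.1
end

section
/- Under the hypotheses of the supersaturation iteration lemma — k ≥ 2, 0 < α < 1, δ > 0 sufficiently small depending on α and k, ℱ ⊆ 𝒫(n) with |ℱ| ≥ (k−1+α)·C(n,⌊n/2⌋), m a real number with δ^{−1} ≤ m ≤ C(|F|,|G|) for all F ⊋ G in ℱ, and ℋ a k-uniform hypergraph on ℱ whose edges are k-chains with e(ℋ) ≤ δ^k m^{k−1} C(n,⌊n/2⌋) and Δ_ℓ(ℋ) ≤ (δm)^{k−ℓ} for all 1 ≤ ℓ ≤ k — suppose additionally that no singleton {F} with F ∈ ℱ is saturated, and let F₁ ∈ ℱ be of minimal cardinality subject to c_k(F₁) ≥ α/k. Then the sum of C(|F₁|,|F₂|)^{−1} ⋯ C(|F_{k−1}|,|F_k|)^{−1} over all bad k-chains F₁ ⊋ F₂ ⊋ ⋯ ⊋ F_k with F₂,…,F_k ∈ ℱ is at most c_k(F₁)/2. -/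
open Finset

/-- The degree of a family `A` of vertices in the hypergraph `H`: the number of edges
of `H` containing `A`. -/
def degH {n : ℕ} (H : Finset (Finset (Finset (Fin n)))) (A : Finset (Finset (Fin n))) : ℕ :=
  (H.filter (fun e => A ⊆ e)).card

/-- `A` is saturated (w.r.t. `H`, `k`, `δ`, `m`): it is nonempty and
`d(A) = ⌊(δm)^{k-|A|}⌋`. -/
def Saturated {n : ℕ} (k : ℕ) (δ m : ℝ) (H : Finset (Finset (Finset (Fin n))))
    (A : Finset (Finset (Fin n))) : Prop :=
  A.Nonempty ∧ degH H A = ⌊(δ * m) ^ (k - A.card)⌋₊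

/-- `B` is bad: it contains a saturated subfamily. `B` is good if it is not bad. -/
def Bad {n : ℕ} (k : ℕ) (δ m : ℝ) (H : Finset (Finset (Finset (Fin n))))
    (B : Finset (Finset (Fin n))) : Prop :=
  ∃ A ⊆ B, Saturated k δ m H A

/-- The weight of a chain tuple `F₁ ⊋ F₂ ⊋ ⋯ ⊋ F_ℓ`: the product
`C(|F₁|,|F₂|)⁻¹ ⋯ C(|F_{ℓ-1}|,|F_ℓ|)⁻¹` of reciprocals of consecutive binomial coefficients. -/
noncomputable def chainWeight {n ℓ : ℕ} (G : Fin ℓ → Finset (Fin n)) : ℝ :=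
  ∏ i : Fin ℓ, if h : (i : ℕ) + 1 < ℓ then
    (((G i).card.choose (G ⟨(i : ℕ) + 1, h⟩).card : ℕ) : ℝ)⁻¹ else 1

open scoped Classical in
/-- The `ℓ`-chain density of `F₁` with respect to the family `𝓕`: the sum of `chainWeight`
over all chains `F₁ ⊋ F₂ ⊋ ⋯ ⊋ F_ℓ` with `F₂, …, F_ℓ ∈ 𝓕`.  In particular the `1`-chain
density is always `1`. -/
noncomputable def chainDensity {n : ℕ} (𝓕 : Finset (Finset (Fin n))) (ℓ : ℕ)
    (F₁ : Finset (Fin n)) : ℝ :=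
  ∑ G : Fin ℓ → Finset (Fin n),
    if (∀ h : 0 < ℓ, G ⟨0, h⟩ = F₁) ∧ (∀ i : Fin ℓ, (i : ℕ) ≠ 0 → G i ∈ 𝓕) ∧
        (∀ i j : Fin ℓ, i < j → G j ⊂ G i)
      then chainWeight G else 0

open scoped Classical in
noncomputable def WW {n : ℕ} (𝓕 : Finset (Finset (Fin n))) (ℓ : ℕ) (F : Finset (Fin n))
    (P : Finset (Finset (Fin n)) → Prop) : ℝ :=
  ∑ G : Fin (ℓ + 1) → Finset (Fin n),
    if (G 0 = F ∧ (∀ i : Fin (ℓ + 1), (i : ℕ) ≠ 0 → G i ∈ 𝓕) ∧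
        (∀ i j : Fin (ℓ + 1), i < j → G j ⊂ G i) ∧ P (Finset.image G Finset.univ))
      then chainWeight G else 0

lemma chainWeight_nonneg' {n ℓ : ℕ} (G : Fin ℓ → Finset (Fin n)) : 0 ≤ chainWeight G := by
  unfold chainWeight
  apply Finset.prod_nonneg
  intro i _
  split_ifs <;> positivity

lemma chainWeight_cons {n ℓ : ℕ} (F : Finset (Fin n)) (G : Fin (ℓ + 1) → Finset (Fin n)) :
    chainWeight (Fin.cons F G : Fin (ℓ + 2) → Finset (Fin n))
      = ((F.card.choose (G 0).card : ℕ) : ℝ)⁻¹ * chainWeight G := by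
  unfold chainWeight
  rw [Fin.prod_univ_succ]
  congr 1
  apply Finset.prod_congr rfl
  intro i _
  by_cases h : (i : ℕ) + 1 < ℓ + 1
  · rw [dif_pos h, dif_pos (by simpa using h)]
    rfl
  · rw [dif_neg h, dif_neg (by simpa using h)]

lemma WW_nonneg {n : ℕ} (𝓕 : Finset (Finset (Fin n))) (ℓ : ℕ) (F : Finset (Fin n))
    (P : Finset (Finset (Fin n)) → Prop) : 0 ≤ WW 𝓕 ℓ F P := by
  unfold WW
  apply Finset.sum_nonneg
  intro G _
  split_ifs
  · exact chainWeight_nonneg' G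
  · exact le_rfl

lemma WW_mono {n : ℕ} (𝓕 : Finset (Finset (Fin n))) (ℓ : ℕ) (F : Finset (Fin n))
    (P Q : Finset (Finset (Fin n)) → Prop) (h : ∀ S, P S → Q S) : WW 𝓕 ℓ F P ≤ WW 𝓕 ℓ F Q := by
  unfold WW
  apply Finset.sum_le_sum
  intro G _
  have := chainWeight_nonneg' G
  split_ifs with h1 h2 h2
  · exact le_rfl
  · exact absurd ⟨h1.1, h1.2.1, h1.2.2.1, h _ h1.2.2.2⟩ h2
  · exact this
  · exact le_rfl

open scoped Classical in
lemma WW_zero {n : ℕ} (𝓕 : Finset (Finset (Fin n))) (F : Finset (Fin n))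
    (P : Finset (Finset (Fin n)) → Prop) : WW 𝓕 0 F P = if P {F} then 1 else 0 := by
  unfold WW
  rw [Finset.sum_eq_single (fun _ => F)]
  · have h1 : (Finset.image (fun _ : Fin (0+1) => F) Finset.univ) = {F} := by
      ext x; simp [eq_comm]
    have h2 : chainWeight (fun _ : Fin (0+1) => F) = 1 := by
      unfold chainWeight; simp
    rw [h1, h2]
    have : ∀ i j : Fin (0+1), i < j → F ⊂ F := by
      intro i j hij; omega
    have h3 : ∀ i : Fin (0+1), (i : ℕ) ≠ 0 → F ∈ 𝓕 := by
      intro i hi; omega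
    apply if_congr _ rfl rfl
    exact ⟨fun h => h.2.2.2, fun h => ⟨rfl, h3, this, h⟩⟩
  · intro G _ hG
    rw [if_neg]
    rintro ⟨h, -⟩
    apply hG
    funext i
    rw [← h]
    congr 1
    exact Subsingleton.elim (α := Fin 1) _ _
  · simp

open scoped Classical in
lemma WW_succ {n : ℕ} (𝓕 : Finset (Finset (Fin n))) (ℓ : ℕ) (F : Finset (Fin n))
    (P : Finset (Finset (Fin n)) → Prop) : WW 𝓕 (ℓ + 1) F P =
      ∑ G ∈ 𝓕.filter (fun G => G ⊂ F), ((F.card.choose G.card : ℕ) : ℝ)⁻¹ *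
        WW 𝓕 ℓ G (fun S => P (insert F S)) := by
  have e1 : WW 𝓕 (ℓ + 1) F P = ∑ g : Fin (ℓ + 1) → Finset (Fin n),
      if (g 0 ∈ 𝓕 ∧ g 0 ⊂ F ∧ (∀ i : Fin (ℓ + 1), (i : ℕ) ≠ 0 → g i ∈ 𝓕) ∧
        (∀ i j : Fin (ℓ + 1), i < j → g j ⊂ g i) ∧ P (insert F (Finset.image g Finset.univ)))
      then ((F.card.choose (g 0).card : ℕ) : ℝ)⁻¹ * chainWeight g else 0 := by
    unfold WW
    rw [← (Fin.consEquiv (fun _ : Fin (ℓ + 2) => Finset (Fin n))).sum_comp,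
      Fintype.sum_prod_type, Finset.sum_eq_single F]
    · apply Finset.sum_congr rfl
      intro g _
      have hc : (Fin.consEquiv (fun _ : Fin (ℓ + 2) => Finset (Fin n))) (F, g)
        = (Fin.cons F g : Fin (ℓ + 2) → Finset (Fin n)) := rfl
      rw [hc, chainWeight_cons]
      have hi : Finset.image (Fin.cons F g : Fin (ℓ + 2) → Finset (Fin n)) Finset.univ
          = insert F (Finset.image g Finset.univ) := by
        ext x
        simp [Fin.exists_fin_succ, eq_comm]
      rw [hi]
      apply if_congr _ rfl rfl
      constructor
      · rintro ⟨-, h1, h2, h3⟩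
        refine ⟨?_, ?_, ?_, ?_, h3⟩
        · simpa using h1 (Fin.succ 0) (by simp)
        · simpa using h2 0 (Fin.succ 0) (by simp)
        · intro i _
          simpa using h1 (Fin.succ i) (by simp)
        · intro i j hij
          simpa using h2 (Fin.succ i) (Fin.succ j) (by simpa using hij)
      · rintro ⟨h0, h1, h2, h3, h4⟩
        have hall : ∀ i : Fin (ℓ + 1), g i ⊆ g 0 := by
          intro i
          rcases eq_or_ne i 0 with rfl | hi
          · exact subset_rfl
          · exact (h3 0 i (Fin.pos_of_ne_zero hi)).1
        refine ⟨rfl, ?_, ?_, h4⟩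
        · intro i
          refine Fin.cases ?_ ?_ i
          · intro h; simp at h
          · intro i _
            simp only [Fin.cons_succ]
            rcases eq_or_ne i 0 with rfl | hi
            · exact h0
            · exact h2 i (by exact fun h => hi (Fin.ext h))
        · intro i j
          refine Fin.cases ?_ ?_ i
          · refine Fin.cases ?_ ?_ j
            · intro h; simp at h
            · intro j _
              simp only [Fin.cons_succ, Fin.cons_zero]
              exact lt_of_le_of_lt (hall j) h1
          · intro i
            refine Fin.cases ?_ ?_ j
            · intro h; simp at h
            · intro j hij
              simp only [Fin.cons_succ]
              exact h3 i j (by simpa using hij)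
    · intro b _ hb
      apply Finset.sum_eq_zero
      intro g _
      rw [if_neg]
      rintro ⟨h, -⟩
      exact hb h
    · simp
  rw [e1]
  have e2 : ∀ g : Fin (ℓ + 1) → Finset (Fin n),
     (if (g 0 ∈ 𝓕 ∧ g 0 ⊂ F ∧ (∀ i : Fin (ℓ + 1), (i : ℕ) ≠ 0 → g i ∈ 𝓕) ∧
        (∀ i j : Fin (ℓ + 1), i < j → g j ⊂ g i) ∧ P (insert F (Finset.image g Finset.univ)))
      then ((F.card.choose (g 0).card : ℕ) : ℝ)⁻¹ * chainWeight g else 0)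
      = ∑ G ∈ 𝓕.filter (fun G => G ⊂ F), ((F.card.choose G.card : ℕ) : ℝ)⁻¹ *
        (if (g 0 = G ∧ (∀ i : Fin (ℓ + 1), (i : ℕ) ≠ 0 → g i ∈ 𝓕) ∧
        (∀ i j : Fin (ℓ + 1), i < j → g j ⊂ g i) ∧ P (insert F (Finset.image g Finset.univ)))
      then chainWeight g else 0) := by
    intro g
    by_cases h : g 0 ∈ 𝓕.filter (fun G => G ⊂ F)
    · rw [Finset.sum_eq_single_of_mem (g 0) h]
      · rw [Finset.mem_filter] at h
        simp [h.1, h.2]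
      · intro b _ hb
        rw [if_neg, mul_zero]
        rintro ⟨h, -⟩
        exact hb h.symm
    · rw [if_neg, Finset.sum_eq_zero]
      · intro b hb
        rw [if_neg, mul_zero]
        rintro ⟨h', -⟩
        exact h (h' ▸ hb)
      · rintro ⟨h0, h1, -⟩
        exact h (Finset.mem_filter.2 ⟨h0, h1⟩)
  rw [Finset.sum_congr rfl (fun g _ => e2 g), Finset.sum_comm]
  apply Finset.sum_congr rfl
  intro G _
  rw [← Finset.mul_sum]
  rfl

/-- number-of-further-elements chain density -/
noncomputable def cc {n : ℕ} (𝓕 : Finset (Finset (Fin n))) (ℓ : ℕ) (F : Finset (Fin n)) : ℝ :=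
  WW 𝓕 ℓ F (fun _ => True)

lemma cc_eq {n : ℕ} (𝓕 : Finset (Finset (Fin n))) (ℓ : ℕ) (F : Finset (Fin n)) :
    chainDensity 𝓕 (ℓ + 1) F = cc 𝓕 ℓ F := by
  unfold chainDensity cc WW
  apply Finset.sum_congr rfl
  intro G _
  split_ifs with ha hb hb
  · rfl
  · exact absurd ⟨ha.1 (Nat.succ_pos _), ha.2.1, ha.2.2, trivial⟩ hb
  · exact absurd ⟨fun _ => hb.1, hb.2.1, hb.2.2.1⟩ ha
  · rfl

lemma cc_nonneg {n : ℕ} (𝓕 : Finset (Finset (Fin n))) (ℓ : ℕ) (F : Finset (Fin n)) :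
    0 ≤ cc 𝓕 ℓ F := WW_nonneg _ _ _ _

lemma cc_zero {n : ℕ} (𝓕 : Finset (Finset (Fin n))) (F : Finset (Fin n)) : cc 𝓕 0 F = 1 := by
  unfold cc; rw [WW_zero]; simp

lemma cc_succ {n : ℕ} (𝓕 : Finset (Finset (Fin n))) (ℓ : ℕ) (F : Finset (Fin n)) :
    cc 𝓕 (ℓ + 1) F = ∑ G ∈ 𝓕.filter (fun G => G ⊂ F), ((F.card.choose G.card : ℕ) : ℝ)⁻¹ *
        cc 𝓕 ℓ G := by
  unfold cc; rw [WW_succ]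

/-- One step of the random maximal chain. -/
lemma cc_step {n : ℕ} (𝓕 : Finset (Finset (Fin n))) (ℓ : ℕ) (F : Finset (Fin n)) :
    (F.card : ℝ) * cc 𝓕 (ℓ + 1) F =
      ∑ x ∈ F, (cc 𝓕 (ℓ + 1) (F.erase x) + if F.erase x ∈ 𝓕 then cc 𝓕 ℓ (F.erase x) else 0) := by
  have e1 : ∀ x ∈ F, (cc 𝓕 (ℓ + 1) (F.erase x) +
      if F.erase x ∈ 𝓕 then cc 𝓕 ℓ (F.erase x) else 0) =
      ∑ G ∈ 𝓕.filter (fun G => G ⊂ F), if x ∉ G then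
        (((F.card - 1).choose G.card : ℕ) : ℝ)⁻¹ * cc 𝓕 ℓ G else 0 := by
    intro x hx
    rw [cc_succ]
    have hc : (F.erase x).card = F.card - 1 := Finset.card_erase_of_mem hx
    rw [hc, ← Finset.sum_filter, Finset.filter_filter]
    have hs : 𝓕.filter (fun G => G ⊂ F ∧ x ∉ G) = 𝓕.filter (fun G => G ⊆ F.erase x) := by
      apply Finset.filter_congr
      intro G _
      rw [Finset.subset_erase]
      constructor
      · rintro ⟨h1, h2⟩; exact ⟨h1.1, h2⟩
      · rintro ⟨h1, h2⟩; exact ⟨⟨h1, fun h => h2 (h hx)⟩, h2⟩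
    rw [hs]
    split_ifs with h
    · have hs2 : 𝓕.filter (fun G => G ⊆ F.erase x) =
        insert (F.erase x) (𝓕.filter (fun G => G ⊂ F.erase x)) := by
        ext G
        simp only [Finset.mem_filter, Finset.mem_insert]
        constructor
        · rintro ⟨h1, h2⟩
          rcases eq_or_ne G (F.erase x) with h3 | h3
          · exact Or.inl h3
          · exact Or.inr ⟨h1, lt_of_le_of_ne h2 h3⟩
        · rintro (rfl | ⟨h1, h2⟩)
          · exact ⟨h, subset_rfl⟩
          · exact ⟨h1, h2.1⟩
      rw [hs2, Finset.sum_insert (by simp), hc]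
      simp
      ring
    · have hs2 : 𝓕.filter (fun G => G ⊆ F.erase x) = 𝓕.filter (fun G => G ⊂ F.erase x) := by
        apply Finset.filter_congr
        intro G hG
        exact ⟨fun h2 => lt_of_le_of_ne h2 (fun h3 => h (h3 ▸ hG)), fun h2 => h2.1⟩
      rw [hs2]; simp
  rw [Finset.sum_congr rfl e1, Finset.sum_comm, cc_succ, Finset.mul_sum]
  apply Finset.sum_congr rfl
  intro G hG
  rw [Finset.mem_filter] at hG
  have hlt := Finset.card_lt_card hG.2
  rw [← Finset.sum_filter, Finset.sum_const]
  have hcard : (F.filter (fun x => x ∉ G)).card = F.card - G.card := by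
    rw [← Finset.card_sdiff_of_subset hG.2.1]
    congr 1
    ext x; simp
  rw [hcard, nsmul_eq_mul, ← mul_assoc, ← mul_assoc]
  congr 1
  obtain ⟨f, hf⟩ : ∃ f, F.card = f + 1 := ⟨F.card - 1, by omega⟩
  rw [hf] at hlt ⊢
  have key2 : (f + 1) * f.choose G.card = (f+1).choose G.card * (f + 1 - G.card) := by
    have := Nat.add_one_mul_choose_eq f G.card; have h3 := Nat.choose_mul_succ_eq f G.card; rw [mul_comm]; exact h3
  have p1 : 0 < f.choose G.card := Nat.choose_pos (by omega)
  have p2 : 0 < (f+1).choose G.card := Nat.choose_pos (by omega)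
  have p1' : (0:ℝ) < f.choose G.card := by exact_mod_cast p1
  have p2' : (0:ℝ) < (f+1).choose G.card := by exact_mod_cast p2
  have key3 : ((f + 1 : ℕ):ℝ) * (f.choose G.card : ℕ) = ((f+1).choose G.card : ℕ) * ((f + 1 - G.card : ℕ) : ℝ) := by
    exact_mod_cast key2
  simp only [Nat.add_sub_cancel]
  rw [← div_eq_mul_inv, ← div_eq_mul_inv, div_eq_div_iff p2'.ne' p1'.ne', key3]
  ring

lemma cc_pos_comb {n : ℕ} (𝓕 : Finset (Finset (Fin n))) (K : ℕ) :
    ∀ (c : ℕ) (F : Finset (Fin n)), F.card = c → ∀ (a : ℕ → ℝ), a (K + 1) = 0 →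
      (∀ N : ℕ, 0 ≤ ∑ i ∈ range (K + 1), a i * (N.choose i : ℝ)) →
      0 ≤ ∑ i ∈ range (K + 1), a i * cc 𝓕 i F := by
  intro c
  induction c with
  | zero =>
    intro F hF a _ ha
    have h0 := ha 0
    rw [Finset.sum_range_succ'] at h0 ⊢
    rw [Finset.card_eq_zero] at hF
    subst hF
    have : ∀ i, cc 𝓕 (i + 1) ∅ = 0 := by
      intro i
      rw [cc_succ]
      apply Finset.sum_eq_zero
      intro G hG
      rw [Finset.mem_filter] at hG
      exact absurd hG.2 (Finset.not_ssubset_empty _)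
    simpa [this, cc_zero] using h0
  | succ c ih =>
    intro F hF a haK ha
    have hpos : (0:ℝ) < F.card := by rw [hF]; positivity
    have h1 : (F.card : ℝ) * ∑ i ∈ range (K + 1), a i * cc 𝓕 i F =
        ∑ x ∈ F, ∑ i ∈ range (K + 1), (if F.erase x ∈ 𝓕 then a i + a (i + 1) else a i) *
          cc 𝓕 i (F.erase x) := by
      have h2 : ∀ x ∈ F, ∑ i ∈ range (K + 1), (if F.erase x ∈ 𝓕 then a i + a (i + 1) else a i) *
          cc 𝓕 i (F.erase x) = ∑ i ∈ range K, a (i + 1) * (cc 𝓕 (i + 1) (F.erase x) +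
            if F.erase x ∈ 𝓕 then cc 𝓕 i (F.erase x) else 0) + a 0 := by
        intro x _
        have h3 : ∑ i ∈ range (K + 1), a i * cc 𝓕 i (F.erase x) =
            ∑ i ∈ range K, a (i + 1) * cc 𝓕 (i + 1) (F.erase x) + a 0 := by
          rw [Finset.sum_range_succ']; simp [cc_zero]
        have h4 : ∑ i ∈ range (K + 1), a (i + 1) * cc 𝓕 i (F.erase x) =
            ∑ i ∈ range K, a (i + 1) * cc 𝓕 i (F.erase x) := by
          rw [Finset.sum_range_succ]; simp [haK]
        split_ifs with h
        · simp only [add_mul, mul_add, Finset.sum_add_distrib]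
          rw [h3, h4]; ring
        · simp only [add_zero]
          exact h3
      rw [Finset.sum_congr rfl h2, Finset.sum_add_distrib, Finset.sum_comm,
        Finset.sum_range_succ', mul_add, Finset.mul_sum]
      congr 1
      · apply Finset.sum_congr rfl
        intro i _
        rw [← Finset.mul_sum, ← cc_step]
        ring
      · simp [cc_zero]
    refine nonneg_of_mul_nonneg_right (h1 ▸ ?_) hpos
    apply Finset.sum_nonneg
    intro x hx
    have hcard : (F.erase x).card = c := by
      rw [Finset.card_erase_of_mem hx, hF]; rfl
    split_ifs with h
    · -- truncated shift
      have hz : ∀ f : ℕ → ℝ, ∑ i ∈ range (K + 1),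
          (if i ≤ K then a i + a (i + 1) else 0) * f i =
          ∑ i ∈ range (K + 1), (a i + a (i + 1)) * f i := by
        intro f
        apply Finset.sum_congr rfl
        intro i hi
        rw [if_pos (by simpa [Nat.lt_succ_iff] using hi)]
      have := ih (F.erase x) hcard (fun i => if i ≤ K then a i + a (i + 1) else 0) (by simp) ?_
      · rwa [hz] at this
      · intro N
        rw [hz]
        have h5 := ha (N + 1)
        rw [Finset.sum_range_succ'] at h5
        simp only [add_mul, Finset.sum_add_distrib]
        rw [Finset.sum_range_succ' (fun i => a i * (N.choose i : ℝ)),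
          Finset.sum_range_succ (fun i => a (i + 1) * (N.choose i : ℝ)), haK]
        simp only [Nat.choose_succ_succ, Nat.cast_add, mul_add, Finset.sum_add_distrib,
          Nat.choose_zero_right] at h5 ⊢
        linarith
    · exact ih (F.erase x) hcard a haK ha

lemma choose_le_aux (K i N : ℕ) (hi : i ≤ K) : N.choose i ≤ 2 ^ K * (1 + N.choose K) := by
  rcases lt_or_ge N K with h | h
  · calc N.choose i ≤ 2 ^ N := Nat.choose_le_two_pow _ _
      _ ≤ 2 ^ K := Nat.pow_le_pow_right (by norm_num) h.le
      _ ≤ _ := Nat.le_mul_of_pos_right _ (by omega)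
  · have h1 := Nat.choose_mul (n := N) (k := K) (s := i) hi
    have h2 : 0 < (N - i).choose (K - i) := Nat.choose_pos (by omega)
    calc N.choose i ≤ N.choose i * (N - i).choose (K - i) := Nat.le_mul_of_pos_right _ h2
      _ = N.choose K * K.choose i := h1.symm
      _ ≤ N.choose K * 2 ^ K := Nat.mul_le_mul_left _ (Nat.choose_le_two_pow _ _)
      _ ≤ _ := by nlinarith [Nat.zero_le (2 ^ K)]

lemma cc_le {n : ℕ} (𝓕 : Finset (Finset (Fin n))) (K i : ℕ) (hi : i ≤ K) (F : Finset (Fin n)) :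
    cc 𝓕 i F ≤ 2 ^ K * (1 + cc 𝓕 K F) := by
  have hz : ∀ f : ℕ → ℝ, ∑ j ∈ range (K + 1), ((if j = 0 then (2:ℝ) ^ K else 0) +
      (if j = K then (2:ℝ) ^ K else 0) - (if j = i then 1 else 0)) * f j
      = 2 ^ K * f 0 + 2 ^ K * f K - f i := by
    intro f
    simp only [sub_mul, add_mul, Finset.sum_sub_distrib, Finset.sum_add_distrib, ite_mul, zero_mul,
      Finset.sum_ite_eq', Finset.mem_range]
    rw [if_pos (by omega), if_pos (by omega), if_pos (by omega)]
    ring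
  have := cc_pos_comb 𝓕 K _ F rfl (fun j => (if j = 0 then (2:ℝ) ^ K else 0) +
      (if j = K then (2:ℝ) ^ K else 0) - (if j = i then 1 else 0))
      (by simp; omega) (by
        intro N
        rw [hz (fun j => (N.choose j : ℝ))]
        have : ((N.choose i : ℕ) : ℝ) ≤ 2 ^ K * (1 + (N.choose K : ℕ)) := by
          exact_mod_cast choose_le_aux K i N hi
        simp only [Nat.choose_zero_right, Nat.cast_one]
        linarith)
  rw [hz (fun j => cc 𝓕 j F), cc_zero] at this
  linarith

open scoped Classical in
lemma count_sat {n k : ℕ} (δ m : ℝ) (H : Finset (Finset (Finset (Fin n)))) (hδm : 1 ≤ δ * m)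
    (hH : ∀ e ∈ H, e.card = k)
    (hdeg : ∀ ℓ : ℕ, 1 ≤ ℓ → ℓ ≤ k → ∀ A : Finset (Finset (Fin n)), A.card = ℓ →
        (degH H A : ℝ) ≤ (δ * m) ^ (k - ℓ))
    (A : Finset (Finset (Fin n))) (hA : A.Nonempty) (hAk : A.card + 1 ≤ k) :
    (((Finset.univ.filter (fun G => G ∉ A ∧ Saturated k δ m H (insert G A))).card : ℕ) : ℝ)
      ≤ 2 * k * (δ * m) := by
  set T := Finset.univ.filter (fun G => G ∉ A ∧ Saturated k δ m H (insert G A)) with hT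
  have h1 : ∑ G ∈ T, degH H (insert G A) ≤ k * degH H A := by
    have : ∀ G ∈ T, degH H (insert G A) =
        ∑ e ∈ H.filter (fun e => A ⊆ e), if G ∈ e then 1 else 0 := by
      intro G _
      rw [← Finset.card_filter, Finset.filter_filter]
      unfold degH
      congr 1
      apply Finset.filter_congr
      intro e _
      rw [Finset.insert_subset_iff, and_comm]
    rw [Finset.sum_congr rfl this, Finset.sum_comm]
    unfold degH
    rw [mul_comm, ← smul_eq_mul]
    apply Finset.sum_le_card_nsmul
    intro e he
    rw [Finset.mem_filter] at he
    rw [← Finset.card_filter, ← hH e he.1]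
    apply Finset.card_le_card
    intro G hG
    exact (Finset.mem_filter.1 hG).2
  have hx : 1 ≤ (δ * m) ^ (k - (A.card + 1)) := one_le_pow₀ hδm
  have h2 : ∀ G ∈ T, (δ * m) ^ (k - (A.card + 1)) / 2 ≤ (degH H (insert G A) : ℝ) := by
    intro G hG
    rw [hT, Finset.mem_filter] at hG
    obtain ⟨-, hGA, -, hs⟩ := hG
    rw [hs, Finset.card_insert_of_notMem hGA]
    set x := (δ * m) ^ (k - (A.card + 1))
    have h3 := Nat.lt_floor_add_one x
    have h4 : 1 ≤ ⌊x⌋₊ := Nat.one_le_floor_iff x |>.2 hx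
    have h5 : (1:ℝ) ≤ ⌊x⌋₊ := by exact_mod_cast h4
    linarith
  have h3 := Finset.card_nsmul_le_sum T _ _ h2
  have h4 : ∑ G ∈ T, (degH H (insert G A) : ℝ) ≤ k * degH H A := by exact_mod_cast h1
  have h5 := hdeg A.card (Finset.card_pos.2 hA) (by omega) A rfl
  have h6 : k - A.card = (k - (A.card + 1)) + 1 := by omega
  rw [h6, pow_succ] at h5
  rw [nsmul_eq_mul] at h3
  set x := (δ * m) ^ (k - (A.card + 1))
  have h7 : (k:ℝ) * degH H A ≤ k * (x * (δ * m)) := mul_le_mul_of_nonneg_left h5 (by positivity)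
  have h8 : (T.card : ℝ) * x ≤ (2 * k * (δ * m)) * x := by nlinarith
  exact le_of_mul_le_mul_right h8 (by linarith)

open scoped Classical in
lemma count_bad {n k : ℕ} (δ m : ℝ) (𝓕 : Finset (Finset (Fin n)))
    (H : Finset (Finset (Finset (Fin n)))) (hδm : 1 ≤ δ * m)
    (hH : ∀ e ∈ H, e.card = k)
    (hdeg : ∀ ℓ : ℕ, 1 ≤ ℓ → ℓ ≤ k → ∀ A : Finset (Finset (Fin n)), A.card = ℓ →
        (degH H A : ℝ) ≤ (δ * m) ^ (k - ℓ))
    (hsing : ∀ F ∈ 𝓕, ¬ Saturated k δ m H {F})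
    (B : Finset (Finset (Fin n))) (hB : ¬ Bad k δ m H B) (hBk : B.card + 1 ≤ k) :
    (((𝓕.filter (fun G => Bad k δ m H (insert G B))).card : ℕ) : ℝ)
      ≤ 2 ^ k * (2 * k * (δ * m)) := by
  have hsub : 𝓕.filter (fun G => Bad k δ m H (insert G B)) ⊆
      (B.powerset.filter (fun A => A.Nonempty)).biUnion
        (fun A => Finset.univ.filter (fun G => G ∉ A ∧ Saturated k δ m H (insert G A))) := by
    intro G hG
    rw [Finset.mem_filter] at hG
    obtain ⟨hGF, A, hAB, hs⟩ := hG
    have hGA : G ∈ A := by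
      by_contra h
      exact hB ⟨A, (Finset.subset_insert_iff_of_notMem h).1 hAB, hs⟩
    have hins : insert G (A.erase G) = A := Finset.insert_erase hGA
    rw [Finset.mem_biUnion]
    refine ⟨A.erase G, ?_, ?_⟩
    · rw [Finset.mem_filter, Finset.mem_powerset]
      refine ⟨Finset.subset_insert_iff.1 hAB, ?_⟩
      rw [Finset.nonempty_iff_ne_empty]
      intro h
      rw [h] at hins
      apply hsing G hGF
      rw [← hins] at hs
      simpa using hs
    · rw [Finset.mem_filter]
      refine ⟨Finset.mem_univ _, Finset.notMem_erase _ _, ?_⟩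
      rwa [hins]
  have h1 := (Finset.card_le_card hsub).trans Finset.card_biUnion_le
  have h2 : (((𝓕.filter (fun G => Bad k δ m H (insert G B))).card : ℕ) : ℝ) ≤
      ∑ A ∈ B.powerset.filter (fun A => A.Nonempty),
        (((Finset.univ.filter (fun G => G ∉ A ∧ Saturated k δ m H (insert G A))).card : ℕ) : ℝ) := by
    exact_mod_cast h1
  refine h2.trans ((Finset.sum_le_card_nsmul _ _ (2 * k * (δ * m)) ?_).trans ?_)
  · intro A hA
    rw [Finset.mem_filter, Finset.mem_powerset] at hA
    have := Finset.card_le_card hA.1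
    exact count_sat δ m H hδm hH hdeg A hA.2 (by omega)
  · rw [nsmul_eq_mul]
    apply mul_le_mul_of_nonneg_right _ (by positivity)
    have h3 : (B.powerset.filter (fun A => A.Nonempty)).card ≤ 2 ^ k := by
      refine (Finset.card_filter_le _ _).trans ?_
      rw [Finset.card_powerset]
      exact Nat.pow_le_pow_right (by norm_num) (by omega)
    exact_mod_cast h3

open scoped Classical in
lemma bad_bound {n k : ℕ} (δ m C ε : ℝ) (𝓕 : Finset (Finset (Fin n)))
    (H : Finset (Finset (Finset (Fin n)))) (F₁ : Finset (Fin n)) (hm : 0 < m) (hC : 0 ≤ C)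
    (hmch : ∀ F ∈ 𝓕, ∀ G ∈ 𝓕, G ⊂ F → m ≤ (F.card.choose G.card : ℝ))
    (hcount : ∀ B : Finset (Finset (Fin n)), ¬ Bad k δ m H B → B.card + 1 ≤ k →
      (((𝓕.filter (fun G => Bad k δ m H (insert G B))).card : ℕ) : ℝ) ≤ ε * m)
    (hCc : ∀ G ∈ 𝓕, G ⊂ F₁ → ∀ i, i + 1 ≤ k → cc 𝓕 i G ≤ C) :
    ∀ (ℓ : ℕ) (F : Finset (Fin n)) (A : Finset (Finset (Fin n))), F ∈ 𝓕 → F ⊆ F₁ →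
      (insert F A).card + ℓ ≤ k → ¬ Bad k δ m H (insert F A) →
      WW 𝓕 ℓ F (fun S => Bad k δ m H (A ∪ S)) ≤ ε * C * ∑ i ∈ range ℓ, cc 𝓕 i F := by
  intro ℓ
  induction ℓ with
  | zero =>
    intro F A _ _ _ hg
    rw [WW_zero, if_neg]
    · simp
    · rwa [Finset.union_comm, ← Finset.insert_eq]
  | succ ℓ ih =>
    intro F A hF hFF hcard hg
    rw [WW_succ]
    have hpt : ∀ G ∈ 𝓕.filter (fun G => G ⊂ F), ((F.card.choose G.card : ℕ) : ℝ)⁻¹ *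
        WW 𝓕 ℓ G (fun S => Bad k δ m H (A ∪ insert F S)) ≤
        (if Bad k δ m H (insert G (insert F A)) then m⁻¹ * C else 0) +
        ((F.card.choose G.card : ℕ) : ℝ)⁻¹ * (if Bad k δ m H (insert G (insert F A)) then 0 else
          ε * C * ∑ i ∈ range ℓ, cc 𝓕 i G) := by
      intro G hG
      rw [Finset.mem_filter] at hG
      have hinv : ((F.card.choose G.card : ℕ) : ℝ)⁻¹ ≤ m⁻¹ :=
        inv_anti₀ hm (hmch F hF G hG.1 hG.2)
      have hGF : G ⊂ F₁ := lt_of_lt_of_le hG.2 hFF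
      have hpos : 0 < (insert F A).card := Finset.card_pos.2 (Finset.insert_nonempty _ _)
      split_ifs with hb
      · rw [mul_zero, add_zero]
        apply mul_le_mul hinv _ (WW_nonneg _ _ _ _) (by positivity)
        exact (WW_mono _ _ _ _ _ (fun _ _ => trivial)).trans (hCc G hG.1 hGF ℓ (by omega))
      · rw [zero_add]
        apply mul_le_mul_of_nonneg_left _ (by positivity)
        refine (WW_mono _ _ _ _ _ ?_).trans (ih G (insert F A) hG.1 hGF.1 ?_ hb)
        · intro S hS
          rwa [Finset.insert_union, ← Finset.union_insert]
        · have := Finset.card_insert_le G (insert F A)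
          omega
    have hcb := hcount (insert F A) hg (by omega)
    have hε : 0 ≤ ε := by
      by_contra h
      have : ε * m < 0 := mul_neg_of_neg_of_pos (by linarith) hm
      have h2 : (0:ℝ) ≤ (((𝓕.filter (fun G => Bad k δ m H (insert G (insert F A)))).card : ℕ) : ℝ) :=
        Nat.cast_nonneg _
      linarith
    refine (Finset.sum_le_sum hpt).trans ?_
    rw [Finset.sum_add_distrib, Finset.sum_range_succ', mul_add, cc_zero, mul_one, add_comm]
    apply add_le_add
    · have h1 : ε * C * ∑ i ∈ range ℓ, cc 𝓕 (i + 1) F = ∑ G ∈ 𝓕.filter (fun G => G ⊂ F),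
          ((F.card.choose G.card : ℕ) : ℝ)⁻¹ * (ε * C * ∑ i ∈ range ℓ, cc 𝓕 i G) := by
        simp only [cc_succ]
        rw [Finset.sum_comm, Finset.mul_sum]
        apply Finset.sum_congr rfl
        intro G _
        rw [← Finset.mul_sum]; ring
      rw [h1]
      apply Finset.sum_le_sum
      intro G _
      apply mul_le_mul_of_nonneg_left _ (by positivity)
      split_ifs
      · exact mul_nonneg (mul_nonneg hε hC) (Finset.sum_nonneg fun i _ => cc_nonneg _ _ _)
      · exact le_rfl
    · rw [← Finset.sum_filter, Finset.sum_const, nsmul_eq_mul, Finset.filter_filter]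
      have h1 : (𝓕.filter (fun G => G ⊂ F ∧ Bad k δ m H (insert G (insert F A)))).card ≤
        (𝓕.filter (fun G => Bad k δ m H (insert G (insert F A)))).card := by
        apply Finset.card_le_card
        intro G hG
        rw [Finset.mem_filter] at hG ⊢
        exact ⟨hG.1, hG.2.2⟩
      have h2 : ((𝓕.filter (fun G => G ⊂ F ∧ Bad k δ m H (insert G (insert F A)))).card : ℝ)
        ≤ ε * m := le_trans (by exact_mod_cast h1) hcb
      calc _ ≤ ε * m * (m⁻¹ * C) := mul_le_mul_of_nonneg_right h2 (by positivity)
        _ = ε * C := by field_simp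

open scoped Classical in
/-- The key step in the proof of the iteration lemma: under its hypotheses, if no singleton from
`𝓕` is saturated and `F₁ ∈ 𝓕` has minimal cardinality subject to `c_k(F₁) ≥ α/k`, then the
weighted number of bad `k`-chains starting at `F₁` is at most `c_k(F₁)/2`. -/
theorem statement17 (k : ℕ) (hk : 2 ≤ k) (α : ℝ) (hα0 : 0 < α) (hα1 : α < 1) :
    ∃ δ₀ : ℝ, 0 < δ₀ ∧ ∀ δ : ℝ, 0 < δ → δ ≤ δ₀ →
      ∀ (n : ℕ) (𝓕 : Finset (Finset (Fin n))) (m : ℝ)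
        (H : Finset (Finset (Finset (Fin n)))),
      ((k : ℝ) - 1 + α) * (n.choose (n / 2)) ≤ (𝓕.card : ℝ) →
      δ⁻¹ ≤ m →
      (∀ F ∈ 𝓕, ∀ G ∈ 𝓕, G ⊂ F → m ≤ (F.card.choose G.card : ℝ)) →
      (∀ e ∈ H, e ⊆ 𝓕 ∧ IsKChain k e) →
      (H.card : ℝ) ≤ δ ^ k * m ^ (k - 1) * (n.choose (n / 2)) →
      (∀ ℓ : ℕ, 1 ≤ ℓ → ℓ ≤ k → ∀ A : Finset (Finset (Fin n)), A.card = ℓ →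
        (degH H A : ℝ) ≤ (δ * m) ^ (k - ℓ)) →
      (∀ F ∈ 𝓕, ¬ Saturated k δ m H {F}) →
      ∀ F₁ ∈ 𝓕, α / k ≤ chainDensity 𝓕 k F₁ →
        (∀ F ∈ 𝓕, α / k ≤ chainDensity 𝓕 k F → F₁.card ≤ F.card) →
        (∑ G : Fin k → Finset (Fin n),
          if (G ⟨0, by omega⟩ = F₁ ∧ (∀ i : Fin k, (i : ℕ) ≠ 0 → G i ∈ 𝓕) ∧
              (∀ i j : Fin k, i < j → G j ⊂ G i) ∧
              Bad k δ m H (Finset.image G Finset.univ))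
            then chainWeight G else 0)
          ≤ chainDensity 𝓕 k F₁ / 2 := by
  obtain ⟨K, rfl⟩ : ∃ K, k = K + 1 := ⟨k - 1, by omega⟩
  set κ : ℝ := ((K + 1 : ℕ) : ℝ) with hκ
  have hκ1 : 1 ≤ κ := by rw [hκ]; exact_mod_cast Nat.succ_pos K
  set D : ℝ := 2 ^ (K + 1) * (2 * κ) * (2 ^ K * 2) * (κ * (2 ^ K * (2 * κ / α))) with hD
  have hDpos : 0 < D := by positivity
  refine ⟨1 / (2 * D), by positivity, ?_⟩
  intro δ hδ0 hδ n 𝓕 m H _ hm hmch hH _ hdeg hsing F₁ hF₁ hc₁ hmin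
  have hmpos : 0 < m := lt_of_lt_of_le (inv_pos.2 hδ0) hm
  have hδm : 1 ≤ δ * m := by
    calc 1 = δ * δ⁻¹ := (mul_inv_cancel₀ hδ0.ne').symm
      _ ≤ δ * m := mul_le_mul_of_nonneg_left hm hδ0.le
  rw [cc_eq] at hc₁ ⊢
  have hακ : α / κ ≤ 1 := by
    rw [div_le_one (by linarith)]; linarith
  set ε : ℝ := 2 ^ (K + 1) * (2 * κ * δ) with hε
  have hmain := bad_bound (k := K + 1) δ m (2 ^ K * 2) ε 𝓕 H F₁ hmpos (by positivity) hmch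
    (by
      intro B hB hBk
      have := count_bad δ m 𝓕 H hδm (fun e he => (hH e he).2.1) hdeg hsing B hB hBk
      calc _ ≤ _ := this
        _ = ε * m := by rw [hε, hκ]; ring)
    (by
      intro G hG hGF i hi
      refine (cc_le 𝓕 K i (by omega) G).trans ?_
      apply mul_le_mul_of_nonneg_left _ (by positivity)
      have : cc 𝓕 K G < α / κ := by
        by_contra h
        have h1 := hmin G hG (by rw [cc_eq]; exact not_lt.1 h)
        have h2 := Finset.card_lt_card hGF
        omega
      linarith)
    K F₁ ∅ hF₁ subset_rfl (by simp; omega) (by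
      rintro ⟨A, hA, hs⟩
      rw [insert_empty_eq, Finset.subset_singleton_iff] at hA
      rcases hA with rfl | rfl
      · exact Finset.not_nonempty_empty hs.1
      · exact hsing F₁ hF₁ hs)
  have hle : ∑ i ∈ range K, cc 𝓕 i F₁ ≤ κ * (2 ^ K * (2 * κ / α)) * cc 𝓕 K F₁ := by
    have h1 : ∀ i ∈ range K, cc 𝓕 i F₁ ≤ (2 ^ K * (2 * κ / α)) * cc 𝓕 K F₁ := by
      intro i hi
      refine (cc_le 𝓕 K i (Finset.mem_range.1 hi).le F₁).trans ?_
      rw [mul_assoc]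
      apply mul_le_mul_of_nonneg_left _ (by positivity)
      have h2 : 1 ≤ κ / α * cc 𝓕 K F₁ := by
        calc 1 = κ / α * (α / κ) := by field_simp
          _ ≤ _ := mul_le_mul_of_nonneg_left hc₁ (by positivity)
      have h3 : 1 ≤ κ / α := by rw [le_div_iff₀ hα0]; linarith
      have h4 : cc 𝓕 K F₁ ≤ κ / α * cc 𝓕 K F₁ := le_mul_of_one_le_left (cc_nonneg _ _ _) h3
      calc _ ≤ κ / α * cc 𝓕 K F₁ + κ / α * cc 𝓕 K F₁ := add_le_add h2 h4
        _ = _ := by ring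
    refine (Finset.sum_le_card_nsmul _ _ _ h1).trans ?_
    rw [nsmul_eq_mul, Finset.card_range, mul_assoc κ]
    apply mul_le_mul_of_nonneg_right
    · rw [hκ]; push_cast; linarith
    · have := cc_nonneg 𝓕 K F₁
      positivity
  have hfin : ε * (2 ^ K * 2) * ∑ i ∈ range K, cc 𝓕 i F₁ ≤ cc 𝓕 K F₁ / 2 := by
    calc _ ≤ ε * (2 ^ K * 2) * (κ * (2 ^ K * (2 * κ / α)) * cc 𝓕 K F₁) :=
          mul_le_mul_of_nonneg_left hle (by positivity)
      _ = (δ * D) * cc 𝓕 K F₁ := by rw [hε, hD]; ring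
      _ ≤ (1 / 2) * cc 𝓕 K F₁ := by
          apply mul_le_mul_of_nonneg_right _ (cc_nonneg _ _ _)
          calc δ * D ≤ 1 / (2 * D) * D := mul_le_mul_of_nonneg_right hδ hDpos.le
            _ = 1 / 2 := by field_simp
      _ = _ := by ring
  refine le_trans (le_of_eq ?_) (hmain.trans hfin)
  unfold WW
  apply Finset.sum_congr rfl
  intro G _
  simp only [Finset.empty_union]
  split_ifs with ha hb hb
  · rfl
  · exact absurd ha hb
  · exact absurd hb ha
  · rfl
end
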